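/- Fix an odd prime power q with q ≡ 1 (mod 4) and an integer r ≥ 0. For d ≥ 1, let N(d) be the number of monic squarefree polynomials f of degree d over F_q, and let N_r(d) be the number of such f for which the subgroup {g ∈ Cl(R_f) : there exists h ∈ Cl(R_f) with h^4 = 1 and g = h^2} of the ideal class group Cl(R_f) of R_f = F_q[x][Y]/(Y^2 − f) has cardinality exactly 2^r. Then the ratio N_r(d)/N(d) converges, as d tends to infinity through odd integers, to μ_S(r) := (2^{r(r−1)/2}/#GL_r(F_2)) · ∏_{k=0}^∞ (1 − 2^{−2k−1}). -/

import Mathlib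

open Polynomial Matrix

/-- The coordinate ring `F_q[x][Y]/(Y² - f)` of the affine hyperelliptic curve `y² = f(x)`. -/
noncomputable abbrev hyperellipticRing {F : Type} [Field F] (f : F[X]) : Type :=
  AdjoinRoot ((X : (F[X])[X]) ^ 2 - Polynomial.C f)

/-- The subgroup `2·Cl(R_f)[4] = {g : ∃ h, h⁴ = 1 ∧ g = h²}` of the ideal class group of
`R_f = F_q[x][Y]/(Y² - f)` has cardinality exactly `2 ^ r`.  (The `IsDomain` hypothesis is
automatically satisfied for squarefree `f` of degree `≥ 1`.) -/
def fourRankEq {F : Type} [Field F] (f : F[X]) (r : ℕ) : Prop :=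
  ∀ [IsDomain (hyperellipticRing f)],
    Nat.card {g : ClassGroup (hyperellipticRing f) |
      ∃ h : ClassGroup (hyperellipticRing f), h ^ 4 = 1 ∧ g = h ^ 2} = 2 ^ r

namespace FourRank

section Symbol

variable {F : Type} [Field F] [Fintype F]

/-- The norm from `F[x]/(P)` is given by the resultant. -/
theorem norm_mk_eq_resultant (P a : F[X]) (hP : Irreducible P) (hm : P.Monic) :
    Algebra.norm F (AdjoinRoot.mk P a) = resultant P a := by
  classical
  have : Fact (Irreducible P) := ⟨hP⟩
  let E := AlgebraicClosure F
  have : FiniteDimensional F (AdjoinRoot P) := hm.finite_adjoinRoot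
  apply (algebraMap F E).injective
  rw [Algebra.norm_eq_prod_embeddings F E]
  have hsp : (P.map (algebraMap F E)).Splits := IsAlgClosed.splits _
  have hinj : Function.Injective (algebraMap F E) := (algebraMap F E).injective
  have h1 := resultant_eq_prod_eval (P.map (algebraMap F E)) (a.map (algebraMap F E))
    a.natDegree (natDegree_map_le) hsp
  rw [natDegree_map, resultant_map_map] at h1
  rw [h1, (hm.map _).leadingCoeff, one_pow, one_mul]
  let pb := AdjoinRoot.powerBasis hP.ne_zero
  have hmin : minpoly F pb.gen = P := by
    have := AdjoinRoot.minpoly_powerBasis_gen hP.ne_zero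
    rw [this, hm.leadingCoeff]; simp
  have hsep : P.Separable := PerfectField.separable_of_irreducible hP
  have hnd : (P.aroots E).Nodup := nodup_roots hsep.map
  have hE : (minpoly F pb.gen).aroots E = P.aroots E := by rw [hmin]
  rw [Fintype.prod_equiv pb.liftEquiv' (fun σ : AdjoinRoot P →ₐ[F] E => σ (AdjoinRoot.mk P a))
    (fun x => (a.map (algebraMap F E)).eval (x : E)) ?_]
  · rw [Finset.prod_mem_multiset _ _ (fun y => (a.map (algebraMap F E)).eval y) (fun _ => rfl),
      Finset.prod_eq_multiset_prod, Multiset.toFinset_val, hE, Multiset.dedup_eq_self.mpr hnd]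
  · intro σ
    have : (pb.liftEquiv' σ : E) = σ (AdjoinRoot.root P) := by
      rw [PowerBasis.liftEquiv'_apply_coe]; rfl
    rw [this, eval_map_algebraMap, ← AdjoinRoot.aeval_eq, Polynomial.aeval_algHom_apply]

open Classical in
/-- The quadratic residue symbol of `a` modulo `b`, extended bimultiplicatively. -/
noncomputable def symb (a b : F[X]) : ℤ := quadraticChar F (resultant a b)

theorem symb_comm (h4 : Fintype.card F % 4 = 1) (a b : F[X]) : symb a b = symb b a := by
  classical
  unfold symb
  have h2 : ringChar F ≠ 2 := fun h => by
    have := FiniteField.even_card_of_char_two h; omega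
  have h1 : quadraticChar F (-1) = 1 := by
    rw [quadraticChar_one_iff_isSquare (by simp), FiniteField.isSquare_neg_one_iff]; omega
  rw [resultant_comm, map_mul, map_pow]
  convert one_mul _
  convert one_pow _

theorem symb_mul_right (a b c : F[X]) (hb : b ≠ 0) (hc : c ≠ 0) :
    symb a (b * c) = symb a b * symb a c := by
  classical
  unfold symb
  rw [natDegree_mul hb hc, resultant_mul_right _ _ _ _ le_rfl, map_mul]

theorem symb_mul_left (a b c : F[X]) (hb : b ≠ 0) (hc : c ≠ 0) :
    symb (b * c) a = symb b a * symb c a := by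
  classical
  unfold symb
  rw [natDegree_mul hb hc, resultant_mul_left _ _ _ _ le_rfl, map_mul]

theorem symb_one_right (a : F[X]) : symb a 1 = 1 := by
  classical
  unfold symb
  rw [natDegree_one, resultant_one_right, pow_zero, map_one]

theorem symb_prod_right {ι : Type*} (s : Finset ι) (a : F[X]) (g : ι → F[X])
    (hg : ∀ i ∈ s, g i ≠ 0) : symb a (∏ i ∈ s, g i) = ∏ i ∈ s, symb a (g i) := by
  classical
  unfold symb
  rw [resultant_prod_right _ _ _ _ le_rfl, map_prod]
  exact Finset.prod_ne_zero_iff.2 fun i hi => leadingCoeff_ne_zero.2 (hg i hi)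

theorem symb_eq_zero_iff (a b : F[X]) (ha : a ≠ 0) : symb a b = 0 ↔ ¬ IsCoprime a b := by
  classical
  unfold symb
  rw [quadraticChar_eq_zero_iff, resultant_eq_zero_iff]
  simp [ha]

theorem symb_trichotomy (a b : F[X]) : symb a b = 0 ∨ symb a b = 1 ∨ symb a b = -1 := by
  classical
  unfold symb
  by_cases h : resultant a b = 0
  · left; rw [h]; simp
  · right; exact quadraticChar_dichotomy h

theorem symb_eq_one_or (a b : F[X]) (ha : a ≠ 0) (h : IsCoprime a b) :
    symb a b = 1 ∨ symb a b = -1 := by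
  rcases symb_trichotomy a b with h' | h'
  · exact absurd h ((symb_eq_zero_iff a b ha).1 h')
  · exact h'

theorem symb_add_mul (c a p : F[X]) (hc : c.Monic) : symb c (a + c * p) = symb c a := by
  classical
  unfold symb
  congr 1
  set N := max (max (a + c * p).natDegree a.natDegree) (p.natDegree + c.natDegree)
  have key : ∀ g : F[X], g.natDegree ≤ N → resultant c g c.natDegree N = resultant c g := by
    intro g hg
    obtain ⟨k, hk⟩ := Nat.exists_eq_add_of_le hg
    rw [hk, resultant_add_right_deg _ _ _ _ _ le_rfl, coeff_natDegree, hc.leadingCoeff, one_pow,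
      one_mul]
  rw [← key (a + c * p) (by simp [N]), ← key a (by simp [N]),
    resultant_add_mul_right _ _ _ _ _ (by simp [N]) le_rfl]

theorem symb_congr (c a b : F[X]) (hc : c.Monic) (h : c ∣ a - b) : symb c a = symb c b := by
  obtain ⟨p, hp⟩ := h
  rw [← symb_add_mul c b p hc, ← hp]; ring_nf

theorem symb_modByMonic (c a : F[X]) (hc : c.Monic) : symb c (a %ₘ c) = symb c a := by
  refine symb_congr _ _ _ hc ?_
  refine ⟨-(a /ₘ c), ?_⟩
  have := modByMonic_add_div a c
  linear_combination this

theorem symb_eq_one_iff (h4 : Fintype.card F % 4 = 1) (P a : F[X]) (hP : Irreducible P)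
    (hm : P.Monic) : symb P a = 1 ↔ ¬ P ∣ a ∧ ∃ h, P ∣ h ^ 2 - a := by
  classical
  have h2 : ringChar F ≠ 2 := fun h => by
    have := FiniteField.even_card_of_char_two h; omega
  have : Fact (Irreducible P) := ⟨hP⟩
  have : FiniteDimensional F (AdjoinRoot P) := hm.finite_adjoinRoot
  have : Finite (AdjoinRoot P) := Module.finite_of_finite F
  have : Fintype (AdjoinRoot P) := Fintype.ofFinite _
  unfold symb
  rw [← norm_mk_eq_resultant P a hP hm]
  set x := AdjoinRoot.mk P a with hx
  have hx0 : x = 0 ↔ P ∣ a := AdjoinRoot.mk_eq_zero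
  have hsq : IsSquare x ↔ ∃ h, P ∣ h ^ 2 - a := by
    constructor
    · rintro ⟨y, hy⟩
      obtain ⟨h, rfl⟩ := AdjoinRoot.mk_surjective y
      refine ⟨h, ?_⟩
      rw [← AdjoinRoot.mk_eq_zero, map_sub, map_pow, ← hx, hy]; ring
    · rintro ⟨h, hh⟩
      refine ⟨AdjoinRoot.mk P h, ?_⟩
      rw [← AdjoinRoot.mk_eq_zero, map_sub, map_pow, ← hx] at hh
      linear_combination -hh
  rw [← hx0, ← hsq]
  by_cases h0 : x = 0
  · simp [h0]
  simp only [h0, not_false_eq_true, true_and]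
  have hn0 : Algebra.norm F x ≠ 0 := Algebra.norm_ne_zero_iff.2 h0
  have hL2 : ringChar (AdjoinRoot P) ≠ 2 := by
    rw [← Algebra.ringChar_eq F (AdjoinRoot P)]; exact h2
  rw [quadraticChar_one_iff_isSquare hn0, FiniteField.isSquare_iff h2 hn0,
    FiniteField.isSquare_iff hL2 h0, ← (algebraMap F (AdjoinRoot P)).injective.eq_iff, map_pow,
    FiniteField.algebraMap_norm_eq_pow, map_one, ← pow_mul]
  have hq : 1 < Fintype.card F := Fintype.one_lt_card
  have hcard : Fintype.card (AdjoinRoot P) = Fintype.card F ^ Module.finrank F (AdjoinRoot P) :=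
    Module.card_eq_pow_finrank
  simp only [Nat.card_eq_fintype_card]
  have hodd : Fintype.card F / 2 * 2 = Fintype.card F - 1 := by omega
  have hoddL : Fintype.card (AdjoinRoot P) / 2 * 2 = Fintype.card (AdjoinRoot P) - 1 := by
    have : Fintype.card (AdjoinRoot P) % 2 = 1 := by
      rw [hcard, Nat.pow_mod]; simp [show Fintype.card F % 2 = 1 by omega]
    omega
  have hdvd : Fintype.card F - 1 ∣ Fintype.card (AdjoinRoot P) - 1 := by
    rw [hcard]; simpa using Nat.sub_dvd_pow_sub_pow (Fintype.card F) 1 (Module.finrank F (AdjoinRoot P))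
  have : (Fintype.card (AdjoinRoot P) - 1) / (Fintype.card F - 1) * (Fintype.card F / 2) =
      Fintype.card (AdjoinRoot P) / 2 := by
    apply Nat.eq_of_mul_eq_mul_right (show 0 < 2 by norm_num)
    rw [mul_assoc, hodd, hoddL, Nat.div_mul_cancel hdvd]
  rw [this]

theorem symb_zero_right (c : F[X]) (hc : 0 < c.natDegree) : symb c 0 = 0 := by
  classical
  unfold symb
  rw [natDegree_zero, resultant_zero_right, zero_pow hc.ne', zero_mul, quadraticChar_zero]

theorem symb_mul_right' (a b c : F[X]) (ha : 0 < a.natDegree) :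
    symb a (b * c) = symb a b * symb a c := by
  by_cases hb : b = 0
  · simp [hb, symb_zero_right a ha]
  by_cases hc : c = 0
  · simp [hc, symb_zero_right a ha]
  exact symb_mul_right a b c hb hc

theorem exists_symb_eq_neg_one_of_irreducible (h4 : Fintype.card F % 4 = 1) (P : F[X])
    (hP : Irreducible P) (hm : P.Monic) : ∃ a, symb P a = -1 := by
  classical
  have h2 : ringChar F ≠ 2 := fun h => by
    have := FiniteField.even_card_of_char_two h; omega
  have : Fact (Irreducible P) := ⟨hP⟩
  have : FiniteDimensional F (AdjoinRoot P) := hm.finite_adjoinRoot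
  have : Finite (AdjoinRoot P) := Module.finite_of_finite F
  obtain ⟨k, hk⟩ := FiniteField.exists_nonsquare h2
  obtain ⟨x, hx⟩ := FiniteField.norm_surjective F (AdjoinRoot P) k
  obtain ⟨a, rfl⟩ := AdjoinRoot.mk_surjective x
  refine ⟨a, ?_⟩
  unfold symb
  rw [← norm_mk_eq_resultant P a hP hm, hx]
  exact quadraticChar_neg_one_iff_not_isSquare.2 hk

theorem exists_symb_eq_neg_one (h4 : Fintype.card F % 4 = 1) (c : F[X]) (hc : c.Monic)
    (hs : Squarefree c) (hd : 0 < c.natDegree) : ∃ u, IsCoprime u c ∧ symb c u = -1 := by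
  obtain ⟨P, hPm, hP, hPc⟩ := Polynomial.exists_monic_irreducible_factor c
    (fun h => by rw [natDegree_eq_zero_of_isUnit h] at hd; exact lt_irrefl _ hd)
  obtain ⟨c', rfl⟩ := hPc
  have hc' : c'.Monic := hPm.of_mul_monic_left hc
  have hcop : IsCoprime P c' := (squarefree_mul_iff.1 hs).1.isCoprime
  obtain ⟨a, ha⟩ := exists_symb_eq_neg_one_of_irreducible h4 P hP hPm
  obtain ⟨s, t, hst⟩ := hcop
  have h1 : symb P (a * (t * c') + s * P) = -1 := by
    rw [← ha]
    refine symb_congr _ _ _ hPm ⟨s - a * s, ?_⟩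
    linear_combination a * hst
  have h2 : symb c' (a * (t * c') + s * P) = 1 := by
    rw [← symb_one_right c']
    refine symb_congr _ _ _ hc' ⟨a * t - t, ?_⟩
    linear_combination hst
  have h3 : symb (P * c') (a * (t * c') + s * P) = -1 := by
    rw [symb_mul_left _ _ _ hP.ne_zero hc'.ne_zero, h1, h2, mul_one]
  refine ⟨_, ?_, h3⟩
  by_contra hcon
  have := (symb_eq_zero_iff _ _ hc.ne_zero).2 (fun h => hcon h.symm)
  rw [h3] at this
  norm_num at this

open Classical in
/-- The monic polynomials of degree `n`. -/
noncomputable def monics (F : Type) [Field F] [Fintype F] (n : ℕ) : Finset F[X] :=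
  Finset.univ.image fun v : Fin n → F => X ^ n + ((degreeLTEquiv F n).symm v : F[X])

theorem mem_monics {n : ℕ} {g : F[X]} : g ∈ monics F n ↔ g.Monic ∧ g.natDegree = n := by
  classical
  unfold monics
  simp only [Finset.mem_image, Finset.mem_univ, true_and]
  constructor
  · rintro ⟨v, rfl⟩
    have h : ((degreeLTEquiv F n).symm v : F[X]).degree < n :=
      mem_degreeLT.1 ((degreeLTEquiv F n).symm v).2
    exact ⟨monic_X_pow_add h, by
      rw [natDegree_add_eq_left_of_degree_lt (by rwa [degree_X_pow]), natDegree_X_pow]⟩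
  · rintro ⟨hm, rfl⟩
    have h : g - X ^ g.natDegree ∈ degreeLT F g.natDegree := by
      rw [mem_degreeLT]
      by_cases h0 : g.natDegree = 0
      · rw [eq_one_of_monic_natDegree_zero hm h0]; simp
      · have := degree_sub_lt_left (p := g) (q := X ^ g.natDegree) (by
          rw [degree_X_pow, degree_eq_natDegree hm.ne_zero]) hm.ne_zero (by
          rw [hm.leadingCoeff, (monic_X_pow _).leadingCoeff])
        rwa [degree_eq_natDegree hm.ne_zero] at this
    refine ⟨degreeLTEquiv F _ ⟨_, h⟩, ?_⟩
    rw [LinearEquiv.symm_apply_apply]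
    simp

theorem card_monics (n : ℕ) : (monics F n).card = Fintype.card F ^ n := by
  classical
  unfold monics
  rw [Finset.card_image_of_injective]
  · simp
  · intro v w h
    exact (degreeLTEquiv F n).symm.injective (Subtype.ext (add_left_cancel h))

theorem sum_symb_monics (h4 : Fintype.card F % 4 = 1) (c : F[X]) (hc : c.Monic)
    (hs : Squarefree c) (hd : 0 < c.natDegree) {n : ℕ} (hn : c.natDegree ≤ n) :
    ∑ g ∈ monics F n, symb c g = 0 := by
  classical
  obtain ⟨u, huc, hu⟩ := exists_symb_eq_neg_one h4 c hc hs hd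
  have hc1 : c ≠ 1 := by rintro rfl; simp at hd
  set φ : F[X] → F[X] := fun g => c * (g /ₘ c) + (u * (g %ₘ c)) %ₘ c with hφ
  have hdeg : ∀ g : F[X], (g %ₘ c).degree < c.degree := fun g => degree_modByMonic_lt g hc
  have hdivmod : ∀ g, φ g /ₘ c = g /ₘ c ∧ φ g %ₘ c = (u * (g %ₘ c)) %ₘ c := by
    intro g
    exact div_modByMonic_unique _ _ hc ⟨by rw [hφ]; ring, hdeg _⟩
  have hinj : Function.Injective φ := by
    intro g g' h
    have h1 := hdivmod g
    have h2 := hdivmod g'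
    rw [h] at h1
    have e1 : g /ₘ c = g' /ₘ c := h1.1.symm.trans h2.1
    have e2 : (u * (g %ₘ c)) %ₘ c = (u * (g' %ₘ c)) %ₘ c := h1.2.symm.trans h2.2
    have e3 : g %ₘ c = g' %ₘ c := by
      have : c ∣ u * (g %ₘ c - g' %ₘ c) := by
        rw [mul_sub]
        rw [← modByMonic_eq_zero_iff_dvd hc, sub_modByMonic, e2, sub_self]
      have h3 := huc.symm.dvd_of_dvd_mul_left this
      exact sub_eq_zero.1 (eq_zero_of_dvd_of_degree_lt h3
        ((degree_sub_le _ _).trans_lt (max_lt (hdeg _) (hdeg _))))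
    rw [← modByMonic_add_div g c, ← modByMonic_add_div g' c, e1, e3]
  have hmaps : ∀ g ∈ monics F n, φ g ∈ monics F n := by
    intro g hg
    rw [mem_monics] at hg ⊢
    have hle : c.degree ≤ g.degree := by
      rw [degree_eq_natDegree hc.ne_zero, degree_eq_natDegree hg.1.ne_zero, hg.2]
      exact_mod_cast hn
    have h1 : (φ g - g).degree < g.degree := by
      have : φ g - g = (u * (g %ₘ c)) %ₘ c - g %ₘ c := by
        have := modByMonic_add_div g c
        rw [hφ]; linear_combination this
      rw [this]
      exact ((degree_sub_le _ _).trans_lt (max_lt (hdeg _) (hdeg _))).trans_le hle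
    have h2 : φ g = g + (φ g - g) := by ring
    constructor
    · rw [h2]; exact hg.1.add_of_left h1
    · rw [h2, natDegree_add_eq_left_of_degree_lt h1, hg.2]
  have hsym : ∀ g, symb c (φ g) = - symb c g := by
    intro g
    rw [← symb_modByMonic c (φ g) hc, (hdivmod g).2, symb_modByMonic _ _ hc, symb_mul_right' _ _ _ hd,
      hu, symb_modByMonic _ _ hc]; ring
  have himg : (monics F n).image φ = monics F n :=
    Finset.eq_of_subset_of_card_le (by
      intro x hx
      obtain ⟨g, hg, rfl⟩ := Finset.mem_image.1 hx
      exact hmaps g hg) (by rw [Finset.card_image_of_injective _ hinj])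
  have key : ∑ g ∈ monics F n, symb c g = - ∑ g ∈ monics F n, symb c g := by
    conv_lhs => rw [← himg, Finset.sum_image (fun _ _ _ _ h => hinj h)]
    rw [← Finset.sum_neg_distrib]
    exact Finset.sum_congr rfl fun g _ => hsym g
  omega

/-- The monic irreducible polynomials of degree `n`. -/
noncomputable def primes (F : Type) [Field F] [Fintype F] (n : ℕ) : Finset F[X] :=
  open Classical in (monics F n).filter Irreducible

theorem mem_primes {n : ℕ} {P : F[X]} :
    P ∈ primes F n ↔ P.Monic ∧ Irreducible P ∧ P.natDegree = n := by
  classical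
  unfold primes
  rw [Finset.mem_filter, mem_monics]; tauto

theorem isCoprime_of_monic_irreducible {F : Type} [Field F] {P Q : F[X]} (hP : P.Monic) (hQ : Q.Monic)
    (hP' : Irreducible P) (hQ' : Irreducible Q) (h : P ≠ Q) : IsCoprime P Q := by
  rcases hP'.isCoprime_or_dvd Q with h1 | h1
  · exact h1
  · exact absurd (eq_of_monic_of_associated hP hQ (hP'.associated_of_dvd hQ' h1)) h

theorem mul_card_primes_le (n : ℕ) : n * (primes F n).card ≤ Fintype.card F ^ n := by
  classical
  rcases Nat.eq_zero_or_pos n with rfl | hn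
  · simp
  have hq : 1 < Fintype.card F := Fintype.one_lt_card
  have hq' : 1 < Fintype.card F ^ n := Nat.one_lt_pow hn.ne' hq
  have hdvd : ∀ P ∈ primes F n, P ∣ (X ^ (Fintype.card F ^ n) - X : F[X]) := by
    intro P hP
    obtain ⟨hm, hi, hd⟩ := mem_primes.1 hP
    have : Fact (Irreducible P) := ⟨hi⟩
    have : FiniteDimensional F (AdjoinRoot P) := hm.finite_adjoinRoot
    have : Finite (AdjoinRoot P) := Module.finite_of_finite F
    have : Fintype (AdjoinRoot P) := Fintype.ofFinite _
    have hfr : Module.finrank F (AdjoinRoot P) = n := by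
      rw [(AdjoinRoot.powerBasis hi.ne_zero).finrank, AdjoinRoot.powerBasis_dim, hd]
    rw [← AdjoinRoot.mk_eq_zero, map_sub, map_pow, AdjoinRoot.mk_X, ← hfr,
      ← Module.card_eq_pow_finrank, FiniteField.pow_card, sub_self]
  have hprod : ∏ P ∈ primes F n, P ∣ (X ^ (Fintype.card F ^ n) - X : F[X]) := by
    refine Finset.prod_dvd_of_coprime ?_ hdvd
    intro P hP Q hQ hPQ
    have hP := mem_primes.1 hP
    have hQ := mem_primes.1 hQ
    exact isCoprime_of_monic_irreducible hP.1 hQ.1 hP.2.1 hQ.2.1 hPQ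
  have hne : (X ^ (Fintype.card F ^ n) - X : F[X]) ≠ 0 := FiniteField.X_pow_card_sub_X_ne_zero F hq'
  have := natDegree_le_of_dvd hprod hne
  rw [FiniteField.X_pow_card_sub_X_natDegree_eq F hq',
    natDegree_prod_of_monic _ _ (fun P hP => (mem_primes.1 hP).1),
    Finset.sum_congr rfl (fun P hP => (mem_primes.1 hP).2.2), Finset.sum_const, smul_eq_mul,
    mul_comm] at this
  exact this

end Symbol

end FourRank

namespace FourRank

section LinearAlgebra

/-- The number of elements of the kernel of a matrix over `F_2`. -/
noncomputable def kerCard {ι κ : Type} [Fintype κ] (C : Matrix ι κ (ZMod 2)) : ℕ :=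
  Nat.card {x : κ → ZMod 2 // C *ᵥ x = 0}

open Classical in
/-- The number of symmetric matrices over `F_2` whose kernel has exactly `2 ^ r` elements. -/
noncomputable def symCount (ι : Type) [Fintype ι] (r : ℕ) : ℕ :=
  (Finset.univ.filter fun C : Matrix ι ι (ZMod 2) => C.IsSymm ∧ kerCard C = 2 ^ r).card

open Classical in
/-- The number of symmetric matrices over `F_2`. -/
noncomputable def symTotal (ι : Type) [Fintype ι] : ℕ :=
  (Finset.univ.filter fun C : Matrix ι ι (ZMod 2) => C.IsSymm).card

theorem card_ker_mul_card_range {V W : Type*} [AddCommGroup V] [AddCommGroup W] [Module (ZMod 2) V]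
    [Module (ZMod 2) W] (f : V →ₗ[ZMod 2] W) :
    Nat.card {x // f x = 0} * Nat.card (LinearMap.range f) = Nat.card V := by
  have h1 := f.toAddMonoidHom.ker.card_mul_index
  rw [AddSubgroup.index_ker] at h1
  exact h1

theorem kerCard_eq_pow {ι κ : Type} [Fintype κ] (C : Matrix ι κ (ZMod 2)) :
    ∃ k, k ≤ Fintype.card κ ∧ kerCard C = 2 ^ k := by
  have h : kerCard C = Nat.card (LinearMap.ker C.mulVecLin) := rfl
  refine ⟨Module.finrank (ZMod 2) (LinearMap.ker C.mulVecLin), ?_, ?_⟩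
  · simpa using Submodule.finrank_le (LinearMap.ker C.mulVecLin)
  · rw [h, Module.natCard_eq_pow_finrank (K := ZMod 2)]; simp

theorem kerCard_reindex {ι κ : Type} [Fintype ι] [Fintype κ] (e : ι ≃ κ)
    (C : Matrix ι ι (ZMod 2)) : kerCard (C.submatrix e.symm e.symm) = kerCard C := by
  refine Nat.card_congr (Equiv.subtypeEquiv (e.arrowCongr (Equiv.refl _)).symm fun x => ?_)
  have hx : (e.arrowCongr (Equiv.refl (ZMod 2))).symm x = x ∘ e := rfl
  rw [hx]
  rw [Matrix.submatrix_mulVec_equiv]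
  constructor
  · intro h; ext i
    have := congrFun h (e i)
    simpa using this
  · intro h; ext i
    have := congrFun h (e.symm i)
    simpa using this

theorem symCount_congr {ι κ : Type} [Fintype ι] [Fintype κ] (e : ι ≃ κ) (r : ℕ) :
    symCount ι r = symCount κ r := by
  classical
  refine Finset.card_bij' (fun C _ => C.submatrix e.symm e.symm) (fun C _ => C.submatrix e e)
    ?_ ?_ ?_ ?_
  · intro C hC
    simp only [Finset.mem_filter, Finset.mem_univ, true_and] at hC ⊢
    exact ⟨hC.1.submatrix _, by rw [kerCard_reindex]; exact hC.2⟩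
  · intro C hC
    simp only [Finset.mem_filter, Finset.mem_univ, true_and] at hC ⊢
    exact ⟨hC.1.submatrix _, by rw [← hC.2]; exact kerCard_reindex e.symm C⟩
  · intro C _; ext; simp
  · intro C _; ext; simp

theorem symTotal_congr {ι κ : Type} [Fintype ι] [Fintype κ] (e : ι ≃ κ) :
    symTotal ι = symTotal κ := by
  classical
  refine Finset.card_bij' (fun C _ => C.submatrix e.symm e.symm) (fun C _ => C.submatrix e e)
    ?_ ?_ ?_ ?_
  · intro C hC
    simp only [Finset.mem_filter, Finset.mem_univ, true_and] at hC ⊢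
    exact hC.submatrix _
  · intro C hC
    simp only [Finset.mem_filter, Finset.mem_univ, true_and] at hC ⊢
    exact hC.submatrix _
  · intro C _; ext; simp
  · intro C _; ext; simp

theorem mem_range_of_forall_ker {ι : Type} [Fintype ι] (C : Matrix ι ι (ZMod 2))
    (hC : C.IsSymm) (b : ι → ZMod 2) (h : ∀ x, C *ᵥ x = 0 → b ⬝ᵥ x = 0) : ∃ y, C *ᵥ y = b := by
  classical
  have h1 : dotProductBilin (ZMod 2) (ZMod 2) b ∈ (LinearMap.ker C.mulVecLin).dualAnnihilator := by
    rw [Submodule.mem_dualAnnihilator]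
    intro x hx
    exact h x hx
  rw [← LinearMap.range_dualMap_eq_dualAnnihilator_ker] at h1
  obtain ⟨ψ, hψ⟩ := h1
  refine ⟨fun i => ψ (Pi.single i 1), ?_⟩
  have hψ' : ∀ v, ψ v = (fun i => ψ (Pi.single i 1)) ⬝ᵥ v := by
    intro v
    conv_lhs => rw [pi_eq_sum_univ' v]
    rw [map_sum]
    simp only [map_smul, dotProduct, smul_eq_mul]
    exact Finset.sum_congr rfl fun i _ => mul_comm _ _
  have key : ∀ x, b ⬝ᵥ x = (C *ᵥ fun i => ψ (Pi.single i 1)) ⬝ᵥ x := by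
    intro x
    have := LinearMap.congr_fun hψ x
    change ψ (C *ᵥ x) = b ⬝ᵥ x at this
    rw [← this, hψ', Matrix.dotProduct_mulVec, ← Matrix.mulVec_transpose, hC.eq]
  ext i
  have := key (Pi.single i 1)
  simpa using this.symm

/-- The bordered matrix with blocks `C`, `b`, `bᵀ`, `c`. -/
def bordered {ι : Type} (C : Matrix ι ι (ZMod 2)) (b : ι → ZMod 2) (c : ZMod 2) :
    Matrix (ι ⊕ Unit) (ι ⊕ Unit) (ZMod 2) :=
  fromBlocks C (Matrix.of fun i _ => b i) (Matrix.of fun _ i => b i) (Matrix.of fun _ _ => c)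

theorem bordered_mulVec_eq_zero {ι : Type} [Fintype ι] (C : Matrix ι ι (ZMod 2))
    (b : ι → ZMod 2) (c : ZMod 2) (x : ι → ZMod 2) (t : ZMod 2) :
    bordered C b c *ᵥ Sum.elim x (fun _ => t) = 0 ↔
      C *ᵥ x + t • b = 0 ∧ b ⬝ᵥ x + c * t = 0 := by
  unfold bordered
  rw [fromBlocks_mulVec]
  have h1 : (Matrix.of fun (i : ι) (_ : Unit) => b i) *ᵥ (fun _ => t) = t • b := by
    ext i; simp [mulVec, dotProduct, mul_comm]
  have h2 : (Matrix.of fun (_ : Unit) (i : ι) => b i) *ᵥ x = fun _ => b ⬝ᵥ x := by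
    ext i; simp [mulVec]
  have h3 : (Matrix.of fun (_ : Unit) (_ : Unit) => c) *ᵥ (fun _ => t) =
      fun _ => c * t := by
    ext i; simp [mulVec, dotProduct]
  simp only [Sum.elim_comp_inl, Sum.elim_comp_inr]
  rw [h1, h2, h3]
  constructor
  · intro h
    constructor
    · ext i; exact congrFun h (Sum.inl i)
    · exact congrFun h (Sum.inr ())
  · rintro ⟨h, h'⟩
    ext (i | i)
    · exact congrFun h i
    · exact h'

theorem kerCard_bordered {ι : Type} [Fintype ι] (C : Matrix ι ι (ZMod 2)) (b : ι → ZMod 2)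
    (c : ZMod 2) : kerCard (bordered C b c) =
      Nat.card {x : ι → ZMod 2 // C *ᵥ x = 0 ∧ b ⬝ᵥ x = 0} +
      Nat.card {x : ι → ZMod 2 // C *ᵥ x = b ∧ b ⬝ᵥ x = c} := by
  classical
  rw [← Nat.card_sum]
  have h2 : ∀ t : ZMod 2, t ≠ 0 → t = 1 := by decide
  have hadd : ∀ s t : ZMod 2, s + t = 0 ↔ s = t := by decide
  have haddv : ∀ s t : ι → ZMod 2, s + t = 0 ↔ s = t := by
    intro s t
    rw [funext_iff, funext_iff]
    exact forall_congr' fun i => hadd _ _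
  symm
  refine Nat.card_congr (Equiv.ofBijective (Sum.elim (fun x => ⟨Sum.elim x.1 (fun _ => 0), ?_⟩)
    (fun x => ⟨Sum.elim x.1 (fun _ => 1), ?_⟩)) ⟨?_, ?_⟩)
  · rw [bordered_mulVec_eq_zero]; simpa using x.2
  · rw [bordered_mulVec_eq_zero]
    simpa [haddv, hadd] using x.2
  · rintro (⟨x, hx⟩ | ⟨x, hx⟩) (⟨y, hy⟩ | ⟨y, hy⟩) h
    · have := congrArg Subtype.val h
      simp only [Sum.elim_inl] at this
      congr 2
      ext i; exact congrFun this (Sum.inl i)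
    · have := congrFun (congrArg Subtype.val h) (Sum.inr ())
      simp at this
    · have := congrFun (congrArg Subtype.val h) (Sum.inr ())
      simp at this
    · have := congrArg Subtype.val h
      simp only [Sum.elim_inr] at this
      congr 2
      ext i; exact congrFun this (Sum.inl i)
  · rintro ⟨z, hz⟩
    obtain ⟨x, t, rfl⟩ : ∃ x t, z = Sum.elim x (fun _ => t) :=
      ⟨z ∘ Sum.inl, z (Sum.inr ()), by ext (i | i) <;> rfl⟩
    have hz' := (bordered_mulVec_eq_zero _ _ _ _ _).1 hz
    by_cases ht : t = 0
    · subst ht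
      exact ⟨Sum.inl ⟨x, by simpa using hz'⟩, rfl⟩
    · obtain rfl := h2 t ht
      exact ⟨Sum.inr ⟨x, by simpa [haddv, hadd] using hz'⟩, rfl⟩

theorem kerCard_bordered_of_not_mem {ι : Type} [Fintype ι] (C : Matrix ι ι (ZMod 2))
    (hC : C.IsSymm) (b : ι → ZMod 2) (c : ZMod 2) (hb : ¬ ∃ y, C *ᵥ y = b) :
    2 * kerCard (bordered C b c) = kerCard C := by
  classical
  rw [kerCard_bordered]
  have h0 : IsEmpty {x : ι → ZMod 2 // C *ᵥ x = b ∧ b ⬝ᵥ x = c} :=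
    ⟨fun x => hb ⟨x.1, x.2.1⟩⟩
  rw [Nat.card_of_isEmpty (α := {x : ι → ZMod 2 // C *ᵥ x = b ∧ b ⬝ᵥ x = c}), add_zero]
  let φ : LinearMap.ker C.mulVecLin →ₗ[ZMod 2] ZMod 2 :=
    (dotProductBilin (ZMod 2) (ZMod 2) b).comp (Submodule.subtype _)
  have h1 := card_ker_mul_card_range φ
  have hsurj : LinearMap.range φ = ⊤ := by
    have : ∃ x, C *ᵥ x = 0 ∧ b ⬝ᵥ x ≠ 0 := by
      by_contra hcon
      push Not at hcon
      exact hb (mem_range_of_forall_ker C hC b hcon)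
    obtain ⟨x, hx, hbx⟩ := this
    have hne : φ ≠ 0 := fun h => hbx (LinearMap.congr_fun h ⟨x, hx⟩)
    exact LinearMap.range_eq_top.2 (LinearMap.surjective hne)
  rw [hsurj] at h1
  have h2 : Nat.card (⊤ : Submodule (ZMod 2) (ZMod 2)) = 2 := by
    rw [Nat.card_congr Submodule.topEquiv.toEquiv]; simp
  rw [h2] at h1
  have h3 : Nat.card {x : ι → ZMod 2 // C *ᵥ x = 0 ∧ b ⬝ᵥ x = 0} = Nat.card {x // φ x = 0} :=
    Nat.card_congr
      { toFun := fun x => ⟨⟨x.1, x.2.1⟩, x.2.2⟩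
        invFun := fun x => ⟨x.1.1, x.1.2, x.2⟩
        left_inv := fun _ => rfl
        right_inv := fun _ => rfl }
  rw [h3, mul_comm, h1]
  rfl

theorem kerCard_bordered_of_mem {ι : Type} [Fintype ι] (C : Matrix ι ι (ZMod 2))
    (hC : C.IsSymm) (y : ι → ZMod 2) (c : ZMod 2) :
    kerCard (bordered C (C *ᵥ y) c) =
      if c = (C *ᵥ y) ⬝ᵥ y then 2 * kerCard C else kerCard C := by
  classical
  rw [kerCard_bordered]
  have hdot : ∀ x, (C *ᵥ y) ⬝ᵥ x = y ⬝ᵥ (C *ᵥ x) := by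
    intro x
    rw [Matrix.dotProduct_mulVec, ← Matrix.mulVec_transpose, hC.eq]
  have h1 : Nat.card {x : ι → ZMod 2 // C *ᵥ x = 0 ∧ (C *ᵥ y) ⬝ᵥ x = 0} = kerCard C := by
    refine Nat.card_congr (Equiv.subtypeEquivRight fun x => ?_)
    rw [hdot]
    constructor
    · exact fun h => h.1
    · intro h; exact ⟨h, by rw [h]; simp⟩
  rw [h1]
  have h3 : ∀ x, C *ᵥ x = C *ᵥ y → (C *ᵥ y) ⬝ᵥ x = (C *ᵥ y) ⬝ᵥ y := by
    intro x hx; rw [hdot, hx, dotProduct_comm]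
  split_ifs with hc
  · rw [two_mul]; congr 1
    refine Nat.card_congr (Equiv.subtypeEquiv (Equiv.subRight y) fun x => ?_)
    rw [Equiv.subRight_apply, mulVec_sub, sub_eq_zero]
    constructor
    · exact fun h => h.1
    · intro h; exact ⟨h, by rw [h3 x h, hc]⟩
  · have : IsEmpty {x : ι → ZMod 2 // C *ᵥ x = C *ᵥ y ∧ (C *ᵥ y) ⬝ᵥ x = c} :=
      ⟨fun x => hc (by rw [← x.2.2, h3 x.1 x.2.1])⟩
    rw [Nat.card_of_isEmpty, add_zero]

end LinearAlgebra

end FourRank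

namespace FourRank

section LinearAlgebra

open Classical in
theorem card_symm_bordered {ι : Type} [Fintype ι] (p : Matrix (ι ⊕ Unit) (ι ⊕ Unit) (ZMod 2) → Prop) :
    (Finset.univ.filter fun D : Matrix (ι ⊕ Unit) (ι ⊕ Unit) (ZMod 2) => D.IsSymm ∧ p D).card =
      ∑ C ∈ Finset.univ.filter (fun C : Matrix ι ι (ZMod 2) => C.IsSymm),
        ∑ b : ι → ZMod 2, ∑ c : ZMod 2, if p (bordered C b c) then 1 else 0 := by
  simp_rw [← Finset.sum_product', Finset.univ_product_univ]
  rw [← Finset.card_filter]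
  refine Finset.card_bij' (fun D _ => (D.toBlocks₁₁, fun i => D (Sum.inl i) (Sum.inr ()),
    D (Sum.inr ()) (Sum.inr ()))) (fun t _ => bordered t.1 t.2.1 t.2.2) ?_ ?_ ?_ ?_
  · intro D hD
    simp only [Finset.mem_filter, Finset.mem_univ, true_and, Finset.mem_product, and_true] at hD ⊢
    refine ⟨?_, ?_⟩
    · ext i j; exact hD.1.apply (Sum.inl i) (Sum.inl j)
    · convert hD.2
      ext (i | i) (j | j)
      · rfl
      · rfl
      · exact hD.1.apply _ _
      · rfl
  · rintro ⟨C, b, c⟩ ht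
    simp only [Finset.mem_filter, Finset.mem_univ, true_and, Finset.mem_product, and_true] at ht ⊢
    refine ⟨?_, ht.2⟩
    ext (i | i) (j | j)
    · exact ht.1.apply i j
    · rfl
    · rfl
    · rfl
  · intro D hD
    simp only [Finset.mem_filter, Finset.mem_univ, true_and] at hD
    ext (i | i) (j | j)
    · rfl
    · rfl
    · exact (hD.1.apply _ _)
    · rfl
  · rintro ⟨C, b, c⟩ ht
    rfl

theorem symTotal_sum_unit (ι : Type) [Fintype ι] :
    (symTotal (ι ⊕ Unit) : ℝ) = 2 ^ (Fintype.card ι + 1) * symTotal ι := by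
  classical
  have h := card_symm_bordered (ι := ι) (fun _ => True)
  simp only [and_true, if_true, Finset.sum_const, Finset.card_univ, smul_eq_mul, mul_one] at h
  have h' : symTotal (ι ⊕ Unit) = symTotal ι * (Fintype.card (ι → ZMod 2) * Fintype.card (ZMod 2)) := by
    unfold symTotal
    convert h
  rw [h']
  push_cast
  simp [pow_succ, mul_comm]

open Classical in
theorem sum_ite_kerCard_bordered {ι : Type} [Fintype ι] (C : Matrix ι ι (ZMod 2))
    (hC : C.IsSymm) (r : ℕ) :
    ((∑ b : ι → ZMod 2, ∑ c : ZMod 2, if kerCard (bordered C b c) = 2 ^ r then 1 else 0 : ℕ) : ℝ) =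
      2 ^ (Fintype.card ι + 1) *
        ((if kerCard C = 2 ^ (r + 1) then 1 - ((2 : ℝ) ^ (r + 1))⁻¹ else 0) +
        (if kerCard C = 2 ^ r then ((2 : ℝ) ^ (r + 1))⁻¹ else 0) +
        (if r = 0 then 0 else if kerCard C = 2 ^ (r - 1) then ((2 : ℝ) ^ r)⁻¹ else 0)) := by
  obtain ⟨k, hkn, hk⟩ := kerCard_eq_pow C
  have hpow : ∀ a b : ℕ, (2 : ℕ) ^ a = 2 ^ b ↔ a = b := fun a b => Nat.pow_right_inj (le_refl 2)
  have hinner : ∀ b : ι → ZMod 2,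
      (∑ c : ZMod 2, if kerCard (bordered C b c) = 2 ^ r then 1 else 0 : ℕ) =
      if (∃ y, C *ᵥ y = b) then ((if r = k + 1 then 1 else 0) + if r = k then 1 else 0)
      else (if k = r + 1 then 2 else 0) := by
    intro b
    have hsum : ∀ g : ZMod 2 → ℕ, ∑ c, g c = g 0 + g 1 := fun g => Fin.sum_univ_two g
    split_ifs with hb
    all_goals try (obtain ⟨y, rfl⟩ := hb)
    all_goals try simp only [kerCard_bordered_of_mem C hC, hk]
    all_goals try rw [hsum]
    · omega
    · have h01 : (C *ᵥ y) ⬝ᵥ y = 0 ∨ (C *ᵥ y) ⬝ᵥ y = 1 := by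
        generalize (C *ᵥ y) ⬝ᵥ y = z; revert z; decide
      subst r
      rcases h01 with h | h <;> simp [h, ← pow_succ', hpow]
    · have h01 : (C *ᵥ y) ⬝ᵥ y = 0 ∨ (C *ᵥ y) ⬝ᵥ y = 1 := by
        generalize (C *ᵥ y) ⬝ᵥ y = z; revert z; decide
      subst r
      rcases h01 with h | h <;> simp [h, ← pow_succ', hpow]
    · have h01 : (C *ᵥ y) ⬝ᵥ y = 0 ∨ (C *ᵥ y) ⬝ᵥ y = 1 := by
        generalize (C *ᵥ y) ⬝ᵥ y = z; revert z; decide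
      rcases h01 with h | h <;> simp [h, ← pow_succ', hpow] <;> omega
    all_goals
      have hcase : ∀ c, kerCard (bordered C b c) = 2 ^ r ↔ k = r + 1 := by
        intro c
        have := kerCard_bordered_of_not_mem C hC b c hb
        rw [hk] at this
        rw [← hpow k, ← this, pow_succ]; omega
      simp_all
  have hR : (Finset.univ.filter fun b : ι → ZMod 2 => ∃ y, C *ᵥ y = b).card * 2 ^ k =
      2 ^ Fintype.card ι := by
    have h1 := card_ker_mul_card_range C.mulVecLin
    have h2 : Nat.card {x // C.mulVecLin x = 0} = 2 ^ k := hk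
    rw [h2] at h1
    have h3 : Nat.card (LinearMap.range C.mulVecLin) =
        (Finset.univ.filter fun b : ι → ZMod 2 => ∃ y, C *ᵥ y = b).card := by
      rw [← Fintype.card_subtype, ← Nat.card_eq_fintype_card]
      rfl
    rw [h3] at h1
    rw [mul_comm, h1]; simp
  simp_rw [hinner]
  rw [Finset.sum_ite, Finset.sum_const, Finset.sum_const]
  have hcompl : (Finset.univ.filter fun b : ι → ZMod 2 => ¬ ∃ y, C *ᵥ y = b).card +
      (Finset.univ.filter fun b : ι → ZMod 2 => ∃ y, C *ᵥ y = b).card = 2 ^ Fintype.card ι := by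
    rw [add_comm, Finset.card_filter_add_card_filter_not]; simp
  generalize (Finset.univ.filter fun b : ι → ZMod 2 => ∃ y, C *ᵥ y = b).card = R at *
  generalize (Finset.univ.filter fun b : ι → ZMod 2 => ¬ ∃ y, C *ᵥ y = b).card = R' at *
  have hRr : (R : ℝ) = 2 ^ Fintype.card ι * ((2 : ℝ) ^ k)⁻¹ := by
    have : (R : ℝ) * 2 ^ k = 2 ^ Fintype.card ι := by exact_mod_cast hR
    rw [← this]; field_simp
  have hR'r : (R' : ℝ) = 2 ^ Fintype.card ι - 2 ^ Fintype.card ι * ((2 : ℝ) ^ k)⁻¹ := by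
    have : (R' : ℝ) + R = 2 ^ Fintype.card ι := by exact_mod_cast hcompl
    rw [← hRr]; linarith
  simp only [hk, hpow, smul_eq_mul]
  push_cast
  rw [hRr, hR'r]
  by_cases h1 : k = r + 1
  · subst h1
    have e1 : r ≠ r + 1 + 1 := by omega
    have e3 : r + 1 ≠ r - 1 := by omega
    simp [e1, e3]
    ring
  by_cases h2 : k = r
  · subst h2
    have e2 : k = 0 ∨ k ≠ k - 1 := by omega
    rcases e2 with e2 | e2
    · subst e2; simp; ring
    · simp [e2]; ring
  by_cases h3 : r = k + 1
  · subst h3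
    simp [h1]
    ring
  · have e1 : ¬ (k = r - 1 ∧ r ≠ 0) := by omega
    have e2 : r ≠ k := fun h => h2 h.symm
    by_cases hr : r = 0
    · subst hr; simp [h1, h2, e2]
    · have e1' : k ≠ r - 1 := fun h => e1 ⟨h, hr⟩
      simp [h1, h2, h3, e2, hr, e1']

theorem symCount_sum_unit (ι : Type) [Fintype ι] (r : ℕ) :
    (symCount (ι ⊕ Unit) r : ℝ) = 2 ^ (Fintype.card ι + 1) *
      ((1 - ((2 : ℝ) ^ (r + 1))⁻¹) * symCount ι (r + 1) + ((2 : ℝ) ^ (r + 1))⁻¹ * symCount ι r +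
        if r = 0 then 0 else ((2 : ℝ) ^ r)⁻¹ * symCount ι (r - 1)) := by
  classical
  have h : symCount (ι ⊕ Unit) r = ∑ C ∈ Finset.univ.filter (fun C : Matrix ι ι (ZMod 2) => C.IsSymm),
      ∑ b : ι → ZMod 2, ∑ c : ZMod 2, if kerCard (bordered C b c) = 2 ^ r then 1 else 0 := by
    unfold symCount
    convert card_symm_bordered (ι := ι) (fun D => kerCard D = 2 ^ r)
  rw [h, Nat.cast_sum, Finset.sum_congr rfl (fun C hC => by
    convert sum_ite_kerCard_bordered C (Finset.mem_filter.1 hC).2 r), ← Finset.mul_sum]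
  congr 1
  have hc : ∀ s, (symCount ι s : ℝ) = ∑ C ∈ Finset.univ.filter (fun C : Matrix ι ι (ZMod 2) => C.IsSymm),
      if kerCard C = 2 ^ s then (1 : ℝ) else 0 := by
    intro s
    rw [← Finset.sum_filter, Finset.filter_filter, Finset.sum_const, nsmul_eq_mul, mul_one]
    unfold symCount
    congr!
  rw [hc, hc, hc, Finset.sum_add_distrib, Finset.sum_add_distrib, Finset.mul_sum, Finset.mul_sum]
  congr 1
  · congr 1
    · exact Finset.sum_congr rfl fun C _ => by split_ifs <;> simp
    · exact Finset.sum_congr rfl fun C _ => by split_ifs <;> simp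
  · split_ifs with hr
    · simp
    · rw [Finset.mul_sum]
      exact Finset.sum_congr rfl fun C _ => by split_ifs <;> simp

end LinearAlgebra

end FourRank

namespace FourRank

section LinearAlgebra

theorem exists_left_inverse_of_mulVec {ι κ : Type} [Fintype ι] [Fintype κ] [DecidableEq κ]
    [DecidableEq ι] (M : Matrix ι κ (ZMod 2)) (hM : ∀ y, M *ᵥ y = 0 → y = 0) :
    ∃ M' : Matrix κ ι (ZMod 2), M' * M = 1 := by
  obtain ⟨g, hg⟩ := LinearMap.exists_leftInverse_of_injective M.mulVecLin
    (LinearMap.ker_eq_bot'.2 hM)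
  refine ⟨LinearMap.toMatrix' g, ?_⟩
  have h := congrArg LinearMap.toMatrix' hg
  rw [LinearMap.toMatrix'_comp, LinearMap.toMatrix'_id] at h
  rw [← h]
  congr 1
  exact (LinearMap.toMatrix'_toLin' M).symm

theorem funext_add_eq_zero {ι : Type} (s t : ι → ZMod 2) : s + t = 0 ↔ s = t := by
  have hadd : ∀ s t : ZMod 2, s + t = 0 ↔ s = t := by decide
  rw [funext_iff, funext_iff]
  exact forall_congr' fun i => hadd _ _

theorem funext_add_self {ι : Type} (s : ι → ZMod 2) : s + s = 0 :=
  (funext_add_eq_zero s s).2 rfl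

theorem kerCard_fromBlocks {α ι κ : Type} [Fintype α] [Fintype ι] [Fintype κ]
    (A : Matrix α α (ZMod 2)) (hA : A.IsSymm) (B : Matrix α ι (ZMod 2))
    (hB : ∀ c, Bᵀ *ᵥ c = 0 → c = 0) (M : Matrix ι κ (ZMod 2)) (hM : ∀ y, M *ᵥ y = 0 → y = 0)
    (S : Matrix α κ (ZMod 2)) (hS : A * S = B * M)
    (hX : ∀ x u, B *ᵥ x = A *ᵥ u → ∃ y, M *ᵥ y = x) (C : Matrix ι ι (ZMod 2)) :
    kerCard (fromBlocks A B Bᵀ C) = kerCard (Mᵀ * C * M + Sᵀ * A * S) := by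
  classical
  obtain ⟨M', hM'⟩ := exists_left_inverse_of_mulVec M hM
  obtain ⟨B', hB'⟩ := exists_left_inverse_of_mulVec Bᵀ hB
  have hBB : B * B'ᵀ = 1 := by
    have := congrArg Matrix.transpose hB'
    simpa [Matrix.transpose_mul] using this
  have hker : ∀ u x, fromBlocks A B Bᵀ C *ᵥ Sum.elim u x = 0 ↔
      A *ᵥ u = B *ᵥ x ∧ Bᵀ *ᵥ u = C *ᵥ x := by
    intro u x
    rw [fromBlocks_mulVec, Sum.elim_comp_inl, Sum.elim_comp_inr, ← funext_add_eq_zero (A *ᵥ u),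
      ← funext_add_eq_zero (Bᵀ *ᵥ u)]
    constructor
    · intro h
      exact ⟨funext fun i => congrFun h (Sum.inl i), funext fun i => congrFun h (Sum.inr i)⟩
    · rintro ⟨h, h'⟩
      ext (i | i)
      · exact congrFun h i
      · exact congrFun h' i
  have hMM : ∀ x u, B *ᵥ x = A *ᵥ u → M *ᵥ (M' *ᵥ x) = x := by
    intro x u h
    obtain ⟨y, rfl⟩ := hX x u h
    rw [mulVec_mulVec y M' M, hM', one_mulVec]
  have hSM : Sᵀ * A = Mᵀ * Bᵀ := by
    have := congrArg Matrix.transpose hS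
    rwa [transpose_mul, transpose_mul, hA.eq] at this
  have hQ : ∀ y, (Mᵀ * C * M + Sᵀ * A * S) *ᵥ y = Mᵀ *ᵥ (C *ᵥ (M *ᵥ y) + Bᵀ *ᵥ (S *ᵥ y)) := by
    intro y
    rw [add_mulVec, mulVec_add, hSM]
    simp only [mulVec_mulVec, Matrix.mul_assoc]
  refine Nat.card_congr (Equiv.ofBijective (fun z => ⟨M' *ᵥ (z.1 ∘ Sum.inr), ?_⟩) ⟨?_, ?_⟩)
  · obtain ⟨z, hz⟩ := z
    obtain ⟨u, x, rfl⟩ : ∃ u x, z = Sum.elim u x :=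
      ⟨z ∘ Sum.inl, z ∘ Sum.inr, by ext (i | i) <;> rfl⟩
    obtain ⟨h1, h2⟩ := (hker _ _).1 hz
    simp only [Sum.elim_comp_inr]
    have hx := hMM x u h1.symm
    rw [hQ, hx, ← h2, mulVec_add, mulVec_mulVec, mulVec_mulVec, ← hSM, ← mulVec_mulVec _ Sᵀ A,
      ← mulVec_mulVec _ Sᵀ A, h1, mulVec_mulVec _ A S, hS, ← mulVec_mulVec, hx]
    exact funext_add_self _
  · rintro ⟨z, hz⟩ ⟨z', hz'⟩ h
    obtain ⟨u, x, rfl⟩ : ∃ u x, z = Sum.elim u x :=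
      ⟨z ∘ Sum.inl, z ∘ Sum.inr, by ext (i | i) <;> rfl⟩
    obtain ⟨u', x', rfl⟩ : ∃ u x, z' = Sum.elim u x :=
      ⟨z' ∘ Sum.inl, z' ∘ Sum.inr, by ext (i | i) <;> rfl⟩
    obtain ⟨h1, h2⟩ := (hker _ _).1 hz
    obtain ⟨h1', h2'⟩ := (hker _ _).1 hz'
    have h := congrArg Subtype.val h
    simp only [Sum.elim_comp_inr] at h
    have hx : x = x' := by rw [← hMM x u h1.symm, ← hMM x' u' h1'.symm, h]
    subst hx
    have : u - u' = 0 := hB _ (by rw [mulVec_sub, h2, h2', sub_self])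
    obtain rfl := sub_eq_zero.1 this
    rfl
  · rintro ⟨y, hy⟩
    set z := C *ᵥ (M *ᵥ y) + Bᵀ *ᵥ (S *ᵥ y) with hz
    have hMz : Mᵀ *ᵥ z = 0 := by rw [← hQ]; exact hy
    have horth : ∀ x u, B *ᵥ x = A *ᵥ u → z ⬝ᵥ x = 0 := by
      intro x u h
      obtain ⟨y', rfl⟩ := hX x u h
      rw [dotProduct_mulVec, ← mulVec_transpose, hMz, zero_dotProduct]
    set ρ := B' *ᵥ z with hρ
    have hzρ : Bᵀ *ᵥ ρ = z := by
      rw [← sub_eq_zero]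
      refine funext fun i => ?_
      have h1 : z ⬝ᵥ (Pi.single i 1 - B'ᵀ *ᵥ (B *ᵥ Pi.single i 1)) = 0 := by
        refine horth _ 0 ?_
        rw [mulVec_sub, mulVec_mulVec _ B B'ᵀ, hBB, one_mulVec, sub_self, mulVec_zero]
      rw [dotProduct_sub, dotProduct_mulVec z B'ᵀ, vecMul_transpose, ← hρ, dotProduct_mulVec ρ B,
        ← mulVec_transpose] at h1
      rw [dotProduct_single_one, dotProduct_single_one, sub_eq_zero] at h1
      rw [Pi.sub_apply, h1, sub_self]; rfl
    have hAρ : A *ᵥ ρ = 0 := by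
      refine funext fun i => ?_
      have h1 : z ⬝ᵥ (B'ᵀ *ᵥ (A *ᵥ Pi.single i 1)) = 0 := by
        refine horth _ (Pi.single i 1) ?_
        rw [mulVec_mulVec _ B B'ᵀ, hBB, one_mulVec]
      rw [dotProduct_mulVec z B'ᵀ, vecMul_transpose, ← hρ, dotProduct_mulVec ρ A,
        ← mulVec_transpose, hA.eq, dotProduct_single_one] at h1
      exact h1
    refine ⟨⟨Sum.elim (S *ᵥ y + ρ) (M *ᵥ y), ?_⟩, ?_⟩
    · rw [hker, mulVec_add, hAρ, add_zero, mulVec_add, hzρ, hz, mulVec_mulVec, hS, mulVec_mulVec]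
      refine ⟨rfl, ?_⟩
      rw [add_comm, add_assoc, funext_add_self, add_zero]
    · apply Subtype.ext
      simp only [Sum.elim_comp_inr]
      rw [mulVec_mulVec, hM', one_mulVec]

open Classical in
theorem card_fromBlocks_mul_symTotal {α ι : Type} [Fintype α] [Fintype ι]
    (A : Matrix α α (ZMod 2)) (hA : A.IsSymm) (B : Matrix α ι (ZMod 2))
    (hB : ∀ c, Bᵀ *ᵥ c = 0 → c = 0) :
    ∃ N, Fintype.card ι ≤ N + Fintype.card α ∧ ∀ r,
      (Finset.univ.filter fun C : Matrix ι ι (ZMod 2) =>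
        C.IsSymm ∧ kerCard (fromBlocks A B Bᵀ C) = 2 ^ r).card * symTotal (Fin N) =
      symCount (Fin N) r * symTotal ι := by
  set X := (LinearMap.range A.mulVecLin).comap B.mulVecLin with hXdef
  set N := Module.finrank (ZMod 2) X with hN
  let bX : Module.Basis (Fin N) (ZMod 2) X := Module.finBasis _ _
  let M : Matrix ι (Fin N) (ZMod 2) := Matrix.of fun i j => (bX j : ι → ZMod 2) i
  have hMy : ∀ y, M *ᵥ y = ((∑ j, y j • bX j : X) : ι → ZMod 2) := by
    intro y
    ext i
    simp [M, mulVec, dotProduct, mul_comm]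
  have hM : ∀ y, M *ᵥ y = 0 → y = 0 := by
    intro y hy
    rw [hMy] at hy
    have := Subtype.ext (a2 := (0 : X)) hy
    exact funext (Fintype.linearIndependent_iff.1 bX.linearIndependent y this)
  have hS' : ∀ j, ∃ s, A *ᵥ s = B *ᵥ (bX j : ι → ZMod 2) := fun j => (bX j).2
  choose s hs using hS'
  let S : Matrix α (Fin N) (ZMod 2) := Matrix.of fun a j => s j a
  have hS : A * S = B * M := by
    ext a j
    exact congrFun (hs j) a
  have hX : ∀ x u, B *ᵥ x = A *ᵥ u → ∃ y, M *ᵥ y = x := by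
    intro x u h
    have hx : x ∈ X := ⟨u, h.symm⟩
    refine ⟨bX.repr ⟨x, hx⟩, ?_⟩
    rw [hMy, bX.sum_repr]
  refine ⟨N, ?_, ?_⟩
  · have h1 := LinearMap.finrank_range_add_finrank_ker B.mulVecLin
    have h2 : Module.finrank (ZMod 2) (LinearMap.range B.mulVecLin) ≤ Fintype.card α := by
      simpa using Submodule.finrank_le (LinearMap.range B.mulVecLin)
    have h3 : Module.finrank (ZMod 2) (LinearMap.ker B.mulVecLin) ≤ N := by
      refine Submodule.finrank_mono ?_
      intro x hx
      exact ⟨0, by rw [LinearMap.mem_ker.1 hx, map_zero]⟩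
    rw [Module.finrank_fintype_fun_eq_card] at h1
    omega
  intro r
  obtain ⟨M', hM'⟩ := exists_left_inverse_of_mulVec M hM
  have hMt : Mᵀ * M'ᵀ = 1 := by rw [← transpose_mul, hM', transpose_one]
  set E := Sᵀ * A * S with hE
  have hEs : E.IsSymm := by
    rw [Matrix.IsSymm, hE, transpose_mul, transpose_mul, transpose_transpose, hA.eq,
      Matrix.mul_assoc]
  let f : Matrix ι ι (ZMod 2) → Matrix (Fin N) (Fin N) (ZMod 2) := fun C => Mᵀ * C * M + E
  have hfs : ∀ C : Matrix ι ι (ZMod 2), C.IsSymm → (f C).IsSymm := by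
    intro C hC
    refine Matrix.IsSymm.add ?_ hEs
    rw [Matrix.IsSymm, transpose_mul, transpose_mul, transpose_transpose, hC.eq, Matrix.mul_assoc]
  set t := (Finset.univ.filter fun C : Matrix ι ι (ZMod 2) => C.IsSymm ∧ f C = 0).card with ht
  have hfib : ∀ D : Matrix (Fin N) (Fin N) (ZMod 2), D.IsSymm →
      (Finset.univ.filter fun C : Matrix ι ι (ZMod 2) => C.IsSymm ∧ f C = D).card = t := by
    intro D hD
    have hG : (M'ᵀ * D * M').IsSymm := by
      rw [Matrix.IsSymm, transpose_mul, transpose_mul, transpose_transpose, hD.eq, Matrix.mul_assoc]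
    have hfG : Mᵀ * (M'ᵀ * D * M') * M = D := by
      rw [Matrix.mul_assoc M'ᵀ, ← Matrix.mul_assoc Mᵀ, hMt, Matrix.one_mul, Matrix.mul_assoc, hM',
        Matrix.mul_one]
    refine Finset.card_bij' (fun C _ => C - M'ᵀ * D * M') (fun C _ => C + M'ᵀ * D * M') ?_ ?_ ?_ ?_
    · intro C hC
      simp only [Finset.mem_filter, Finset.mem_univ, true_and] at hC ⊢
      refine ⟨hC.1.sub hG, ?_⟩
      have := hC.2
      simp only [f] at this ⊢
      rw [Matrix.mul_sub, Matrix.sub_mul, hfG, ← this]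
      abel
    · intro C hC
      simp only [Finset.mem_filter, Finset.mem_univ, true_and] at hC ⊢
      refine ⟨hC.1.add hG, ?_⟩
      have := hC.2
      simp only [f] at this ⊢
      rw [Matrix.mul_add, Matrix.add_mul, hfG, add_right_comm, this, zero_add]
    · intro C _; simp
    · intro C _; simp
  have hcount : ∀ p : Matrix (Fin N) (Fin N) (ZMod 2) → Prop,
      (Finset.univ.filter fun C : Matrix ι ι (ZMod 2) => C.IsSymm ∧ p (f C)).card =
      (Finset.univ.filter fun D : Matrix (Fin N) (Fin N) (ZMod 2) => D.IsSymm ∧ p D).card * t := by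
    intro p
    rw [Finset.card_eq_sum_card_fiberwise (f := f)
      (t := Finset.univ.filter fun D : Matrix (Fin N) (Fin N) (ZMod 2) => D.IsSymm ∧ p D)]
    · rw [← smul_eq_mul, ← Finset.sum_const]
      refine Finset.sum_congr rfl fun D hD => ?_
      simp only [Finset.mem_filter, Finset.mem_univ, true_and] at hD
      rw [← hfib D hD.1, Finset.filter_filter]
      congr 1
      ext C
      simp only [Finset.mem_filter, Finset.mem_univ, true_and]
      constructor
      · exact fun h => ⟨h.1.1, h.2⟩
      · exact fun h => ⟨⟨h.1, by rw [h.2]; exact hD.2⟩, h.2⟩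
    · intro C hC
      simp only [Finset.coe_filter, Finset.mem_univ, true_and, Set.mem_ofPred_eq] at hC ⊢
      exact ⟨hfs C hC.1, hC.2⟩
  have h1 := hcount fun D => kerCard D = 2 ^ r
  have h2 := hcount fun _ => True
  simp only [and_true] at h2
  have h3 : (Finset.univ.filter fun C : Matrix ι ι (ZMod 2) =>
        C.IsSymm ∧ kerCard (fromBlocks A B Bᵀ C) = 2 ^ r) =
      Finset.univ.filter fun C : Matrix ι ι (ZMod 2) => C.IsSymm ∧ kerCard (f C) = 2 ^ r := by
    refine Finset.filter_congr fun C _ => ?_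
    rw [kerCard_fromBlocks A hA B hB M hM S hS hX C]
  have h6 : (Finset.univ.filter fun C : Matrix ι ι (ZMod 2) => C.IsSymm ∧ kerCard (f C) = 2 ^ r).card
      = (Finset.univ.filter fun D : Matrix (Fin N) (Fin N) (ZMod 2) =>
        D.IsSymm ∧ kerCard D = 2 ^ r).card * t := by convert h1
  rw [h3, h6]
  have h4 : symTotal ι = symTotal (Fin N) * t := by unfold symTotal; convert h2
  have h5 : symCount (Fin N) r = (Finset.univ.filter fun D : Matrix (Fin N) (Fin N) (ZMod 2) =>
      D.IsSymm ∧ kerCard D = 2 ^ r).card := by unfold symCount; congr!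
  rw [h4, h5]
  ring

end LinearAlgebra

end FourRank

namespace FourRank

section LinearAlgebra

/-- The number of elements of the kernel over `F_2` of the Laplacian of the weighted graph `E`. -/
noncomputable def lapKer {V : Type} [Fintype V] (E : Matrix V V (ZMod 2)) : ℕ :=
  Nat.card {v : V → ZMod 2 // ∀ p, ∑ q, E p q * (v q + v p) = 0}

theorem lapKer_reindex {V W : Type} [Fintype V] [Fintype W] (e : W ≃ V) (E : Matrix V V (ZMod 2)) :
    lapKer (E.submatrix e e) = lapKer E := by
  refine Nat.card_congr (Equiv.subtypeEquiv (e.arrowCongr (Equiv.refl _)) fun v => ?_)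
  rw [← e.forall_congr_right]
  refine forall_congr' fun p => ?_
  rw [← e.sum_comp]
  simp

open Classical in
/-- The graph matrix with the zero-diagonal condition. -/
noncomputable def alts (κ : Type) [Fintype κ] : Finset (Matrix κ κ (ZMod 2)) :=
  Finset.univ.filter fun γ => γ.IsSymm ∧ ∀ i, γ i i = 0

theorem mem_alts {κ : Type} [Fintype κ] {γ : Matrix κ κ (ZMod 2)} :
    γ ∈ alts κ ↔ γ.IsSymm ∧ ∀ i, γ i i = 0 := by
  classical
  unfold alts; simp

/-- The Laplacian with the row and column of the last vertex removed. -/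
def redLap {V : Type} [Fintype V] [DecidableEq V] (E : Matrix (V ⊕ Unit) (V ⊕ Unit) (ZMod 2)) :
    Matrix V V (ZMod 2) :=
  Matrix.of fun p q => E (Sum.inl p) (Sum.inl q) +
    if p = q then ∑ r, E (Sum.inl p) r else 0

theorem zmod_two_add_self (a : ZMod 2) : a + a = 0 := by revert a; decide

theorem redLap_mulVec {V : Type} [Fintype V] [DecidableEq V]
    (E : Matrix (V ⊕ Unit) (V ⊕ Unit) (ZMod 2)) (w : V → ZMod 2) (p : V) :
    (redLap E *ᵥ w) p = (∑ q, E (Sum.inl p) (Sum.inl q) * (w q + w p)) +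
      E (Sum.inl p) (Sum.inr ()) * w p := by
  simp only [redLap, mulVec, dotProduct, Matrix.of_apply, add_mul, mul_add, ite_mul, zero_mul,
    Finset.sum_add_distrib, Finset.sum_ite_eq, Finset.mem_univ, if_true, Fintype.sum_sum_type,
    Finset.univ_unique, Finset.sum_singleton, Finset.sum_mul]
  rw [add_assoc]

theorem lapKer_sum_unit {V : Type} [Fintype V] [DecidableEq V]
    (E : Matrix (V ⊕ Unit) (V ⊕ Unit) (ZMod 2)) (hE : E.IsSymm) :
    lapKer E = 2 * kerCard (redLap E) := by
  have h2 : 2 * kerCard (redLap E) =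
      Nat.card (ZMod 2 × {x : V → ZMod 2 // redLap E *ᵥ x = 0}) := by
    rw [Nat.card_prod, Nat.card_zmod, kerCard]
  rw [h2, lapKer]
  have hred : ∀ (w : V → ZMod 2) (t : ZMod 2) (p : V),
      ∑ q, E (Sum.inl p) q * ((Sum.elim w (fun _ => 0) q + t) +
        (Sum.elim w (fun _ => 0) (Sum.inl p : V ⊕ Unit) + t)) = (redLap E *ᵥ w) p := by
    intro w t p
    rw [redLap_mulVec, Fintype.sum_sum_type]
    have : ∀ a b : ZMod 2, a + t + (b + t) = a + b := by
      intro a b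
      linear_combination zmod_two_add_self t
    simp only [this]
    simp
  have hlast : ∀ (w : V → ZMod 2), redLap E *ᵥ w = 0 →
      ∑ q, E (Sum.inr ()) (Sum.inl q) * w q = 0 := by
    intro w hw
    have h1 : ∑ p, (redLap E *ᵥ w) p = 0 := by rw [hw]; simp
    simp only [redLap_mulVec, Finset.sum_add_distrib, mul_add] at h1
    have h3 : ∑ p, ∑ q, E (Sum.inl p) (Sum.inl q) * w q =
        ∑ p, ∑ q, E (Sum.inl p) (Sum.inl q) * w p := by
      rw [Finset.sum_comm]
      refine Finset.sum_congr rfl fun p _ => Finset.sum_congr rfl fun q _ => ?_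
      rw [hE.apply]
    rw [h3, zmod_two_add_self, zero_add] at h1
    rw [← h1]
    exact Finset.sum_congr rfl fun q _ => by rw [hE.apply]
  symm
  refine Nat.card_congr
    { toFun := fun x => ⟨fun q => Sum.elim x.2.1 (fun _ => 0) q + x.1, ?_⟩
      invFun := fun v => (v.1 (Sum.inr ()), ⟨fun p => v.1 (Sum.inl p) + v.1 (Sum.inr ()), ?_⟩)
      left_inv := ?_
      right_inv := ?_ }
  · rintro (p | p)
    · rw [hred, x.2.2]; rfl
    · rw [Fintype.sum_sum_type]
      have := hlast x.2.1 x.2.2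
      have h4 : ∀ a : ZMod 2, a + x.1 + (0 + x.1) = a := by
        intro a; linear_combination zmod_two_add_self x.1
      simp only [Sum.elim_inl, Sum.elim_inr, h4, mul_zero, Finset.sum_const_zero, add_zero]
      exact this
  · obtain ⟨v, hv⟩ := v
    ext p
    rw [← hred _ (v (Sum.inr ()))]
    refine Eq.trans ?_ (hv (Sum.inl p))
    refine Finset.sum_congr rfl fun q _ => ?_
    have h5 : ∀ a b : ZMod 2, a + b + b = a := by
        intro a b; linear_combination zmod_two_add_self b
    rcases q with q | q <;> simp [h5]
  · rintro ⟨t, w, hw⟩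
    have h5 : ∀ a : ZMod 2, a + t + t = a := by
        intro a; linear_combination zmod_two_add_self t
    simp [h5]
  · rintro ⟨v, hv⟩
    have h5 : ∀ a b : ZMod 2, a + b + b = a := by
        intro a b; linear_combination zmod_two_add_self b
    ext (q | q) <;> simp [h5]

/-- The symmetric matrix obtained by moving the weights to the last vertex to the diagonal. -/
def moveDiag {ι : Type} [Fintype ι] [DecidableEq ι] (β : ι → ZMod 2)
    (γ : Matrix (ι ⊕ Unit) (ι ⊕ Unit) (ZMod 2)) : Matrix ι ι (ZMod 2) :=
  Matrix.of fun i j => γ (Sum.inl i) (Sum.inl j) +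
    if i = j then β i + ∑ k, γ (Sum.inl i) k else 0

open Classical in
theorem card_alts_moveDiag {ι : Type} [Fintype ι] (β : ι → ZMod 2)
    (p : Matrix ι ι (ZMod 2) → Prop) :
    ((alts (ι ⊕ Unit)).filter fun γ => p (moveDiag β γ)).card =
      (Finset.univ.filter fun C : Matrix ι ι (ZMod 2) => C.IsSymm ∧ p C).card := by
  have h5 : ∀ a b : ZMod 2, a + b + b = a := by
    intro a b; linear_combination zmod_two_add_self b
  have h5' : ∀ a b : ZMod 2, b + (b + a) = a := by
    intro a b; linear_combination zmod_two_add_self b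
  let off : Matrix ι ι (ZMod 2) → Matrix ι ι (ZMod 2) := fun C =>
    Matrix.of fun i j => if i = j then 0 else C i j
  let back : Matrix ι ι (ZMod 2) → Matrix (ι ⊕ Unit) (ι ⊕ Unit) (ZMod 2) := fun C =>
    bordered (off C) (fun i => C i i + (β i + ∑ j, off C i j)) 0
  have hright : ∀ C, moveDiag β (back C) = C := by
    intro C
    ext i j
    by_cases hij : i = j
    · subst hij
      simp only [moveDiag, back, bordered, Matrix.of_apply, fromBlocks_apply₁₁, if_true,
        Fintype.sum_sum_type, fromBlocks_apply₁₂, Finset.univ_unique, Finset.sum_const,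
        Finset.card_singleton, one_smul]
      have : off C i i = 0 := by simp [off]
      rw [this]
      linear_combination zmod_two_add_self (β i) + zmod_two_add_self (∑ j, off C i j)
    · simp [moveDiag, back, bordered, off, hij]
  refine Finset.card_bij' (fun γ _ => moveDiag β γ) (fun C _ => back C) ?_ ?_ ?_ ?_
  · intro γ hγ
    simp only [Finset.mem_filter, Finset.mem_univ, true_and, mem_alts] at hγ ⊢
    refine ⟨?_, hγ.2⟩
    ext i j
    have := hγ.1.1.apply (Sum.inl i) (Sum.inl j)
    by_cases hij : i = j
    · subst hij; rfl
    · have hji : j ≠ i := fun h => hij h.symm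
      simp [moveDiag, hij, hji, this]
  · intro C hC
    simp only [Finset.mem_filter, Finset.mem_univ, true_and, mem_alts] at hC ⊢
    refine ⟨⟨?_, ?_⟩, ?_⟩
    · ext (i | i) (j | j)
      · have := hC.1.apply i j
        by_cases hij : i = j
        · subst hij; rfl
        · have hji : j ≠ i := fun h => hij h.symm
          simp [back, bordered, off, hij, hji, this]
      · rfl
      · rfl
      · rfl
    · rintro (i | i)
      · simp [back, bordered, off]
      · rfl
    · rw [hright]; exact hC.2
  · intro γ hγ
    simp only [Finset.mem_filter, mem_alts] at hγ
    have hoff : ∀ i j, off (moveDiag β γ) i j = γ (Sum.inl i) (Sum.inl j) := by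
      intro i j
      by_cases hij : i = j
      · subst hij; simp [off, hγ.1.2]
      · simp [off, moveDiag, hij]
    have hd : ∀ i, moveDiag β γ i i + (β i + ∑ j, off (moveDiag β γ) i j) =
        γ (Sum.inl i) (Sum.inr ()) := by
      intro i
      simp only [hoff]
      simp only [moveDiag, Matrix.of_apply, if_true, hγ.1.2, Fintype.sum_sum_type,
        Finset.univ_unique, Finset.sum_singleton, PUnit.default_eq_unit]
      linear_combination zmod_two_add_self (β i) +
        zmod_two_add_self (∑ j, γ (Sum.inl i) (Sum.inl j))
    ext (i | i) (j | j)
    · exact hoff i j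
    · exact hd i
    · exact (hd j).trans (hγ.1.1.apply _ _)
    · exact (hγ.1.2 _).symm
  · intro C _
    exact hright C

theorem card_alts_sum_unit (ι : Type) [Fintype ι] : (alts (ι ⊕ Unit)).card = symTotal ι := by
  classical
  have h := card_alts_moveDiag (ι := ι) 0 (fun _ => True)
  simp only [and_true, Finset.filter_true] at h
  rw [h]; unfold symTotal; congr!

open Classical in
theorem card_alts_lapKer_sum_unit {α ι : Type} [Fintype α] [Fintype ι]
    (a : Matrix α α (ZMod 2)) (ha : a.IsSymm) (b : Matrix α (ι ⊕ Unit) (ZMod 2))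
    (hb : ∀ c : α → ZMod 2, c ≠ 0 → ∃ i j, i ≠ j ∧ (bᵀ *ᵥ c) i ≠ 0 ∧ (bᵀ *ᵥ c) j ≠ 0) :
    ∃ N, Fintype.card ι ≤ N + Fintype.card α ∧ ∀ r,
      ((alts (ι ⊕ Unit)).filter fun γ => lapKer (fromBlocks a b bᵀ γ) = 2 ^ (r + 1)).card *
        symTotal (Fin N) = symCount (Fin N) r * (alts (ι ⊕ Unit)).card := by
  let B : Matrix α ι (ZMod 2) := b.submatrix id Sum.inl
  let A : Matrix α α (ZMod 2) := Matrix.of fun p q => a p q +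
    if p = q then ∑ p', a p p' + ∑ k, b p k else 0
  have hA : A.IsSymm := by
    ext p q
    have := ha.apply p q
    by_cases hpq : p = q
    · subst hpq; rfl
    · have hqp : q ≠ p := fun h => hpq h.symm
      simp [A, hpq, hqp, this]
  have hB : ∀ c, Bᵀ *ᵥ c = 0 → c = 0 := by
    intro c hc
    by_contra hne
    obtain ⟨i, j, hij, hi, hj⟩ := hb c hne
    have hz : ∀ k, (bᵀ *ᵥ c) (Sum.inl k) = 0 := fun k => congrFun hc k
    rcases i with i | i
    · exact hi (hz i)
    · rcases j with j | j
      · exact hj (hz j)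
      · exact hij rfl
  obtain ⟨N, hN, hcard⟩ := card_fromBlocks_mul_symTotal A hA B hB
  refine ⟨N, hN, fun r => ?_⟩
  rw [card_alts_sum_unit, ← hcard r]
  congr 1
  refine Eq.trans ?_ ((card_alts_moveDiag (fun i => ∑ p, b p (Sum.inl i))
    (fun C => kerCard (fromBlocks A B Bᵀ C) = 2 ^ r)).trans (by congr!))
  congr 1
  ext γ
  simp only [Finset.mem_filter]
  refine and_congr_right fun hγ => ?_
  rw [mem_alts] at hγ
  have hlap : lapKer (fromBlocks a b bᵀ γ) =
      2 * kerCard (fromBlocks A B Bᵀ (moveDiag (fun i => ∑ p, b p (Sum.inl i)) γ)) := by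
    rw [← lapKer_reindex (Equiv.sumAssoc α ι Unit), lapKer_sum_unit]
    · congr 2
      ext (p | p) (q | q)
      · simp only [redLap, Matrix.of_apply, Matrix.submatrix_apply, fromBlocks_apply₁₁, A]
        simp only [Fintype.sum_sum_type, Sum.inl.injEq, Equiv.sumAssoc_apply_inl_inl,
          Equiv.sumAssoc_apply_inl_inr, Equiv.sumAssoc_apply_inr, fromBlocks_apply₁₁,
          fromBlocks_apply₁₂, add_assoc]
      · simp [redLap, B]
      · simp [redLap, B]
      · simp only [redLap, Matrix.of_apply, Matrix.submatrix_apply, fromBlocks_apply₂₂, moveDiag]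
        simp only [Fintype.sum_sum_type, Sum.inr.injEq, Equiv.sumAssoc_apply_inl_inl,
          Equiv.sumAssoc_apply_inl_inr, Equiv.sumAssoc_apply_inr, fromBlocks_apply₂₂,
          fromBlocks_apply₂₁, add_assoc, Matrix.transpose_apply]
    · rw [Matrix.IsSymm, Matrix.transpose_submatrix, Matrix.fromBlocks_transpose, ha.eq, hγ.1.eq,
        Matrix.transpose_transpose]
  rw [hlap, pow_succ']
  omega

open Classical in
/-- For a random graph on the vertices `κ` attached to a fixed graph on `α`, the kernel of the
Laplacian is distributed like the kernel of a random symmetric matrix. -/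
theorem card_alts_lapKer {α κ : Type} [Fintype α] [Fintype κ] [Nonempty κ]
    (a : Matrix α α (ZMod 2)) (ha : a.IsSymm) (b : Matrix α κ (ZMod 2))
    (hb : ∀ c : α → ZMod 2, c ≠ 0 → ∃ i j, i ≠ j ∧ (bᵀ *ᵥ c) i ≠ 0 ∧ (bᵀ *ᵥ c) j ≠ 0) :
    ∃ N, Fintype.card κ ≤ N + Fintype.card α + 1 ∧ ∀ r,
      ((alts κ).filter fun γ => lapKer (fromBlocks a b bᵀ γ) = 2 ^ (r + 1)).card *
        symTotal (Fin N) = symCount (Fin N) r * (alts κ).card := by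
  obtain ⟨k₀⟩ := ‹Nonempty κ›
  have hcardpos : 0 < Fintype.card κ := Fintype.card_pos_iff.2 ⟨k₀⟩
  let e : Fin (Fintype.card κ - 1) ⊕ Unit ≃ κ := Fintype.equivOfCardEq (by simp; omega)
  obtain ⟨N, hN, h⟩ := card_alts_lapKer_sum_unit a ha (b.submatrix id e) (by
    intro c hc
    obtain ⟨i, j, hij, hi, hj⟩ := hb c hc
    refine ⟨e.symm i, e.symm j, fun h => hij (e.symm.injective h), ?_, ?_⟩
    · convert hi
      simp [mulVec, dotProduct]
    · convert hj
      simp [mulVec, dotProduct])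
  refine ⟨N, by simp at hN; omega, fun r => ?_⟩
  have hbij : ∀ p : Matrix κ κ (ZMod 2) → Prop, ((alts κ).filter p).card =
      ((alts (Fin (Fintype.card κ - 1) ⊕ Unit)).filter
        fun γ => p (γ.submatrix e.symm e.symm)).card := by
    intro p
    refine Finset.card_bij' (fun γ _ => γ.submatrix e e) (fun γ _ => γ.submatrix e.symm e.symm)
      ?_ ?_ ?_ ?_
    · intro γ hγ
      simp only [Finset.mem_filter, mem_alts] at hγ ⊢
      exact ⟨⟨hγ.1.1.submatrix _, fun i => hγ.1.2 _⟩, by simpa using hγ.2⟩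
    · intro γ hγ
      simp only [Finset.mem_filter, mem_alts] at hγ ⊢
      exact ⟨⟨hγ.1.1.submatrix _, fun i => hγ.1.2 _⟩, by simpa using hγ.2⟩
    · intro γ _; ext; simp
    · intro γ _; ext; simp
  have h1 : (alts κ).card = (alts (Fin (Fintype.card κ - 1) ⊕ Unit)).card := by
    have := hbij fun _ => True
    simpa using this
  rw [h1, ← h r]
  congr 1
  refine Eq.trans (by congr!) ((hbij fun γ => lapKer (fromBlocks a b bᵀ γ) = 2 ^ (r + 1)).trans ?_)
  congr 1
  ext γ
  simp only [Finset.mem_filter]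
  refine and_congr_right fun _ => ?_
  rw [← lapKer_reindex (Equiv.sumCongr (Equiv.refl α) e)]
  have : (fromBlocks a b bᵀ (γ.submatrix e.symm e.symm)).submatrix
      (Equiv.sumCongr (Equiv.refl α) e) (Equiv.sumCongr (Equiv.refl α) e) =
      fromBlocks a (b.submatrix id e) (b.submatrix id e)ᵀ γ := by
    ext (i | i) (j | j) <;> simp
  rw [this]

end LinearAlgebra

end FourRank

namespace FourRank

section Limit

open Filter Topology

/-- The product of `1 - 4⁻ⁱ` for `1 ≤ i ≤ m`. -/
noncomputable def evenProd (m : ℕ) : ℝ := ∏ i ∈ Finset.range m, (1 - ((4 : ℝ) ^ (i + 1))⁻¹)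

/-- The product of `1 - 2⁻ⁱ` over the first `m` odd numbers `i`. -/
noncomputable def oddProd (m : ℕ) : ℝ :=
  ∏ i ∈ Finset.range m, (1 - ((2 : ℝ) ^ (2 * i + 1))⁻¹)

/-- The product of `1 - 2⁻ⁱ` for `1 ≤ i ≤ N`. -/
noncomputable def fullProd (N : ℕ) : ℝ := ∏ i ∈ Finset.range N, (1 - ((2 : ℝ) ^ (i + 1))⁻¹)

/-- The product of `2ⁱ - 1` for `1 ≤ i ≤ r`. -/
noncomputable def mersProd (r : ℕ) : ℝ := ∏ i ∈ Finset.range r, ((2 : ℝ) ^ (i + 1) - 1)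

/-- Inverses of `evenProd`, each repeated twice, with a zero in front. -/
noncomputable def invEven : ℕ → ℝ
  | 0 => 0
  | m + 1 => (evenProd (m / 2))⁻¹

theorem evenProd_ge (m : ℕ) : 2 / 3 + 1 / 3 * ((4 : ℝ) ^ m)⁻¹ ≤ evenProd m := by
  induction m with
  | zero => norm_num [evenProd]
  | succ m ih =>
    unfold evenProd at ih ⊢
    rw [Finset.prod_range_succ]
    set x : ℝ := ((4 : ℝ) ^ m)⁻¹ with hx
    have hx0 : 0 < x := by positivity
    have hx1 : x ≤ 1 := inv_le_one_of_one_le₀ (one_le_pow₀ (by norm_num))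
    have h4 : ((4 : ℝ) ^ (m + 1))⁻¹ = x / 4 := by rw [pow_succ, mul_inv, hx]; ring
    rw [h4]
    have : (2 / 3 + 1 / 3 * x) * (1 - x / 4) ≤
        (∏ i ∈ Finset.range m, (1 - ((4 : ℝ) ^ (i + 1))⁻¹)) * (1 - x / 4) :=
      mul_le_mul_of_nonneg_right ih (by linarith)
    nlinarith

theorem evenProd_pos (m : ℕ) : 0 < evenProd m :=
  lt_of_lt_of_le (by positivity) (evenProd_ge m)

theorem mersProd_pos (r : ℕ) : 0 < mersProd r :=
  Finset.prod_pos fun i _ => by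
    have : (1 : ℝ) < 2 ^ (i + 1) := one_lt_pow₀ (by norm_num) (by omega)
    linarith

theorem invEven_rec (m : ℕ) :
    2 * (1 - ((2 : ℝ) ^ m)⁻¹) * invEven (m + 1) = invEven m + invEven (m - 1) := by
  match m with
  | 0 => simp [invEven]
  | 1 => norm_num [invEven, evenProd]
  | m + 2 =>
    obtain ⟨k, hk | hk⟩ := Nat.even_or_odd' m
    · have h1 : (m + 2) / 2 = k + 1 := by omega
      have h2 : (m + 1) / 2 = k := by omega
      have h3 : m / 2 = k := by omega
      simp only [invEven, h1, h2, h3, show m + 2 - 1 = m + 1 from rfl]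
      have h4 : evenProd (k + 1) = evenProd k * (1 - ((2 : ℝ) ^ (m + 2))⁻¹) := by
        unfold evenProd
        rw [Finset.prod_range_succ, hk, show 2 * k + 2 = 2 * (k + 1) by ring, pow_mul]
        norm_num
      have h5 := (evenProd_pos (k + 1)).ne'
      rw [h4] at h5 ⊢
      have h6 := left_ne_zero_of_mul h5
      have h7 := right_ne_zero_of_mul h5
      set y : ℝ := ((2 : ℝ) ^ (m + 2))⁻¹
      field_simp
      norm_num
    · have h1 : (m + 2) / 2 = k + 1 := by omega
      have h2 : (m + 1) / 2 = k + 1 := by omega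
      have h3 : m / 2 = k := by omega
      simp only [invEven, h1, h2, h3, show m + 2 - 1 = m + 1 from rfl]
      have h4 : evenProd (k + 1) = evenProd k * (2 * (1 - ((2 : ℝ) ^ (m + 2))⁻¹) - 1) := by
        unfold evenProd
        rw [Finset.prod_range_succ, hk, show 2 * k + 1 + 2 = 2 * (k + 1) + 1 by ring,
          pow_succ 2 (2 * (k + 1)), pow_mul, show (2 : ℝ) ^ 2 = 4 by norm_num, mul_inv]
        ring
      have h5 := (evenProd_pos (k + 1)).ne'
      rw [h4] at h5 ⊢
      have h6 := left_ne_zero_of_mul h5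
      have h7 := right_ne_zero_of_mul h5
      set y : ℝ := ((2 : ℝ) ^ (m + 2))⁻¹
      field_simp
      ring

theorem symTotal_fin_succ (N : ℕ) :
    (symTotal (Fin (N + 1)) : ℝ) = 2 ^ (N + 1) * symTotal (Fin N) := by
  rw [symTotal_congr (Fintype.equivOfCardEq (by simp) : Fin (N + 1) ≃ Fin N ⊕ Unit),
    symTotal_sum_unit, Fintype.card_fin]

theorem symTotal_fin_pos (N : ℕ) : (0 : ℝ) < symTotal (Fin N) := by
  induction N with
  | zero =>
    have : 0 < symTotal (Fin 0) := Finset.card_pos.2 ⟨0, by simp⟩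
    exact_mod_cast this
  | succ N ih => rw [symTotal_fin_succ]; positivity

theorem symCount_fin_zero (r : ℕ) :
    (symCount (Fin 0) r : ℝ) = if r = 0 then (symTotal (Fin 0) : ℝ) else 0 := by
  unfold symCount symTotal
  have h : ∀ C : Matrix (Fin 0) (Fin 0) (ZMod 2), kerCard C = 1 := by
    intro C
    obtain ⟨k, hk, h⟩ := kerCard_eq_pow C
    rw [Fintype.card_fin, Nat.le_zero] at hk
    rw [h, hk, pow_zero]
  simp only [h]
  by_cases hr : r = 0
  · simp [hr]
  · have : ¬ (1 = 2 ^ r) := by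
      have := Nat.one_lt_two_pow hr
      omega
    simp [hr, this]

theorem symCount_fin (N r : ℕ) : (symCount (Fin N) r : ℝ) * mersProd r =
    fullProd N * invEven (N + 1 - r) * symTotal (Fin N) := by
  induction N generalizing r with
  | zero =>
    rw [symCount_fin_zero]
    rcases r with _ | r
    · simp [mersProd, fullProd, invEven, evenProd]
    · have : 0 + 1 - (r + 1) = 0 := by omega
      rw [this]; simp [invEven]
  | succ N ih =>
    rw [symCount_congr (Fintype.equivOfCardEq (by simp) : Fin (N + 1) ≃ Fin N ⊕ Unit),
      symCount_sum_unit, Fintype.card_fin, symTotal_fin_succ]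
    have hF : fullProd (N + 1) = fullProd N * (1 - ((2 : ℝ) ^ (N + 1))⁻¹) := by
      unfold fullProd; rw [Finset.prod_range_succ]
    have hM : ∀ s, mersProd (s + 1) = mersProd s * ((2 : ℝ) ^ (s + 1) - 1) := fun s => by
      unfold mersProd; rw [Finset.prod_range_succ]
    have h1 : (1 - ((2 : ℝ) ^ (r + 1))⁻¹) * symCount (Fin N) (r + 1) * mersProd r =
        ((2 : ℝ) ^ (r + 1))⁻¹ * (fullProd N * invEven (N + 1 - (r + 1)) * symTotal (Fin N)) := by
      rw [← ih, hM]
      field_simp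
    have h3 : (if r = 0 then 0 else ((2 : ℝ) ^ r)⁻¹ * symCount (Fin N) (r - 1)) * mersProd r =
        (1 - ((2 : ℝ) ^ r)⁻¹) * (fullProd N * invEven (N + 1 + 1 - r) * symTotal (Fin N)) := by
      rcases r with _ | r
      · simp
      · have : N + 1 + 1 - (r + 1) = N + 1 - r := by omega
        rw [this, ← ih, hM]
        simp only [Nat.add_sub_cancel, Nat.add_eq_zero_iff, one_ne_zero, and_false, if_false]
        field_simp
    have h2 := ih r
    have hkey : (((2 : ℝ) ^ r)⁻¹ - ((2 : ℝ) ^ (N + 1))⁻¹) * invEven (N + 1 + 1 - r) =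
        ((2 : ℝ) ^ (r + 1))⁻¹ * (invEven (N + 1 - (r + 1)) + invEven (N + 1 - r)) := by
      by_cases hr : r ≤ N + 1
      · obtain ⟨m, hm⟩ := Nat.exists_eq_add_of_le hr
        have e1 : N + 1 + 1 - r = m + 1 := by omega
        have e2 : N + 1 - r = m := by omega
        have e3 : N + 1 - (r + 1) = m - 1 := by omega
        rw [e1, e2, e3, hm, add_comm (invEven _), ← invEven_rec, pow_add, pow_succ]
        field_simp
      · have e1 : N + 1 + 1 - r = 0 := by omega
        have e2 : N + 1 - r = 0 := by omega
        have e3 : N + 1 - (r + 1) = 0 := by omega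
        rw [e1, e2, e3]; simp [invEven]
    rw [hF]
    linear_combination (2 : ℝ) ^ (N + 1) * h1 + (2 : ℝ) ^ (N + 1) * ((2 : ℝ) ^ (r + 1))⁻¹ * h2 +
      (2 : ℝ) ^ (N + 1) * h3 - (2 : ℝ) ^ (N + 1) * fullProd N * symTotal (Fin N) * hkey

theorem summable_inv_two_pow (a b : ℕ) (ha : 0 < a) :
    Summable fun i : ℕ => -((2 : ℝ) ^ (a * i + b))⁻¹ := by
  refine Summable.neg ?_
  have h : ∀ i : ℕ, ((2 : ℝ) ^ (a * i + b))⁻¹ = ((2 : ℝ) ^ b)⁻¹ * (((2 : ℝ) ^ a)⁻¹) ^ i := by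
    intro i; rw [pow_add, pow_mul, mul_inv, inv_pow]; ring
  simp_rw [h]
  refine Summable.mul_left _ (summable_geometric_of_lt_one (by positivity) ?_)
  exact inv_lt_one_of_one_lt₀ (one_lt_pow₀ (by norm_num) ha.ne')

theorem tendsto_prod_one_sub (a b : ℕ) (ha : 0 < a) :
    Tendsto (fun m => ∏ i ∈ Finset.range m, (1 - ((2 : ℝ) ^ (a * i + b))⁻¹)) atTop
      (𝓝 (∏' i : ℕ, (1 - ((2 : ℝ) ^ (a * i + b))⁻¹))) := by
  have := (Real.multipliable_one_add_of_summable (summable_inv_two_pow a b ha)).hasProd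
  simpa only [← sub_eq_add_neg] using this.tendsto_prod_nat

theorem fullProd_two_mul (m : ℕ) : fullProd (2 * m) = evenProd m * oddProd m := by
  induction m with
  | zero => simp [fullProd, evenProd, oddProd]
  | succ m ih =>
    unfold fullProd evenProd oddProd at *
    rw [show 2 * (m + 1) = 2 * m + 1 + 1 by ring, Finset.prod_range_succ, Finset.prod_range_succ,
      ih, Finset.prod_range_succ, Finset.prod_range_succ,
      show 2 * m + 1 + 1 = 2 * (m + 1) by ring, pow_mul]
    norm_num
    ring

theorem tendsto_fullProd_mul_invEven (r : ℕ) :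
    Tendsto (fun N => fullProd N * invEven (N + 1 - r)) atTop
      (𝓝 (∏' k : ℕ, (1 - ((2 : ℝ) ^ (2 * k + 1))⁻¹))) := by
  have hF : ∃ L, Tendsto fullProd atTop (𝓝 L) := by
    refine ⟨_, (tendsto_prod_one_sub 1 1 (by norm_num)).congr fun m => ?_⟩
    simp [fullProd]
  obtain ⟨L, hL⟩ := hF
  have hO : Tendsto oddProd atTop (𝓝 (∏' k : ℕ, (1 - ((2 : ℝ) ^ (2 * k + 1))⁻¹))) :=
    tendsto_prod_one_sub 2 1 (by norm_num)
  have hE : ∃ M, Tendsto evenProd atTop (𝓝 M) := by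
    refine ⟨_, (tendsto_prod_one_sub 2 2 (by norm_num)).congr fun m => ?_⟩
    unfold evenProd
    refine Finset.prod_congr rfl fun i _ => ?_
    rw [show 2 * i + 2 = 2 * (i + 1) by ring, pow_mul]; norm_num
  obtain ⟨M, hM⟩ := hE
  have hMpos : 2 / 3 ≤ M := ge_of_tendsto' hM fun m => by
    have := evenProd_ge m
    have h4 : (0 : ℝ) < ((4 : ℝ) ^ m)⁻¹ := by positivity
    linarith
  have hLM : L = M * ∏' k : ℕ, (1 - ((2 : ℝ) ^ (2 * k + 1))⁻¹) := by
    refine tendsto_nhds_unique (hL.comp (tendsto_id.const_mul_atTop' (r := 2) (by norm_num))) ?_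
    refine (hM.mul hO).congr fun m => ?_
    exact (fullProd_two_mul m).symm
  have hI : Tendsto (fun N => invEven (N + 1 - r)) atTop (𝓝 M⁻¹) := by
    have h1 : Tendsto (fun N : ℕ => (N - r) / 2) atTop atTop :=
      (Nat.tendsto_div_const_atTop (by norm_num)).comp (tendsto_sub_atTop_nat r)
    refine ((hM.comp h1).inv₀ (by linarith)).congr' ?_
    filter_upwards [eventually_ge_atTop r] with N hN
    rw [show N + 1 - r = (N - r) + 1 by omega]
    rfl
  have := hL.mul hI
  rw [hLM] at this
  convert this using 2
  field_simp

theorem card_GL_two (r : ℕ) :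
    (Nat.card (GL (Fin r) (ZMod 2)) : ℝ) = 2 ^ (r * (r - 1) / 2) * mersProd r := by
  have h := Matrix.card_GL_field (𝔽 := ZMod 2) r
  rw [ZMod.card] at h
  rw [h, Fin.prod_univ_eq_prod_range (fun i => 2 ^ r - 2 ^ i), Nat.cast_prod]
  have h1 : ∀ i ∈ Finset.range r, ((2 ^ r - 2 ^ i : ℕ) : ℝ) = 2 ^ i * (2 ^ (r - 1 - i + 1) - 1) := by
    intro i hi
    rw [Finset.mem_range] at hi
    rw [Nat.cast_sub (Nat.pow_le_pow_right (by norm_num) hi.le)]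
    push_cast
    rw [mul_sub, ← pow_add, show i + (r - 1 - i + 1) = r by omega]
    ring
  rw [Finset.prod_congr rfl h1, Finset.prod_mul_distrib,
    Finset.prod_range_reflect (fun i => (2 : ℝ) ^ (i + 1) - 1) r, Finset.prod_pow_eq_pow_sum,
    Finset.sum_range_id]
  rfl

theorem tendsto_symCount (r : ℕ) :
    Tendsto (fun N => (symCount (Fin N) r : ℝ) / symTotal (Fin N)) atTop
      (𝓝 (((2 : ℝ) ^ (r * (r - 1) / 2) / (Nat.card (GL (Fin r) (ZMod 2)) : ℝ)) *
        ∏' k : ℕ, (1 - ((2 : ℝ) ^ (2 * k + 1))⁻¹))) := by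
  rw [card_GL_two]
  have h := (tendsto_fullProd_mul_invEven r).const_mul (mersProd r)⁻¹
  have hm := (mersProd_pos r).ne'
  convert h using 2 with N
  · have h1 := symCount_fin N r
    have h2 := (symTotal_fin_pos N).ne'
    field_simp
    linear_combination h1
  · field_simp

end Limit

end FourRank

namespace FourRank

section QuadraticRing

open QuadraticAlgebra hiding C_ofNat norm_def

variable {F : Type} [Field F]

/-- The ring `F[x] ⊕ F[x]·Y` with `Y² = f`. -/
abbrev QRing (f : F[X]) : Type := QuadraticAlgebra F[X] f 0

theorem exists_leadingCoeff_eq_sq {i : F} (hi : i * i = -1) {D E : F[X]} (hD : D.Monic)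
    (hE : E.Monic) (hodd : Odd (D.natDegree + E.natDegree)) {x y : F[X]} (h : x ≠ 0 ∨ y ≠ 0) :
    ∃ s : F, s ≠ 0 ∧ (D * x ^ 2 - E * y ^ 2).leadingCoeff = s ^ 2 := by
  have hi0 : i ≠ 0 := by rintro rfl; simp at hi
  have hlx : (D * x ^ 2).leadingCoeff = x.leadingCoeff ^ 2 := by
    rw [leadingCoeff_mul, hD.leadingCoeff, one_mul, leadingCoeff_pow]
  have hly : (-(E * y ^ 2)).leadingCoeff = (i * y.leadingCoeff) ^ 2 := by
    rw [leadingCoeff_neg, leadingCoeff_mul, hE.leadingCoeff, one_mul, leadingCoeff_pow, mul_pow,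
      pow_two i, hi]; ring
  by_cases hx : x = 0
  · have hy : y ≠ 0 := h.resolve_left (not_not.2 hx)
    refine ⟨i * y.leadingCoeff, mul_ne_zero hi0 (leadingCoeff_ne_zero.2 hy), ?_⟩
    rw [← hly, hx]; congr 1; ring
  by_cases hy : y = 0
  · refine ⟨x.leadingCoeff, leadingCoeff_ne_zero.2 hx, ?_⟩
    rw [← hlx, hy]; congr 1; ring
  have hdx : (D * x ^ 2).natDegree = D.natDegree + 2 * x.natDegree := by
    rw [natDegree_mul hD.ne_zero (pow_ne_zero _ hx), natDegree_pow]
  have hdy : (E * y ^ 2).natDegree = E.natDegree + 2 * y.natDegree := by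
    rw [natDegree_mul hE.ne_zero (pow_ne_zero _ hy), natDegree_pow]
  have hne : (D * x ^ 2).natDegree ≠ (E * y ^ 2).natDegree := by
    rw [hdx, hdy]
    intro heq
    obtain ⟨k, hk⟩ := hodd
    omega
  rcases lt_or_gt_of_ne hne with hlt | hlt
  · refine ⟨i * y.leadingCoeff, mul_ne_zero hi0 (leadingCoeff_ne_zero.2 hy), ?_⟩
    rw [← hly, sub_eq_add_neg, leadingCoeff_add_of_degree_lt]
    rw [degree_neg]
    exact degree_lt_degree hlt
  · refine ⟨x.leadingCoeff, leadingCoeff_ne_zero.2 hx, ?_⟩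
    rw [← hlx, sub_eq_add_neg, leadingCoeff_add_of_degree_lt']
    rw [degree_neg]
    exact degree_lt_degree hlt

theorem form_ne_zero {i : F} (hi : i * i = -1) {D E : F[X]} (hD : D.Monic)
    (hE : E.Monic) (hodd : Odd (D.natDegree + E.natDegree)) {x y : F[X]} (h : x ≠ 0 ∨ y ≠ 0) :
    D * x ^ 2 - E * y ^ 2 ≠ 0 := by
  obtain ⟨s, hs, h⟩ := exists_leadingCoeff_eq_sq hi hD hE hodd h
  rw [← leadingCoeff_ne_zero, h]
  exact pow_ne_zero _ hs

theorem qnorm_eq {f : F[X]} (z : QRing f) : norm z = 1 * z.re ^ 2 - f * z.im ^ 2 := by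
  rw [QuadraticAlgebra.norm_def]; ring

theorem exists_leadingCoeff_norm {i : F} (hi : i * i = -1) {f : F[X]} (hf : f.Monic)
    (hodd : Odd f.natDegree) {z : QRing f} (hz : z ≠ 0) :
    ∃ s : F, s ≠ 0 ∧ (norm z).leadingCoeff = s ^ 2 := by
  rw [qnorm_eq]
  refine exists_leadingCoeff_eq_sq hi monic_one hf (by simpa using hodd) ?_
  by_contra hcon
  push Not at hcon
  exact hz (QuadraticAlgebra.ext hcon.1 hcon.2)

theorem qnorm_ne_zero {i : F} (hi : i * i = -1) {f : F[X]} (hf : f.Monic)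
    (hodd : Odd f.natDegree) {z : QRing f} (hz : z ≠ 0) : norm z ≠ 0 := by
  obtain ⟨s, hs, h⟩ := exists_leadingCoeff_norm hi hf hodd hz
  rw [← leadingCoeff_ne_zero, h]
  exact pow_ne_zero _ hs

theorem qring_isDomain {i : F} (hi : i * i = -1) {f : F[X]} (hf : f.Monic)
    (hodd : Odd f.natDegree) : IsDomain (QRing f) := by
  have : NoZeroDivisors (QRing f) := ⟨fun {a b} hab => by
    by_contra hcon
    push Not at hcon
    have h1 := mul_ne_zero (qnorm_ne_zero hi hf hodd hcon.1) (qnorm_ne_zero hi hf hodd hcon.2)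
    rw [← map_mul, hab, QuadraticAlgebra.norm_zero] at h1
    exact h1 rfl⟩
  exact NoZeroDivisors.to_isDomain _

/-- The inclusion of `F[x]`. -/
noncomputable abbrev inc (f : F[X]) : F[X] →+* QRing f := algebraMap F[X] (QRing f)

/-- The square root of `f`. -/
noncomputable abbrev rt (f : F[X]) : QRing f := ⟨0, 1⟩

/-- Hermite form: every nonzero ideal is `g·(A, B + Y)`. -/
theorem exists_hermite {f : F[X]} (hN : ∀ z : QRing f, z ≠ 0 → norm z ≠ 0)
    (I : Ideal (QRing f)) (hI : I ≠ ⊥) :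
    ∃ g A B : F[X], g ≠ 0 ∧ A ≠ 0 ∧ A ∣ B ^ 2 - f ∧
      I = Ideal.span {inc f g} * Ideal.span {inc f A, ⟨B, 1⟩} := by
  obtain ⟨z₀, hz₀, hz₀'⟩ := Submodule.exists_mem_ne_zero_of_ne_bot hI
  let G : Ideal F[X] := Submodule.map (imₗ f 0) (I.restrictScalars F[X])
  let H : Ideal F[X] := I.comap (inc f)
  obtain ⟨g, hg⟩ := (IsPrincipalIdealRing.principal G).principal
  obtain ⟨h, hh⟩ := (IsPrincipalIdealRing.principal H).principal
  have memG : ∀ z ∈ I, g ∣ z.im := fun z hz => by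
    have : z.im ∈ G := ⟨z, hz, rfl⟩
    rw [hg] at this
    exact Ideal.mem_span_singleton.1 this
  have memH : ∀ a, inc f a ∈ I ↔ h ∣ a := fun a => by
    rw [← Ideal.mem_span_singleton, ← Ideal.submodule_span_eq, ← hh]
    rfl
  have hnorm : inc f (norm z₀) ∈ I := by
    rw [algebraMap_norm_eq_mul_star]
    exact I.mul_mem_right _ hz₀
  have hh0 : h ≠ 0 := by
    rintro rfl
    exact hN z₀ hz₀' (zero_dvd_iff.1 ((memH _).1 hnorm))
  have hgG : g ∈ G := by rw [hg]; exact Ideal.mem_span_singleton_self g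
  obtain ⟨w, hw, hwg⟩ := hgG
  change w.im = g at hwg
  have hgh : g ∣ h := by
    have := memG _ (I.mul_mem_left (rt f) ((memH h).2 dvd_rfl))
    simpa using this
  have hgb : g ∣ w.re := by
    have := memG _ (I.mul_mem_left (rt f) hw)
    simpa using this
  obtain ⟨A, hA⟩ := hgh
  obtain ⟨B, hB⟩ := hgb
  have hg0 : g ≠ 0 := by rintro rfl; exact hh0 (by rw [hA, zero_mul])
  have hwe : w = inc f g * ⟨B, 1⟩ := by
    ext <;> simp [hB, hwg]
  refine ⟨g, A, B, hg0, ?_, ?_, ?_⟩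
  · rintro rfl; exact hh0 (by rw [hA, mul_zero])
  · have h1 : w * ⟨B, -1⟩ = inc f (g * (B ^ 2 - f)) := by
      rw [hwe]
      apply QuadraticAlgebra.ext <;> simp only [re_mul, im_mul, algebraMap_re, algebraMap_im] <;> ring
    have h2 := (memH _).1 (h1 ▸ I.mul_mem_right _ hw)
    rw [hA] at h2
    exact (mul_dvd_mul_iff_left hg0).1 h2
  · rw [Ideal.span_mul_span', Set.singleton_mul, Set.image_pair, ← map_mul, ← hA, ← hwe]
    refine le_antisymm (fun z hz => ?_) ?_
    · obtain ⟨k, hk⟩ := memG z hz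
      have h1 : z - inc f k * w = inc f (z.re - k * w.re) := by
        ext
        · simp
        · simp [hwg, hk, mul_comm]
      have h2 : inc f (z.re - k * w.re) ∈ I := h1 ▸ I.sub_mem hz (I.mul_mem_left _ hw)
      obtain ⟨l, hl⟩ := (memH _).1 h2
      rw [Ideal.mem_span_pair]
      refine ⟨inc f l, inc f k, ?_⟩
      rw [← map_mul, mul_comm l, ← hl, ← h1]
      ring
    · rw [Ideal.span_le]
      rintro z (rfl | rfl)
      · exact (memH h).2 dvd_rfl
      · exact hw

open Classical in
theorem exists_bezout_three {A B C : F[X]} (hA : A ≠ 0)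
    (h : ∀ p, Irreducible p → p ∣ A → p ∣ B → ¬ p ∣ C) :
    ∃ u v w, u * A + v * B + w * C = 1 := by
  have hcop : IsCoprime (EuclideanDomain.gcd A B) C := by
    refine isCoprime_of_prime_dvd ?_ fun p hp h1 h2 => ?_
    · rintro ⟨h1, -⟩
      exact hA (EuclideanDomain.gcd_eq_zero_iff.1 h1).1
    · exact h p hp.irreducible (h1.trans (EuclideanDomain.gcd_dvd_left _ _))
        (h1.trans (EuclideanDomain.gcd_dvd_right _ _)) h2
  obtain ⟨s, t, hst⟩ := hcop
  rw [EuclideanDomain.gcd_eq_gcd_ab] at hst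
  exact ⟨s * EuclideanDomain.gcdA A B, s * EuclideanDomain.gcdB A B, t, by rw [← hst]; ring⟩

theorem two_unit (h2 : (2 : F) ≠ 0) : C (2 : F)⁻¹ * (2 : F[X]) = 1 := by
  rw [← Polynomial.C_ofNat, ← Polynomial.C_mul, inv_mul_cancel₀ h2, C_1]

theorem hermite_mul_conj (h2 : (2 : F) ≠ 0) {f A B : F[X]} (hf : Squarefree f) (hA : A ≠ 0)
    (hAB : A ∣ B ^ 2 - f) :
    Ideal.span {inc f A, (⟨B, 1⟩ : QRing f)} * Ideal.span {inc f A, (⟨B, -1⟩ : QRing f)} =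
      Ideal.span {inc f A} := by
  obtain ⟨E, hE⟩ := hAB
  have hw : (⟨B, 1⟩ : QRing f) * ⟨B, -1⟩ = inc f A * inc f E := by
    rw [← map_mul, ← hE]
    apply QuadraticAlgebra.ext <;> simp only [re_mul, im_mul, algebraMap_re, algebraMap_im] <;> ring
  refine le_antisymm ?_ ?_
  · rw [Ideal.span_mul_span', Ideal.span_le]
    rintro z ⟨a, ha, b, hb, rfl⟩
    rw [SetLike.mem_coe, Ideal.mem_span_singleton]
    rcases ha with rfl | rfl
    · exact dvd_mul_right _ _
    · rcases hb with rfl | rfl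
      · exact dvd_mul_left _ _
      · exact ⟨_, hw⟩
  · rw [Ideal.span_singleton_le_iff_mem]
    obtain ⟨u, v, w, huvw⟩ := exists_bezout_three (A := A) (B := B) (C := E) hA (by
      intro p hp h1 h3 h4
      refine hp.not_isUnit (hf p ?_)
      have h5 : p * p ∣ A * E := mul_dvd_mul h1 h4
      have h6 : p * p ∣ B ^ 2 := by rw [pow_two]; exact mul_dvd_mul h3 h3
      have : f = B ^ 2 - A * E := by rw [← hE]; ring
      rw [this]
      exact dvd_sub h6 h5)
    set P := Ideal.span {inc f A, (⟨B, 1⟩ : QRing f)} * Ideal.span {inc f A, (⟨B, -1⟩ : QRing f)}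
    have m1 : inc f A * inc f A ∈ P :=
      Ideal.mul_mem_mul (Ideal.subset_span (by simp)) (Ideal.subset_span (by simp))
    have m2 : inc f A * ⟨B, -1⟩ ∈ P :=
      Ideal.mul_mem_mul (Ideal.subset_span (by simp)) (Ideal.subset_span (by simp))
    have m3 : ⟨B, 1⟩ * inc f A ∈ P :=
      Ideal.mul_mem_mul (Ideal.subset_span (by simp)) (Ideal.subset_span (by simp))
    have m4 : ⟨B, 1⟩ * ⟨B, -1⟩ ∈ P :=
      Ideal.mul_mem_mul (Ideal.subset_span (by simp)) (Ideal.subset_span (by simp))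
    rw [hw] at m4
    have hsum : (⟨B, -1⟩ : QRing f) + ⟨B, 1⟩ = inc f (2 * B) := by
      apply QuadraticAlgebra.ext
      · rw [re_add, algebraMap_re]; ring
      · rw [im_add, algebraMap_im]; ring
    have key : inc f A = inc f u * (inc f A * inc f A) +
        inc f (v * C (2 : F)⁻¹) * (inc f A * ⟨B, -1⟩ + ⟨B, 1⟩ * inc f A) +
        inc f w * (inc f A * inc f E) := by
      have h5 : inc f A * ⟨B, -1⟩ + ⟨B, 1⟩ * inc f A = inc f (A * (2 * B)) := by
        rw [map_mul, ← hsum]; ring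
      rw [h5]
      simp only [← map_mul, ← map_add]
      congr 1
      linear_combination -A * huvw - v * A * B * two_unit h2
    rw [key]
    exact P.add_mem (P.add_mem (P.mul_mem_left _ m1) (P.mul_mem_left _ (P.add_mem m2 m3)))
      (P.mul_mem_left _ m4)

theorem exists_mul_eq_span (h2 : (2 : F) ≠ 0) {f : F[X]} (hf : Squarefree f)
    (hN : ∀ z : QRing f, z ≠ 0 → norm z ≠ 0) (I : Ideal (QRing f)) (hI : I ≠ ⊥) :
    ∃ n : F[X], n ≠ 0 ∧ I * I.map (starRingEnd (QRing f)) = Ideal.span {inc f n} := by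
  obtain ⟨g, A, B, hg, hA, hAB, rfl⟩ := exists_hermite hN I hI
  refine ⟨g ^ 2 * A, mul_ne_zero (pow_ne_zero _ hg) hA, ?_⟩
  have hs : ∀ a, starRingEnd (QRing f) (inc f a) = inc f a := fun a => by
    rw [starRingEnd_apply]; ext <;> simp
  have hs' : starRingEnd (QRing f) ⟨B, 1⟩ = ⟨B, -1⟩ := by
    rw [starRingEnd_apply]; ext <;> simp
  rw [Ideal.map_mul, Ideal.map_span, Ideal.map_span, Set.image_singleton, Set.image_pair, hs, hs,
    hs', mul_mul_mul_comm, hermite_mul_conj h2 hf hA hAB, Ideal.span_singleton_mul_span_singleton,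
    Ideal.span_singleton_mul_span_singleton, ← map_mul, ← map_mul, pow_two]

open FractionalIdeal in
theorem qring_isDedekindDomain (h2 : (2 : F) ≠ 0) {f : F[X]} (hf : Squarefree f)
    [IsDomain (QRing f)] (hN : ∀ z : QRing f, z ≠ 0 → norm z ≠ 0) :
    IsDedekindDomain (QRing f) := by
  rw [isDedekindDomain_iff_mul_inv_cancel (K := FractionRing (QRing f))]
  intro I hI
  rw [FractionalIdeal.mul_inv_cancel_iff]
  obtain ⟨a, aI, ha, hIa⟩ := FractionalIdeal.exists_eq_spanSingleton_mul I
  have haI : aI ≠ ⊥ := by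
    rintro rfl
    apply hI
    rw [hIa]; simp
  obtain ⟨n, hn, h⟩ := exists_mul_eq_span h2 hf hN aI haI
  have hn' : algebraMap (QRing f) (FractionRing (QRing f)) (inc f n) ≠ 0 := by
    rw [Ne, FaithfulSMul.algebraMap_eq_zero_iff]
    intro h0
    exact hn (algebraMap_injective (a := f) (b := 0) (by rw [h0, map_zero]))
  have ha' : algebraMap (QRing f) (FractionRing (QRing f)) a ≠ 0 := by
    rwa [Ne, FaithfulSMul.algebraMap_eq_zero_iff]
  refine ⟨spanSingleton _ (algebraMap _ (FractionRing (QRing f)) a *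
    (algebraMap _ (FractionRing (QRing f)) (inc f n))⁻¹) *
    ((aI.map (starRingEnd (QRing f)) : Ideal (QRing f)) :
      FractionalIdeal _ (FractionRing (QRing f))), ?_⟩
  rw [hIa, mul_mul_mul_comm, ← coeIdeal_mul, h, coeIdeal_span_singleton,
    spanSingleton_mul_spanSingleton, spanSingleton_mul_spanSingleton, ← spanSingleton_one]
  congr 1
  field_simp

end QuadraticRing

end FourRank

namespace FourRank

section PolynomialArithmetic

variable {F : Type} [Field F]

open Classical in
theorem exists_eq_mul_isCoprime (a b : F[X]) (hb : b ≠ 0) :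
    ∃ g a' b', g ≠ 0 ∧ a = g * a' ∧ b = g * b' ∧ IsCoprime a' b' := by
  have hg : EuclideanDomain.gcd a b ≠ 0 := fun h => hb (EuclideanDomain.gcd_eq_zero_iff.1 h).2
  obtain ⟨a', ha'⟩ := EuclideanDomain.gcd_dvd_left a b
  obtain ⟨b', hb'⟩ := EuclideanDomain.gcd_dvd_right a b
  refine ⟨_, a', b', hg, ha', hb', EuclideanDomain.gcdA a b, EuclideanDomain.gcdB a b, ?_⟩
  have h := EuclideanDomain.gcd_eq_gcd_ab a b
  generalize EuclideanDomain.gcd a b = g at *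
  apply mul_left_cancel₀ hg
  linear_combination - h - EuclideanDomain.gcdA a b * ha' - EuclideanDomain.gcdB a b * hb'

theorem eq_of_mul_sq_eq {D E a n : F[X]} {u : F} (hD : D.Monic) (hE : E.Monic)
    (hDs : Squarefree D) (hEs : Squarefree E) (hn : n ≠ 0) (hu : u ≠ 0)
    (h : D * a ^ 2 = C u * (E * n ^ 2)) : D = E := by
  obtain ⟨g, a, n, hg, rfl, rfl, hcop⟩ := exists_eq_mul_isCoprime a n hn
  have hCu : IsUnit (C u) := isUnit_C.2 (isUnit_iff_ne_zero.2 hu)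
  have h' : D * a ^ 2 = C u * (E * n ^ 2) := by
    apply mul_left_cancel₀ (pow_ne_zero 2 hg)
    linear_combination h
  have hn1 : IsUnit n := by
    apply hDs n
    rw [← pow_two]
    refine (IsCoprime.pow (n := 2) hcop.symm).dvd_of_dvd_mul_right (Dvd.intro_left (C u * E) ?_)
    rw [h']; ring
  have ha1 : IsUnit a := by
    apply hEs a
    rw [← pow_two]
    refine (IsCoprime.pow (n := 2) hcop).dvd_of_dvd_mul_right (hCu.dvd_mul_left.1 ?_)
    rw [← h']
    exact dvd_mul_left _ _
  refine eq_of_monic_of_associated hD hE ?_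
  calc Associated D (D * a ^ 2) := (associated_mul_unit_left _ _ (ha1.pow 2)).symm
    _ = C u * (E * n ^ 2) := h'
    Associated _ (E * n ^ 2) := associated_unit_mul_left _ _ hCu
    Associated _ E := associated_mul_unit_left _ _ (hn1.pow 2)

theorem natDegree_le_natDegree_form {D E : F[X]} (hD : D.Monic)
    (hE : E.Monic) (hodd : Odd (D.natDegree + E.natDegree)) {x y : F[X]} (hy : y ≠ 0) :
    E.natDegree ≤ (D * x ^ 2 - E * y ^ 2).natDegree := by
  have hdy : (E * y ^ 2).natDegree = E.natDegree + 2 * y.natDegree := by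
    rw [natDegree_mul hE.ne_zero (pow_ne_zero _ hy), natDegree_pow]
  by_cases hx : x = 0
  · rw [hx, ← natDegree_neg (D * 0 ^ 2 - E * y ^ 2)]
    have : -(D * 0 ^ 2 - E * y ^ 2) = E * y ^ 2 := by ring
    rw [this, hdy]; omega
  have hdx : (D * x ^ 2).natDegree = D.natDegree + 2 * x.natDegree := by
    rw [natDegree_mul hD.ne_zero (pow_ne_zero _ hx), natDegree_pow]
  have hne : (D * x ^ 2).natDegree ≠ (E * y ^ 2).natDegree := by
    rw [hdx, hdy]
    intro heq
    obtain ⟨k, hk⟩ := hodd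
    omega
  rcases lt_or_gt_of_ne hne with hlt | hlt
  · rw [natDegree_sub_eq_right_of_natDegree_lt hlt]; omega
  · rw [natDegree_sub_eq_left_of_natDegree_lt hlt]; omega

theorem isUnit_eq_C {u : F[X]} (hu : IsUnit u) : ∃ c : F, c ≠ 0 ∧ u = C c := by
  obtain ⟨c, hc, h⟩ := Polynomial.isUnit_iff.1 hu
  exact ⟨c, hc.ne_zero, h.symm⟩

theorem prime_dvd_of_sq_dvd_mul_sq {D p x : F[X]} (hD : Squarefree D) (hp : Irreducible p)
    (h : p ^ 2 ∣ D * x ^ 2) : p ∣ x := by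
  by_contra hx
  have hcop : IsCoprime (p ^ 2) (x ^ 2) := ((hp.coprime_iff_not_dvd).2 hx).pow
  have := hcop.dvd_of_dvd_mul_right h
  exact hp.not_isUnit (hD p (by rwa [← pow_two]))

/-- A nontrivial solution of `D x² - E y² = z²` may be taken primitive. -/
theorem exists_primitive_solution {D E : F[X]} :
    ∀ (N : ℕ) (x y z : F[X]), z ≠ 0 → z.natDegree = N → D * x ^ 2 - E * y ^ 2 = z ^ 2 →
    ∃ x y z, z ≠ 0 ∧ D * x ^ 2 - E * y ^ 2 = z ^ 2 ∧
      ∀ p, Irreducible p → p ∣ x → p ∣ y → ¬ p ∣ z := by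
  intro N
  induction N using Nat.strong_induction_on with
  | _ N ih =>
    intro x y z hz hN h
    by_cases hprim : ∀ p, Irreducible p → p ∣ x → p ∣ y → ¬ p ∣ z
    · exact ⟨x, y, z, hz, h, hprim⟩
    push Not at hprim
    obtain ⟨p, hp, ⟨x, rfl⟩, ⟨y, rfl⟩, ⟨z, rfl⟩⟩ := hprim
    have hz' : z ≠ 0 := right_ne_zero_of_mul hz
    refine ih z.natDegree ?_ x y z hz' rfl ?_
    · rw [← hN, natDegree_mul hp.ne_zero hz']
      have := hp.natDegree_pos
      omega
    · apply mul_left_cancel₀ (pow_ne_zero 2 hp.ne_zero)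
      linear_combination h

end PolynomialArithmetic

section QuadraticRing

open QuadraticAlgebra hiding C_ofNat norm_def

variable {F : Type} [Field F]

theorem inc_injective (f : F[X]) : Function.Injective (inc f) :=
  algebraMap_injective (a := f) (b := 0)

theorem conj_inc {f : F[X]} (a : F[X]) : starRingEnd (QRing f) (inc f a) = inc f a := by
  rw [starRingEnd_apply]; ext <;> simp

theorem conj_mk {f : F[X]} (a b : F[X]) : starRingEnd (QRing f) ⟨a, b⟩ = ⟨a, -b⟩ := by
  rw [starRingEnd_apply]; ext <;> simp

theorem mul_conj {f : F[X]} (z : QRing f) : z * starRingEnd _ z = inc f (norm z) := by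
  rw [algebraMap_norm_eq_mul_star]; rfl

theorem rt_mul_rt (f : F[X]) : rt f * rt f = inc f f := by
  apply QuadraticAlgebra.ext <;> simp

/-- The ideal `(D, Y)`. -/
noncomputable def idl (f D : F[X]) : Ideal (QRing f) := Ideal.span {inc f D, rt f}

theorem idl_ne_bot {f : F[X]} (D : F[X]) : idl f D ≠ ⊥ := by
  rw [idl, Ne, Ideal.span_eq_bot]
  intro h
  have := congrArg QuadraticAlgebra.im (h (rt f) (by simp))
  simp at this

theorem span_pair_neg {R : Type*} [CommRing R] (a b : R) :
    Ideal.span {a, -b} = Ideal.span {a, b} := by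
  rw [Ideal.span_insert, Ideal.span_insert, Ideal.span_singleton_neg]

theorem map_conj_idl {f : F[X]} (D : F[X]) :
    (idl f D).map (starRingEnd (QRing f)) = idl f D := by
  rw [idl, Ideal.map_span, Set.image_pair, conj_inc, conj_mk, ← span_pair_neg]
  congr 3
  apply QuadraticAlgebra.ext <;> simp

theorem idl_mul_self (h2 : (2 : F) ≠ 0) {f D E : F[X]} (hf : Squarefree f) (h : D * E = f) :
    idl f D * idl f D = Ideal.span {inc f D} := by
  have hD : D ≠ 0 := by rintro rfl; rw [zero_mul] at h; exact hf.ne_zero h.symm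
  rw [← hermite_mul_conj (B := 0) h2 hf hD ⟨-E, by rw [← h]; ring⟩]
  have : (⟨0, -1⟩ : QRing f) = - rt f := by apply QuadraticAlgebra.ext <;> simp
  rw [this, span_pair_neg]
  rfl

theorem span_mul_idl {f D E : F[X]} (h : D * E = f) :
    Ideal.span {rt f} * idl f D = Ideal.span {inc f D} * idl f E := by
  rw [idl, idl, Ideal.span_mul_span', Ideal.span_mul_span', Set.singleton_mul, Set.singleton_mul,
    Set.image_pair, Set.image_pair, rt_mul_rt, ← map_mul, h, Set.pair_comm, mul_comm (rt f)]

theorem qring_isUnit {f : F[X]} (hf : f.Monic) (hodd : Odd f.natDegree)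
    {u : QRing f} (hu : IsUnit u) : ∃ c : F, c ≠ 0 ∧ u = inc f (C c) := by
  have hn : IsUnit (norm u) := hu.map QuadraticAlgebra.norm
  have him : u.im = 0 := by
    by_contra him
    have h1 := natDegree_le_natDegree_form (monic_one (R := F)) hf (by simpa using hodd)
      (x := u.re) him
    rw [← qnorm_eq, natDegree_eq_zero_of_isUnit hn] at h1
    obtain ⟨k, hk⟩ := hodd
    omega
  rw [qnorm_eq, him] at hn
  have : IsUnit u.re := by
    rw [zero_pow two_ne_zero, mul_zero, sub_zero, one_mul] at hn
    exact (isUnit_pow_iff two_ne_zero).1 hn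
  obtain ⟨c, hc, h⟩ := isUnit_eq_C this
  exact ⟨c, hc, by apply QuadraticAlgebra.ext <;> simp [h, him]⟩

theorem eq_or_of_span_mul_idl {i : F} (hi : i * i = -1) (h2 : (2 : F) ≠ 0) {f D D' E E' : F[X]}
    (hf : Squarefree f) (hfm : f.Monic) (hodd : Odd f.natDegree) (hD : D.Monic)
    (hE : E.Monic) (hDf : D * D' = f) (hEf : E * E' = f) {x y : QRing f} (hy : y ≠ 0)
    (h : Ideal.span {x} * idl f D = Ideal.span {y} * idl f E) : D = E ∨ D' = E := by
  have hD' : D'.Monic := hD.of_mul_monic_left (hDf ▸ hfm)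
  have : IsDomain (QRing f) := qring_isDomain hi hfm hodd
  have hsq : Ideal.span {x * x * inc f D} = Ideal.span {y * y * inc f E} := by
    simp only [← Ideal.span_singleton_mul_span_singleton]
    rw [← idl_mul_self h2 hf hDf, ← idl_mul_self h2 hf hEf, mul_mul_mul_comm, h,
      mul_mul_mul_comm]
  rw [Ideal.span_singleton_eq_span_singleton] at hsq
  obtain ⟨v, hv⟩ := hsq.symm
  obtain ⟨u, hu, huv⟩ := qring_isUnit hfm hodd v.isUnit
  rw [huv] at hv
  set w := x * starRingEnd _ y with hw
  have hn : norm y ≠ 0 := qnorm_ne_zero hi hfm hodd hy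
  have key : inc f D * w * w = inc f (C u * (E * norm y ^ 2)) := by
    rw [map_mul, map_mul, map_pow, ← mul_conj]
    linear_combination - (starRingEnd _ y) ^ 2 * hv
  have him := congrArg QuadraticAlgebra.im key
  have hre := congrArg QuadraticAlgebra.re key
  simp only [re_mul, im_mul, algebraMap_re, algebraMap_im] at him hre
  have hDs : Squarefree D := hf.squarefree_of_dvd ⟨_, hDf.symm⟩
  have hD's : Squarefree D' := hf.squarefree_of_dvd ⟨D, by rw [← hDf, mul_comm]⟩
  have hEs : Squarefree E := hf.squarefree_of_dvd ⟨_, hEf.symm⟩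
  have h0 : w.re * w.im = 0 := by
    have h3 : (D * C 2) * (w.re * w.im) = 0 := by
      rw [Polynomial.C_ofNat]
      linear_combination him
    exact (mul_eq_zero.1 h3).resolve_left (mul_ne_zero hD.ne_zero (C_ne_zero.2 h2))
  rcases mul_eq_zero.1 h0 with h0 | h0
  · right
    refine eq_of_mul_sq_eq (a := D * w.im) hD' hE hD's hEs hn hu ?_
    rw [← hre, h0]
    linear_combination D * w.im ^ 2 * hDf
  · left
    refine eq_of_mul_sq_eq (a := w.re) hD hE hDs hEs hn hu ?_
    rw [← hre, h0]; ring

end QuadraticRing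

end FourRank

namespace FourRank

section QuadraticRing

open QuadraticAlgebra hiding C_ofNat norm_def

variable {F : Type} [Field F]

theorem span_mul_left_cancel {R : Type*} [CommRing R] [IsDomain R] {x : R} (hx : x ≠ 0)
    {I J : Ideal R} (h : Ideal.span {x} * I = Ideal.span {x} * J) : I = J :=
  (Ideal.span_singleton_mul_right_inj hx).1 h

theorem hermite_conj_invariant (h2 : (2 : F) ≠ 0) {f A B : F[X]}
    (h : Ideal.span {inc f A, (⟨B, 1⟩ : QRing f)} = Ideal.span {inc f A, (⟨B, -1⟩ : QRing f)})
    (hAB : A ∣ B ^ 2 - f) : A ∣ B := by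
  have hmem : (⟨B, -1⟩ : QRing f) ∈ Ideal.span {inc f A, (⟨B, 1⟩ : QRing f)} := by
    rw [h]; exact Ideal.subset_span (by simp)
  have h1 : (⟨B, 1⟩ : QRing f) ∈ Ideal.span {inc f A, (⟨B, 1⟩ : QRing f)} :=
    Ideal.subset_span (by simp)
  have hsum : (⟨B, -1⟩ : QRing f) + ⟨B, 1⟩ = inc f (2 * B) := by
    apply QuadraticAlgebra.ext
    · rw [re_add, algebraMap_re]; ring
    · rw [im_add, algebraMap_im]; ring
  have h3 := Ideal.add_mem _ hmem h1
  rw [hsum, Ideal.mem_span_pair] at h3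
  obtain ⟨s, t, hst⟩ := h3
  have hre := congrArg QuadraticAlgebra.re hst
  have him := congrArg QuadraticAlgebra.im hst
  simp only [re_mul, im_mul, algebraMap_re, algebraMap_im, re_add, im_add] at hre him
  obtain ⟨E, hE⟩ := hAB
  have h4 : A ∣ 2 * B := by
    refine ⟨s.re - s.im * B - t.im * E, ?_⟩
    linear_combination - hre + B * him - t.im * hE
  have h5 : B = C (2 : F)⁻¹ * (2 * B) := by linear_combination -B * two_unit h2
  rw [h5]
  exact h4.mul_left _

theorem exists_idl_of_mul_self {i : F} (hi : i * i = -1) (h2 : (2 : F) ≠ 0) {f : F[X]}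
    (hf : Squarefree f) (hfm : f.Monic) (hodd : Odd f.natDegree)
    {I : Ideal (QRing f)} (hI : I ≠ ⊥) {x : QRing f} (hx : x ≠ 0) (h : I * I = Ideal.span {x}) :
    ∃ D : F[X], D.Monic ∧ D ∣ f ∧ ∃ b c : QRing f, b ≠ 0 ∧ c ≠ 0 ∧
      Ideal.span {b} * I = Ideal.span {c} * idl f D := by
  have : IsDomain (QRing f) := qring_isDomain hi hfm hodd
  have hN : ∀ z : QRing f, z ≠ 0 → norm z ≠ 0 := fun z => qnorm_ne_zero hi hfm hodd
  obtain ⟨n, hn, hIn⟩ := exists_mul_eq_span h2 hf hN I hI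
  set σ := starRingEnd (QRing f) with hσ
  have hσσ : ∀ z, σ (σ z) = z := fun z => starRingEnd_self_apply z
  have e1 : Ideal.span {inc f n} * I = Ideal.span {x} * I.map σ := by
    rw [← hIn, ← h]; ring
  have hIσσ : (I.map σ).map σ = I := by
    rw [Ideal.map_map]
    have : σ.comp σ = RingHom.id _ := RingHom.ext hσσ
    rw [this, Ideal.map_id]
  have e2 : Ideal.span {inc f n} * I.map σ = Ideal.span {σ x} * I := by
    have := congrArg (Ideal.map σ) e1
    rwa [Ideal.map_mul, Ideal.map_mul, Ideal.map_span, Ideal.map_span, Set.image_singleton,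
      Set.image_singleton, hIσσ, conj_inc] at this
  have e3 : Ideal.span {inc f (n ^ 2)} = Ideal.span {inc f (norm x)} := by
    have h0 : Ideal.span {inc f (n ^ 2)} * I = Ideal.span {inc f (norm x)} * I := by
      rw [map_pow, pow_two, ← mul_conj, ← Ideal.span_singleton_mul_span_singleton,
        ← Ideal.span_singleton_mul_span_singleton, mul_assoc, e1, mul_left_comm, e2, mul_assoc]
    have h1 := congrArg (· * I.map σ) h0
    simp only [mul_assoc, hIn] at h1
    rw [mul_comm, mul_comm _ (Ideal.span {inc f n})] at h1
    refine span_mul_left_cancel ?_ h1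
    rwa [Ne, map_eq_zero_iff _ (inc_injective f)]
  rw [Ideal.span_singleton_eq_span_singleton] at e3
  obtain ⟨v, hv⟩ := e3.symm
  obtain ⟨u, hu, huv⟩ := qring_isUnit hfm hodd v.isUnit
  rw [huv, ← map_mul] at hv
  have hv := inc_injective f hv
  obtain ⟨s, hs, hs'⟩ := exists_leadingCoeff_norm hi hfm hodd hx
  obtain ⟨t, ht, htu⟩ : ∃ t : F, t ≠ 0 ∧ t ^ 2 = u := by
    refine ⟨n.leadingCoeff / s, div_ne_zero (leadingCoeff_ne_zero.2 hn) hs, ?_⟩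
    have := congrArg leadingCoeff hv
    rw [leadingCoeff_mul, hs', leadingCoeff_C, leadingCoeff_pow] at this
    rw [div_pow, ← this]
    field_simp
  -- rescale so that the norm of `x` is `m ^ 2`
  obtain ⟨m, hm, hmx, e4⟩ : ∃ m : F[X], m ≠ 0 ∧ x * σ x = inc f m ^ 2 ∧
      Ideal.span {inc f m} * I.map σ = Ideal.span {σ x} * I := by
    have hct : C t⁻¹ * C t = (1 : F[X]) := by rw [← Polynomial.C_mul, inv_mul_cancel₀ ht, C_1]
    refine ⟨C t⁻¹ * n, mul_ne_zero (C_ne_zero.2 (inv_ne_zero ht)) hn, ?_, ?_⟩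
    · rw [hσ, mul_conj, ← map_pow]
      congr 1
      rw [← htu, Polynomial.C_pow] at hv
      linear_combination (-norm x * (C t⁻¹ * C t + 1)) * hct + C t⁻¹ ^ 2 * hv
    · rw [← e2]
      congr 1
      rw [Ideal.span_singleton_eq_span_singleton, map_mul]
      exact associated_unit_mul_left _ _
        ((isUnit_C.2 (isUnit_iff_ne_zero.2 (inv_ne_zero ht))).map (inc f))
  have hm' : inc f m ≠ 0 := by rwa [Ne, map_eq_zero_iff _ (inc_injective f)]
  obtain ⟨b, hb, hbI⟩ : ∃ b : QRing f, b ≠ 0 ∧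
      (Ideal.span {b} * I).map σ = Ideal.span {b} * I := by
    have crit : ∀ b : QRing f, Associated (σ b * σ x) (b * inc f m) →
        (Ideal.span {b} * I).map σ = Ideal.span {b} * I := by
      intro b hb
      rw [Ideal.map_mul, Ideal.map_span, Set.image_singleton]
      refine span_mul_left_cancel hm' ?_
      rw [mul_left_comm, e4, ← mul_assoc, ← mul_assoc, Ideal.span_singleton_mul_span_singleton,
        Ideal.span_singleton_mul_span_singleton, mul_comm (inc f m),
        Ideal.span_singleton_eq_span_singleton.2 hb]
    by_cases hb : inc f m + x = 0
    · refine ⟨rt f, ?_, crit _ ?_⟩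
      · intro h0
        simpa using congrArg QuadraticAlgebra.im h0
      · have h3 : σ x = - inc f m := by
          rw [← eq_neg_iff_add_eq_zero] at hb
          rw [← conj_inc (f := f) m, hb, map_neg, neg_neg]
        have h4 : σ (rt f) = - rt f := by
          rw [hσ, conj_mk]; apply QuadraticAlgebra.ext <;> simp
        rw [h3, h4, neg_mul_neg]
    · refine ⟨inc f m + σ x, ?_, crit _ ?_⟩
      · intro h0
        apply hb
        have := congrArg σ h0
        rwa [map_add, hσσ, conj_inc, map_zero] at this
      · rw [map_add, hσσ, hσ, conj_inc, ← hσ, add_mul, hmx]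
        have : inc f m * σ x + inc f m ^ 2 = (inc f m + σ x) * inc f m := by ring
        rw [this]
  obtain ⟨g, A, B, hg, hA, hAB, hJ⟩ := exists_hermite hN (Ideal.span {b} * I) (by
    rw [Ne, Ideal.mul_eq_bot, Ideal.span_singleton_eq_bot]
    tauto)
  have hg' : inc f g ≠ 0 := by rwa [Ne, map_eq_zero_iff _ (inc_injective f)]
  have hAB' : A ∣ B := by
    refine hermite_conj_invariant h2 ?_ hAB
    rw [hJ, Ideal.map_mul, Ideal.map_span, Ideal.map_span, Set.image_singleton, Set.image_pair,
      conj_inc, conj_inc, conj_mk] at hbI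
    exact (span_mul_left_cancel hg' hbI).symm
  have hAf : A ∣ f := by
    have := (hAB'.trans (dvd_pow_self B two_ne_zero)).sub hAB
    simpa using this
  have hlc : A.leadingCoeff⁻¹ ≠ 0 := inv_ne_zero (leadingCoeff_ne_zero.2 hA)
  have hCu : IsUnit (C A.leadingCoeff⁻¹) := isUnit_C.2 (isUnit_iff_ne_zero.2 hlc)
  refine ⟨A * C A.leadingCoeff⁻¹, monic_mul_leadingCoeff_inv hA, ?_, b, inc f g, hb, hg', ?_⟩
  · exact (associated_mul_unit_left _ _ hCu).dvd.trans hAf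
  · rw [hJ]
    congr 1
    obtain ⟨k, rfl⟩ := hAB'
    rw [idl, Ideal.span_insert, Ideal.span_insert, Ideal.span_singleton_eq_span_singleton.2
      ((associated_mul_unit_left _ _ hCu).map (inc f)), ← Ideal.span_insert, ← Ideal.span_insert]
    have : (⟨A * k, 1⟩ : QRing f) = rt f + inc f k * inc f A := by
      rw [← map_mul]
      apply QuadraticAlgebra.ext <;> simp [mul_comm]
    rw [this, Ideal.span_pair_add_mul_left]

end QuadraticRing

end FourRank

namespace FourRank

section QuadraticRing

open QuadraticAlgebra hiding C_ofNat norm_def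

variable {F : Type} [Field F]

theorem exists_solution_of_idl_mul_sq {i : F} (hi : i * i = -1) (h2 : (2 : F) ≠ 0)
    {f D E : F[X]} (hf : Squarefree f) (hfm : f.Monic) (hodd : Odd f.natDegree) (hD : D.Monic)
    (hDE : D * E = f) {H : Ideal (QRing f)} (hH : H ≠ ⊥) {w : QRing f} (hw : w ≠ 0)
    (h : idl f D * (H * H) = Ideal.span {w}) :
    ∃ x y z : F[X], z ≠ 0 ∧ D * x ^ 2 - E * y ^ 2 = z ^ 2 := by
  have : IsDomain (QRing f) := qring_isDomain hi hfm hodd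
  have hE : E.Monic := hD.of_mul_monic_left (hDE ▸ hfm)
  have hDs : Squarefree D := hf.squarefree_of_dvd ⟨_, hDE.symm⟩
  have hN : ∀ z : QRing f, z ≠ 0 → norm z ≠ 0 := fun z => qnorm_ne_zero hi hfm hodd
  obtain ⟨n, hn, hHn⟩ := exists_mul_eq_span h2 hf hN H hH
  have h1 := congrArg (Ideal.map (starRingEnd (QRing f))) h
  rw [Ideal.map_mul, Ideal.map_mul, map_conj_idl, Ideal.map_span, Set.image_singleton] at h1
  have h3 : Ideal.span {inc f (D * n ^ 2)} = Ideal.span {inc f (norm w)} := by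
    rw [← mul_conj, ← Ideal.span_singleton_mul_span_singleton w, ← h, ← h1, map_mul, map_pow,
      pow_two, ← Ideal.span_singleton_mul_span_singleton, ← Ideal.span_singleton_mul_span_singleton,
      ← hHn, ← idl_mul_self h2 hf hDE]
    ring
  rw [Ideal.span_singleton_eq_span_singleton] at h3
  obtain ⟨v, hv⟩ := h3
  obtain ⟨u, hu, huv⟩ := qring_isUnit hfm hodd v.isUnit
  rw [huv, ← map_mul] at hv
  have hv := inc_injective f hv
  rw [qnorm_eq] at hv
  obtain ⟨x, hx⟩ : D ∣ w.re := by
    refine (hDs.dvd_pow_iff_dvd two_ne_zero).1 ⟨n ^ 2 * C u + E * w.im ^ 2, ?_⟩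
    linear_combination - hv - w.im ^ 2 * hDE
  have hform : D * x ^ 2 - E * w.im ^ 2 = n ^ 2 * C u := by
    apply mul_left_cancel₀ hD.ne_zero
    rw [hx] at hv
    linear_combination - hv - w.im ^ 2 * hDE
  have hne : x ≠ 0 ∨ w.im ≠ 0 := by
    by_contra hcon
    push Not at hcon
    apply hw
    apply QuadraticAlgebra.ext
    · rw [hx, hcon.1, mul_zero]; rfl
    · exact hcon.2
  obtain ⟨s, hs, hs'⟩ := exists_leadingCoeff_eq_sq hi hD hE (by
    rw [← hDE, hD.natDegree_mul hE] at hodd; exact hodd) hne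
  obtain ⟨t, ht, htu⟩ : ∃ t : F, t ≠ 0 ∧ t ^ 2 = u := by
    refine ⟨s / n.leadingCoeff, div_ne_zero hs (leadingCoeff_ne_zero.2 hn), ?_⟩
    rw [hform, leadingCoeff_mul, leadingCoeff_C, leadingCoeff_pow] at hs'
    rw [div_pow, ← hs']
    have := leadingCoeff_ne_zero.2 hn
    field_simp
  refine ⟨x, w.im, n * C t, mul_ne_zero hn (C_ne_zero.2 ht), ?_⟩
  rw [hform, ← htu, Polynomial.C_pow]
  ring

theorem exists_idl_mul_sq {f D E : F[X]} (h2 : (2 : F) ≠ 0) (hf : Squarefree f)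
    (hD : D ≠ 0) (hDE : D * E = f) {x y z : F[X]} (hz : z ≠ 0)
    (h : D * x ^ 2 - E * y ^ 2 = z ^ 2)
    (hprim : ∀ p, Irreducible p → p ∣ x → p ∣ y → ¬ p ∣ z) :
    ∃ (J : Ideal (QRing f)) (w : QRing f), J ≠ ⊥ ∧ w ≠ 0 ∧ idl f D * (J * J) = Ideal.span {w} := by
  have hDs : Squarefree D := hf.squarefree_of_dvd ⟨_, hDE.symm⟩
  have hEs : Squarefree E := hf.squarefree_of_dvd ⟨D, by rw [← hDE, mul_comm]⟩
  have hzD : IsCoprime z D := by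
    refine isCoprime_of_prime_dvd (fun h0 => hz h0.1) fun p hp h1 h3 => ?_
    have hp := hp.irreducible
    have hpE : ¬ p ∣ E := fun h4 => hp.not_isUnit (hf p (hDE ▸ mul_dvd_mul h3 h4))
    have hpy : p ∣ y := by
      have : p ∣ E * y ^ 2 := by
        have e : E * y ^ 2 = D * x ^ 2 - z ^ 2 := by linear_combination -h
        rw [e]
        exact (h3.mul_right _).sub (h1.trans (dvd_pow_self _ two_ne_zero))
      exact hp.prime.dvd_of_dvd_pow ((hp.prime.dvd_or_dvd this).resolve_left hpE)
    have hpx : p ∣ x := by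
      refine prime_dvd_of_sq_dvd_mul_sq hDs hp ?_
      have e : D * x ^ 2 = z ^ 2 + E * y ^ 2 := by linear_combination h
      rw [e]
      exact (pow_dvd_pow_of_dvd h1 2).add ((pow_dvd_pow_of_dvd hpy 2).mul_left _)
    exact hprim p hp hpx hpy h1
  have hzx : IsCoprime z x := by
    refine isCoprime_of_prime_dvd (fun h0 => hz h0.1) fun p hp h1 h3 => ?_
    have hp := hp.irreducible
    have hpy : p ∣ y := by
      refine prime_dvd_of_sq_dvd_mul_sq hEs hp ?_
      have e : E * y ^ 2 = D * x ^ 2 - z ^ 2 := by linear_combination -h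
      rw [e]
      exact ((pow_dvd_pow_of_dvd h3 2).mul_left _).sub (pow_dvd_pow_of_dvd h1 2)
    exact hprim p hp h3 hpy h1
  have hzf : IsCoprime z (C 2 * (D ^ 2 * x)) := by
    refine IsCoprime.mul_right ?_ ((hzD.pow_right).mul_right hzx)
    exact isCoprime_one_right.of_isCoprime_of_dvd_right
      (isUnit_iff_dvd_one.1 (isUnit_C.2 (isUnit_iff_ne_zero.2 h2)))
  set w : QRing f := ⟨D * x, y⟩ with hw
  set w' : QRing f := ⟨D * x, -y⟩ with hw'
  set t : QRing f := ⟨- (E * y), x⟩ with ht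
  have hz' : inc f z ≠ 0 := by rwa [Ne, map_eq_zero_iff _ (inc_injective f)]
  have r1 : w * w' = inc f D * inc f z * inc f z := by
    rw [← map_mul, ← map_mul]
    apply QuadraticAlgebra.ext <;> simp only [hw, hw', re_mul, im_mul, algebraMap_re,
      algebraMap_im]
    · linear_combination D * h + y ^ 2 * hDE
    · ring
  have r2 : w * t = rt f * inc f z * inc f z := by
    apply QuadraticAlgebra.ext <;> simp only [hw, ht, re_mul, im_mul, algebraMap_re,
      algebraMap_im]
    · linear_combination -x * y * hDE
    · linear_combination h
  have r3 : inc f x * w' + inc f y * t = inc f z * inc f z := by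
    rw [← map_mul]
    apply QuadraticAlgebra.ext <;> simp only [hw', ht, re_mul, im_mul, algebraMap_re,
      algebraMap_im, re_add, im_add]
    · linear_combination h
    · ring
  have r4 : w + w' = inc f (C 2 * (D * x)) := by
    apply QuadraticAlgebra.ext <;> simp only [hw, hw', algebraMap_re, algebraMap_im, re_add,
      im_add, Polynomial.C_ofNat] <;> ring
  have hJz : inc f z ∈ Ideal.span {inc f z, w} := Ideal.subset_span (by simp)
  have hJw : w ∈ Ideal.span {inc f z, w} := Ideal.subset_span (by simp)
  have hDm : inc f D ∈ idl f D := Ideal.subset_span (by simp)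
  have hYm : rt f ∈ idl f D := Ideal.subset_span (by simp)
  refine ⟨Ideal.span {inc f z, w}, w, ?_, ?_, le_antisymm ?_ ?_⟩
  · intro h0
    rw [h0] at hJz
    exact hz' hJz
  · intro h0
    rw [h0, zero_mul] at r1
    have hD' : inc f D ≠ 0 := by rwa [Ne, map_eq_zero_iff _ (inc_injective f)]
    rw [← map_mul, ← map_mul, eq_comm, map_eq_zero_iff _ (inc_injective f)] at r1
    exact mul_ne_zero (mul_ne_zero hD hz) hz r1
  · rw [idl, Ideal.span_mul_span', Ideal.span_mul_span', Ideal.span_le]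
    rintro _ ⟨a, ha, _, ⟨b, hb, c, hc, rfl⟩, rfl⟩
    rw [SetLike.mem_coe, Ideal.mem_span_singleton]
    rcases hb with rfl | rfl
    · rcases hc with rfl | rfl
      · rcases ha with rfl | rfl
        · exact ⟨w', by rw [r1]; ring⟩
        · exact ⟨t, by rw [r2]; ring⟩
      · exact (dvd_mul_left _ _).mul_left _
    · exact (dvd_mul_right _ _).mul_left _
  · rw [Ideal.span_singleton_le_iff_mem]
    set P := idl f D * (Ideal.span {inc f z, w} * Ideal.span {inc f z, w})
    have m1 : inc f D * (inc f z * w) ∈ P := Ideal.mul_mem_mul hDm (Ideal.mul_mem_mul hJz hJw)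
    have m2 : inc f D * (inc f z * inc f z) ∈ P :=
      Ideal.mul_mem_mul hDm (Ideal.mul_mem_mul hJz hJz)
    have m3 : rt f * (inc f z * inc f z) ∈ P :=
      Ideal.mul_mem_mul hYm (Ideal.mul_mem_mul hJz hJz)
    have m4 : inc f D * (w * w) ∈ P := Ideal.mul_mem_mul hDm (Ideal.mul_mem_mul hJw hJw)
    have hz2 : w * (inc f z * inc f z) ∈ P := by
      have e : w * (inc f z * inc f z) = inc f x * (inc f D * (inc f z * inc f z)) +
          inc f y * (rt f * (inc f z * inc f z)) := by
        linear_combination -w * r3 + inc f x * r1 + inc f y * r2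
      rw [e]
      exact P.add_mem (P.mul_mem_left _ m2) (P.mul_mem_left _ m3)
    have hz1 : w * inc f z ∈ P := by
      obtain ⟨a, b, hab⟩ := hzD
      have hab' := congrArg (inc f) hab
      rw [map_add, map_mul, map_mul, map_one] at hab'
      have e : w * inc f z = inc f a * (w * (inc f z * inc f z)) +
          inc f b * (inc f D * (inc f z * w)) := by
        linear_combination -w * inc f z * hab'
      rw [e]
      exact P.add_mem (P.mul_mem_left _ hz2) (P.mul_mem_left _ m1)
    obtain ⟨a, b, hab⟩ := hzf
    have hab' := congrArg (inc f) hab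
    have e0 : inc f (a * z + b * (C 2 * (D ^ 2 * x))) =
        inc f a * inc f z + inc f b * inc f D * inc f (C 2 * (D * x)) := by
      simp only [← map_mul, ← map_add]
      congr 1
      ring
    rw [e0, map_one, ← r4] at hab'
    have e : w = inc f a * (w * inc f z) + inc f b * (inc f D * (w * w)) +
        inc f b * inc f D * (inc f D * (inc f z * inc f z)) := by
      linear_combination -w * hab' + inc f b * inc f D * r1
    rw [e]
    exact P.add_mem (P.add_mem (P.mul_mem_left _ hz1) (P.mul_mem_left _ m4))
      (P.mul_mem_left _ m2)

end QuadraticRing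

end FourRank

namespace FourRank

section LocalGlobal

variable {F : Type} [Field F]

theorem exists_dvd_sq_sub (a : F[X]) (S : Finset F[X])
    (hS : ∀ p ∈ S, ∀ q ∈ S, p ≠ q → IsCoprime p q) (h : ∀ p ∈ S, ∃ b, p ∣ b ^ 2 - a) :
    ∃ b, (∏ p ∈ S, p) ∣ b ^ 2 - a := by
  classical
  induction S using Finset.induction_on with
  | empty => exact ⟨0, by simp⟩
  | insert p S hp ih =>
    obtain ⟨b, hb⟩ := ih (fun q hq r hr => hS q (Finset.mem_insert_of_mem hq) r
      (Finset.mem_insert_of_mem hr)) fun q hq => h q (Finset.mem_insert_of_mem hq)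
    obtain ⟨c, hc⟩ := h p (Finset.mem_insert_self _ _)
    have hcop : IsCoprime p (∏ q ∈ S, q) := IsCoprime.prod_right fun q hq =>
      hS p (Finset.mem_insert_self _ _) q (Finset.mem_insert_of_mem hq) (by rintro rfl; exact hp hq)
    rw [Finset.prod_insert hp]
    obtain ⟨u, v, huv⟩ := id hcop
    generalize ∏ q ∈ S, q = T at *
    refine ⟨b * (u * p) + c * (v * T), hcop.mul_dvd ?_ ?_⟩
    · have e : (b * (u * p) + c * (v * T)) ^ 2 - a =
          c ^ 2 - a + p * (u * (b - c) * (u * p * (b - c) + 2 * c)) := by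
        linear_combination (c * (u * p + v * T - 1) + 2 * (b * (u * p) + c * (1 - u * p))) * c * huv
      rw [e]
      exact hc.add (dvd_mul_right _ _)
    · have e : (b * (u * p) + c * (v * T)) ^ 2 - a =
          b ^ 2 - a + T * (v * (c - b) * (v * T * (c - b) + 2 * b)) := by
        linear_combination (b * (u * p + v * T - 1) + 2 * (c * (v * T) + b * (1 - v * T))) * b * huv
      rw [e]
      exact hb.add (dvd_mul_right _ _)

theorem finrank_degreeLT (n : ℕ) : Module.finrank F (degreeLT F n) = n := by
  rw [(degreeLTEquiv F n).finrank_eq, Module.finrank_fin_fun]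

theorem finite_degreeLT (n : ℕ) : Module.Finite F (degreeLT F n) :=
  Module.Finite.equiv (degreeLTEquiv F n).symm

theorem degree_mul_sq_lt {p a : F[X]} {n k : ℕ} (hp : p ≠ 0) (ha : a ∈ degreeLT F n)
    (h : p.natDegree + 2 * n ≤ k + 1) : (p * a ^ 2).degree < (k : WithBot ℕ) := by
  by_cases ha0 : a = 0
  · rw [ha0, zero_pow two_ne_zero, mul_zero, degree_zero]
    exact WithBot.bot_lt_coe _
  rw [mem_degreeLT, degree_eq_natDegree ha0, Nat.cast_lt] at ha
  rw [degree_eq_natDegree (mul_ne_zero hp (pow_ne_zero _ ha0)),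
    natDegree_mul hp (pow_ne_zero _ ha0), natDegree_pow, Nat.cast_lt]
  omega

/-- Legendre's criterion: local solvability of `D x² - E y² = z²` implies solvability. -/
theorem exists_solution_of_local {i : F} (hi : i * i = -1) {D E : F[X]} (hD : D.Monic)
    (hE : E.Monic) (hodd : Odd (D.natDegree + E.natDegree)) (hcop : IsCoprime D E)
    {α β : F[X]} (hα : E ∣ α ^ 2 - D) (hβ : D ∣ β ^ 2 - E) :
    ∃ x y z : F[X], z ≠ 0 ∧ D * x ^ 2 - E * y ^ 2 = z ^ 2 := by
  set m := D.natDegree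
  set m' := E.natDegree
  have h1 := finite_degreeLT (F := F)
  have hmod : ∀ (p : F[X]), p.Monic → ∀ a, modByMonicHom p a ∈ degreeLT F p.natDegree := by
    intro p hp a
    rw [mem_degreeLT, modByMonicHom_apply, ← degree_eq_natDegree hp.ne_zero]
    exact degree_modByMonic_lt _ hp
  let V := degreeLT F ((m' + 1) / 2) × degreeLT F ((m + 1) / 2) × degreeLT F ((m + m' + 1) / 2)
  let xx : V →ₗ[F] F[X] := (Submodule.subtype _).comp (LinearMap.fst F _ _)
  let yy : V →ₗ[F] F[X] :=
    (Submodule.subtype _).comp ((LinearMap.fst F _ _).comp (LinearMap.snd F _ _))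
  let zz : V →ₗ[F] F[X] :=
    (Submodule.subtype _).comp ((LinearMap.snd F _ _).comp (LinearMap.snd F _ _))
  let L : V →ₗ[F] degreeLT F m' × degreeLT F m := LinearMap.prod
    (((modByMonicHom E).comp (zz - (LinearMap.mulLeft F α).comp xx)).codRestrict _
      fun v => hmod E hE _)
    (((modByMonicHom D).comp (zz - (LinearMap.mulLeft F (C i * β)).comp yy)).codRestrict _
      fun v => hmod D hD _)
  have hker : LinearMap.ker L ≠ ⊥ := by
    apply LinearMap.ker_ne_bot_of_finrank_lt
    simp only [V, Module.finrank_prod, finrank_degreeLT]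
    obtain ⟨k, hk⟩ := hodd
    omega
  obtain ⟨v, hv, hv0⟩ := Submodule.exists_mem_ne_zero_of_ne_bot hker
  obtain ⟨⟨x, hx⟩, ⟨y, hy⟩, ⟨z, hz⟩⟩ := v
  rw [LinearMap.mem_ker] at hv
  have hvE : E ∣ z - α * x := by
    have := congrArg (fun w => (w.1 : F[X])) hv
    exact (modByMonic_eq_zero_iff_dvd hE).1 this
  have hvD : D ∣ z - C i * β * y := by
    have := congrArg (fun w => (w.2 : F[X])) hv
    exact (modByMonic_eq_zero_iff_dvd hD).1 this
  have hCi : C i * C i = (-1 : F[X]) := by rw [← C_mul, hi, C_neg, C_1]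
  have hform : D * x ^ 2 - E * y ^ 2 - z ^ 2 = 0 := by
    refine eq_zero_of_dvd_of_degree_lt (p := D * E) (hcop.mul_dvd ?_ ?_) ?_
    · have e : D * x ^ 2 - E * y ^ 2 - z ^ 2 = D * x ^ 2 + (β ^ 2 - E) * y ^ 2 -
          (z - C i * β * y) * (z + C i * β * y) := by
        linear_combination - β ^ 2 * y ^ 2 * hCi
      rw [e]
      exact ((dvd_mul_right _ _).add (hβ.mul_right _)).sub (hvD.mul_right _)
    · have e : D * x ^ 2 - E * y ^ 2 - z ^ 2 = - (E * y ^ 2) - (α ^ 2 - D) * x ^ 2 -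
          (z - α * x) * (z + α * x) := by ring
      rw [e]
      exact ((dvd_mul_right _ _).neg_right.sub (hα.mul_right _)).sub (hvE.mul_right _)
    · have hdeg : (D * E).degree = ((m + m' : ℕ) : WithBot ℕ) := by
        rw [degree_mul, degree_eq_natDegree hD.ne_zero, degree_eq_natDegree hE.ne_zero]
        rfl
      rw [hdeg]
      refine (degree_sub_le _ _).trans_lt (max_lt ((degree_sub_le _ _).trans_lt (max_lt ?_ ?_)) ?_)
      · exact degree_mul_sq_lt hD.ne_zero hx (by omega)
      · exact degree_mul_sq_lt hE.ne_zero hy (by omega)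
      · rw [← one_mul (z ^ 2)]
        exact degree_mul_sq_lt one_ne_zero hz (by rw [natDegree_one]; omega)
  refine ⟨x, y, z, ?_, by linear_combination hform⟩
  rintro rfl
  by_cases hxy : x ≠ 0 ∨ y ≠ 0
  · apply form_ne_zero hi hD hE hodd hxy
    linear_combination hform
  · push Not at hxy
    obtain ⟨rfl, rfl⟩ := hxy
    exact hv0 rfl

end LocalGlobal

end FourRank

namespace FourRank

section QuadraticRing

open QuadraticAlgebra hiding C_ofNat norm_def

variable {F : Type} [Field F]

theorem root_sq (f : F[X]) : (AdjoinRoot.root ((X : (F[X])[X]) ^ 2 - Polynomial.C f)) ^ 2 =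
    AdjoinRoot.of _ f := by
  have := AdjoinRoot.eval₂_root ((X : (F[X])[X]) ^ 2 - Polynomial.C f)
  simp only [eval₂_sub, eval₂_pow, eval₂_X, eval₂_C] at this
  exact sub_eq_zero.1 this

/-- The two models of the coordinate ring agree. -/
noncomputable def hyperellipticEquiv (f : F[X]) : hyperellipticRing f ≃+* QRing f :=
  RingEquiv.ofRingHom
    (AdjoinRoot.lift (inc f) (rt f) (by
      simp only [eval₂_sub, eval₂_pow, eval₂_X, eval₂_C]
      rw [pow_two, rt_mul_rt, sub_self]))
    (QuadraticAlgebra.lift (A := hyperellipticRing f) ⟨AdjoinRoot.root _, by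
      rw [← pow_two, root_sq, zero_smul, add_zero, Algebra.smul_def, mul_one]
      rfl⟩ : QRing f →ₐ[F[X]] hyperellipticRing f).toRingHom
    (by
      apply RingHom.ext
      intro z
      simp only [RingHom.comp_apply, AlgHom.toRingHom_eq_coe, RingHom.coe_coe, lift_apply_apply,
        map_add, Algebra.smul_def, mul_one, map_mul, AdjoinRoot.lift_root, RingHom.id_apply]
      rw [AdjoinRoot.algebraMap_eq, AdjoinRoot.lift_of, AdjoinRoot.lift_of]
      apply QuadraticAlgebra.ext <;> simp)
    (by
      refine AdjoinRoot.ringHom_ext ?_ ?_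
      · apply RingHom.ext
        intro a
        simp
      · simp)

end QuadraticRing

section Divisors

variable {F : Type} [Field F]

theorem prod_monic {S : Finset F[X]} (hS : ∀ p ∈ S, p.Monic ∧ Irreducible p) :
    (∏ p ∈ S, p).Monic := monic_prod_of_monic _ _ fun p hp => (hS p hp).1

theorem mem_of_dvd_prod {S : Finset F[X]} (hS : ∀ p ∈ S, p.Monic ∧ Irreducible p) {p : F[X]}
    (hp : p.Monic) (hp' : Irreducible p) (h : p ∣ ∏ q ∈ S, q) : p ∈ S := by
  obtain ⟨q, hq, h⟩ := (hp'.prime.dvd_finsetProd_iff _).1 h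
  rwa [eq_of_monic_of_associated hp (hS q hq).1 (hp'.associated_of_dvd (hS q hq).2 h)]

theorem prod_injective {S T : Finset F[X]} (hS : ∀ p ∈ S, p.Monic ∧ Irreducible p)
    (hT : ∀ p ∈ T, p.Monic ∧ Irreducible p) (h : ∏ p ∈ S, p = ∏ p ∈ T, p) : S = T :=
  Finset.Subset.antisymm
    (fun p hp => mem_of_dvd_prod hT (hS p hp).1 (hS p hp).2 (h ▸ Finset.dvd_prod_of_mem _ hp))
    fun p hp => mem_of_dvd_prod hS (hT p hp).1 (hT p hp).2 (h ▸ Finset.dvd_prod_of_mem _ hp)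

theorem squarefree_prod {S : Finset F[X]} (hS : ∀ p ∈ S, p.Monic ∧ Irreducible p) :
    Squarefree (∏ p ∈ S, p) := by
  classical
  induction S using Finset.induction_on with
  | empty => simp
  | insert p S hp ih =>
    have hS' : ∀ q ∈ S, q.Monic ∧ Irreducible q := fun q hq => hS q (Finset.mem_insert_of_mem hq)
    have hp' := hS p (Finset.mem_insert_self _ _)
    rw [Finset.prod_insert hp, squarefree_mul_iff]
    refine ⟨?_, hp'.2.squarefree, ih hS'⟩
    refine IsCoprime.isRelPrime (IsCoprime.prod_right fun q hq =>
      isCoprime_of_monic_irreducible hp'.1 (hS' q hq).1 hp'.2 (hS' q hq).2 ?_)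
    rintro rfl
    exact hp hq

theorem exists_eq_prod_of_dvd [DecidableEq F[X]] {S : Finset F[X]}
    (hS : ∀ p ∈ S, p.Monic ∧ Irreducible p)
    {D : F[X]} (hD : D.Monic) (h : D ∣ ∏ p ∈ S, p) : ∃ U ⊆ S, D = ∏ p ∈ U, p := by
  classical
  refine ⟨S.filter (· ∣ D), Finset.filter_subset _ _, ?_⟩
  set U := S.filter (· ∣ D)
  have hU : ∀ p ∈ U, p.Monic ∧ Irreducible p := fun p hp => hS p (Finset.mem_filter.1 hp).1
  obtain ⟨K, hK⟩ : ∏ p ∈ U, p ∣ D := by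
    refine Finset.prod_dvd_of_coprime (fun p hp q hq hpq => ?_)
      fun p hp => (Finset.mem_filter.1 hp).2
    exact isCoprime_of_monic_irreducible (hU p hp).1 (hU q hq).1 (hU p hp).2 (hU q hq).2 hpq
  have hKm : K.Monic := (prod_monic hU).of_mul_monic_left (hK ▸ hD)
  suffices hKu : IsUnit K by
    rw [hK, hKm.eq_one_of_isUnit hKu, mul_one]
  by_contra hKu
  obtain ⟨p, hpm, hp, hpK⟩ := exists_monic_irreducible_factor K hKu
  have hpD : p ∣ D := hK ▸ hpK.mul_left _
  have hpS : p ∈ S := mem_of_dvd_prod hS hpm hp (hpD.trans h)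
  have hpU : p ∣ ∏ p ∈ U, p := Finset.dvd_prod_of_mem _ (Finset.mem_filter.2 ⟨hpS, hpD⟩)
  have hDs : Squarefree D := (squarefree_prod hS).squarefree_of_dvd h
  exact hp.not_isUnit (hDs p (hK ▸ mul_dvd_mul hpU hpK))

end Divisors

end FourRank

namespace FourRank

section QuadraticRing

open QuadraticAlgebra hiding C_ofNat norm_def

variable {F : Type} [Field F]

theorem exists_dvd_sq_sub_of_mul_sq {p a y z : F[X]} (hp : Irreducible p) (hy : ¬p ∣ y)
    (h : p ∣ z ^ 2 - a * y ^ 2) : ∃ b, p ∣ b ^ 2 - a := by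
  obtain ⟨u, v, huv⟩ := (hp.coprime_iff_not_dvd).2 hy
  refine ⟨z * v, ?_⟩
  have : (z * v) ^ 2 - a = v ^ 2 * (z ^ 2 - a * y ^ 2) - p * (u * (1 + v * y) * a) := by
    linear_combination (1 + v * y) * a * huv
  rw [this]
  exact dvd_sub (h.mul_left _) (dvd_mul_right _ _)

/-- A primitive solution of `D x² - E y² = z²` makes `D` a square modulo every prime dividing
`E`. -/
theorem exists_dvd_sq_sub_left {D E x y z p : F[X]} (hs : Squarefree (D * E))
    (h : D * x ^ 2 - E * y ^ 2 = z ^ 2)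
    (hprim : ∀ p, Irreducible p → p ∣ x → p ∣ y → ¬p ∣ z) (hp : Irreducible p) (hpE : p ∣ E) :
    ¬p ∣ D ∧ ∃ b, p ∣ b ^ 2 - D := by
  have hpD : ¬p ∣ D := fun hpD => hp.not_isUnit (hs p (mul_dvd_mul hpD hpE))
  refine ⟨hpD, exists_dvd_sq_sub_of_mul_sq (y := x) (z := z) hp (fun hx => ?_) ?_⟩
  · have hz : p ∣ z := by
      refine hp.prime.dvd_of_dvd_pow (n := 2) (h ▸ dvd_sub ?_ (hpE.mul_right _))
      exact (dvd_pow hx two_ne_zero).mul_left _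
    have hy : p ∣ y := by
      refine prime_dvd_of_sq_dvd_mul_sq (hs.squarefree_of_dvd (dvd_mul_left _ _)) hp ?_
      rw [show E * y ^ 2 = D * x ^ 2 - z ^ 2 by rw [← h]; ring]
      exact dvd_sub ((pow_dvd_pow_of_dvd hx 2).mul_left _) (pow_dvd_pow_of_dvd hz 2)
    exact hprim p hp hx hy hz
  · rw [← h, sub_sub_cancel_left]
    exact (hpE.mul_right _).neg_right

theorem exists_dvd_sq_sub_right {i : F} (hi : i * i = -1) {D E x y z p : F[X]}
    (hs : Squarefree (D * E)) (h : D * x ^ 2 - E * y ^ 2 = z ^ 2)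
    (hprim : ∀ p, Irreducible p → p ∣ x → p ∣ y → ¬p ∣ z) (hp : Irreducible p) (hpD : p ∣ D) :
    ¬p ∣ E ∧ ∃ b, p ∣ b ^ 2 - E := by
  have hC : (Polynomial.C i) ^ 2 = -1 := by
    rw [← Polynomial.C_pow, pow_two, hi, Polynomial.C_neg, Polynomial.C_1]
  have hiu : Polynomial.C i * -Polynomial.C i = 1 := by linear_combination -hC
  refine exists_dvd_sq_sub_left (x := y) (y := x) (z := Polynomial.C i * z) (mul_comm D E ▸ hs)
    ?_ ?_ hp hpD
  · linear_combination -h - hC * z ^ 2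
  · intro p hp hy hx hz
    refine hprim p hp hx hy ?_
    have := hz.mul_left (-Polynomial.C i)
    rwa [← mul_assoc, mul_comm (-Polynomial.C i), hiu, one_mul] at this

variable [Fintype F]

/-- Mutual quadratic residuosity of a set of primes and its complement. -/
def IsResidual (S U : Finset F[X]) [DecidableEq F[X]] : Prop :=
  (∀ p ∈ S \ U, ∏ q ∈ U, symb p q = 1) ∧ ∀ p ∈ U, ∏ q ∈ S \ U, symb p q = 1

theorem prod_symb_eq_one_iff (h4 : Fintype.card F % 4 = 1) {U : Finset F[X]}
    (hU : ∀ p ∈ U, p.Monic ∧ Irreducible p) {p : F[X]} (hp : p.Monic ∧ Irreducible p) :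
    ∏ q ∈ U, symb p q = 1 ↔ ¬p ∣ ∏ q ∈ U, q ∧ ∃ b, p ∣ b ^ 2 - ∏ q ∈ U, q := by
  rw [← symb_prod_right U p (fun q => q) fun q hq => (hU q hq).1.ne_zero,
    symb_eq_one_iff h4 _ _ hp.2 hp.1]

variable [DecidableEq F[X]]

theorem isResidual_of_solution (h4 : Fintype.card F % 4 = 1) {i : F} (hi : i * i = -1)
    {S U : Finset F[X]} (hS : ∀ p ∈ S, p.Monic ∧ Irreducible p) (hU : U ⊆ S)
    (h : ∃ x y z : F[X], z ≠ 0 ∧ (∏ p ∈ U, p) * x ^ 2 - (∏ p ∈ S \ U, p) * y ^ 2 = z ^ 2) :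
    IsResidual S U := by
  obtain ⟨x, y, z, hz, h⟩ := h
  obtain ⟨x, y, z, hz, h, hprim⟩ := exists_primitive_solution _ x y z hz rfl h
  have hs : Squarefree ((∏ p ∈ U, p) * ∏ p ∈ S \ U, p) := by
    rw [mul_comm, Finset.prod_sdiff hU]; exact squarefree_prod hS
  have hS' : ∀ p ∈ S \ U, p.Monic ∧ Irreducible p := fun p hp => hS p (Finset.mem_sdiff.1 hp).1
  have hU' : ∀ p ∈ U, p.Monic ∧ Irreducible p := fun p hp => hS p (hU hp)
  constructor
  · intro p hp
    rw [prod_symb_eq_one_iff h4 hU' (hS' p hp)]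
    exact exists_dvd_sq_sub_left hs h hprim (hS' p hp).2 (Finset.dvd_prod_of_mem _ hp)
  · intro p hp
    rw [prod_symb_eq_one_iff h4 hS' (hU' p hp)]
    exact exists_dvd_sq_sub_right hi hs h hprim (hU' p hp).2 (Finset.dvd_prod_of_mem _ hp)

theorem IsResidual.exists_solution (h4 : Fintype.card F % 4 = 1) {i : F} (hi : i * i = -1)
    {S U : Finset F[X]} (hS : ∀ p ∈ S, p.Monic ∧ Irreducible p)
    (hodd : Odd (∏ p ∈ S, p).natDegree) (hU : U ⊆ S) (h : IsResidual S U) :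
    ∃ x y z : F[X], z ≠ 0 ∧ (∏ p ∈ U, p) * x ^ 2 - (∏ p ∈ S \ U, p) * y ^ 2 = z ^ 2 := by
  have hS' : ∀ p ∈ S \ U, p.Monic ∧ Irreducible p := fun p hp => hS p (Finset.mem_sdiff.1 hp).1
  have hU' : ∀ p ∈ U, p.Monic ∧ Irreducible p := fun p hp => hS p (hU hp)
  have hcop : ∀ V : Finset F[X], (∀ p ∈ V, p.Monic ∧ Irreducible p) →
      ∀ p ∈ V, ∀ q ∈ V, p ≠ q → IsCoprime p q := fun V hV p hp q hq hpq =>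
    isCoprime_of_monic_irreducible (hV p hp).1 (hV q hq).1 (hV p hp).2 (hV q hq).2 hpq
  obtain ⟨α, hα⟩ := exists_dvd_sq_sub (∏ p ∈ U, p) (S \ U) (hcop _ hS') fun p hp =>
    ((prod_symb_eq_one_iff h4 hU' (hS' p hp)).1 (h.1 p hp)).2
  obtain ⟨β, hβ⟩ := exists_dvd_sq_sub (∏ p ∈ S \ U, p) U (hcop _ hU') fun p hp =>
    ((prod_symb_eq_one_iff h4 hS' (hU' p hp)).1 (h.2 p hp)).2
  refine exists_solution_of_local hi (prod_monic hU') (prod_monic hS') ?_ ?_ hα hβ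
  · rwa [← (prod_monic hU').natDegree_mul (prod_monic hS'), mul_comm, Finset.prod_sdiff hU]
  · refine IsCoprime.prod_left fun p hp => IsCoprime.prod_right fun q hq => ?_
    refine hcop S hS p (hU hp) q (Finset.mem_sdiff.1 hq).1 ?_
    rintro rfl
    exact (Finset.mem_sdiff.1 hq).2 hp

end QuadraticRing

end FourRank

namespace FourRank

section QuadraticRing

open QuadraticAlgebra hiding C_ofNat norm_def

variable {F : Type} [Field F]

/-- The class of the ideal of the divisor `D` of `f`. -/
noncomputable def idlClass (f D : F[X]) [IsDedekindDomain (QRing f)] :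
    ClassGroup (QRing f) :=
  ClassGroup.mk0 ⟨idl f D, mem_nonZeroDivisors_of_ne_zero (idl_ne_bot D)⟩

section Classes

variable {f : F[X]} [IsDedekindDomain (QRing f)]

theorem mul_self_eq_one_iff_exists_idlClass {i : F} (hi : i * i = -1) (h2 : (2 : F) ≠ 0)
    (hf : Squarefree f) (hfm : f.Monic) (hodd : Odd f.natDegree) (g : ClassGroup (QRing f)) :
    g * g = 1 ↔ ∃ D, D.Monic ∧ D ∣ f ∧ g = idlClass f D := by
  constructor
  · intro h
    obtain ⟨⟨I, hI⟩, rfl⟩ := ClassGroup.mk0_surjective g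
    have h1 := eq_inv_of_mul_eq_one_left h
    obtain ⟨x, hx, hxI⟩ := ClassGroup.mk0_eq_mk0_inv_iff.1 h1
    obtain ⟨D, hDm, hDf, b, c, hb, hc, hbc⟩ :=
      exists_idl_of_mul_self hi h2 hf hfm hodd (nonZeroDivisors.ne_zero hI) hx hxI
    exact ⟨D, hDm, hDf, ClassGroup.mk0_eq_mk0_iff.2 ⟨b, c, hb, hc, hbc⟩⟩
  · rintro ⟨D, hDm, ⟨E, hE⟩, rfl⟩
    rw [← eq_inv_iff_mul_eq_one]
    refine ClassGroup.mk0_eq_mk0_inv_iff.2 ⟨inc f D, ?_, idl_mul_self h2 hf hE.symm⟩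
    exact (map_ne_zero_iff _ (inc_injective f)).2 hDm.ne_zero

theorem idlClass_eq_iff {i : F} (hi : i * i = -1) (h2 : (2 : F) ≠ 0)
    (hf : Squarefree f) (hfm : f.Monic) (hodd : Odd f.natDegree) {D D' E E' : F[X]}
    (hD : D.Monic) (hE : E.Monic) (hDf : D * D' = f) (hEf : E * E' = f) :
    idlClass f D = idlClass f E ↔ D = E ∨ D' = E := by
  constructor
  · intro h
    obtain ⟨x, y, hx, hy, hxy⟩ := ClassGroup.mk0_eq_mk0_iff.1 h
    exact eq_or_of_span_mul_idl hi h2 hf hfm hodd hD hE hDf hEf hy hxy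
  · rintro (rfl | rfl)
    · rfl
    · refine ClassGroup.mk0_eq_mk0_iff.2 ⟨rt f, inc f D, ?_, ?_, span_mul_idl hDf⟩
      · intro h
        have := rt_mul_rt f
        rw [h, mul_zero] at this
        exact hfm.ne_zero ((map_eq_zero_iff _ (inc_injective f)).1 this.symm)
      · exact (map_ne_zero_iff _ (inc_injective f)).2 hD.ne_zero

theorem idlClass_isSquare_iff {i : F} (hi : i * i = -1) (h2 : (2 : F) ≠ 0)
    (hf : Squarefree f) (hfm : f.Monic) (hodd : Odd f.natDegree) {D E : F[X]}
    (hD : D.Monic) (hDE : D * E = f) :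
    (∃ h, idlClass f D = h ^ 2) ↔
      ∃ x y z : F[X], z ≠ 0 ∧ D * x ^ 2 - E * y ^ 2 = z ^ 2 := by
  constructor
  · rintro ⟨h, hh⟩
    obtain ⟨⟨H, hH⟩, hH'⟩ := ClassGroup.mk0_surjective h⁻¹
    have h1 : idlClass f D = (ClassGroup.mk0 (⟨H, hH⟩ * ⟨H, hH⟩))⁻¹ := by
      rw [map_mul, hH', hh, pow_two, mul_inv, inv_inv]
    obtain ⟨w, hw, hwI⟩ := ClassGroup.mk0_eq_mk0_inv_iff.1 h1
    exact exists_solution_of_idl_mul_sq hi h2 hf hfm hodd hD hDE (nonZeroDivisors.ne_zero hH)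
      hw hwI
  · rintro ⟨x, y, z, hz, h⟩
    obtain ⟨x, y, z, hz, h, hprim⟩ := exists_primitive_solution _ x y z hz rfl h
    obtain ⟨J, w, hJ, hw, hJw⟩ := exists_idl_mul_sq h2 hf hD.ne_zero hDE hz h hprim
    have hJ' := mem_nonZeroDivisors_of_ne_zero hJ
    have h1 : idlClass f D = (ClassGroup.mk0 (⟨J, hJ'⟩ * ⟨J, hJ'⟩))⁻¹ :=
      ClassGroup.mk0_eq_mk0_inv_iff.2 ⟨w, hw, hJw⟩
    refine ⟨(ClassGroup.mk0 ⟨J, hJ'⟩)⁻¹, ?_⟩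
    rw [h1, map_mul, pow_two, mul_inv]

end Classes

theorem setOf_sq_congr {G H : Type*} [CommGroup G] [CommGroup H] (e : G ≃* H) :
    Nat.card {g : G | ∃ h : G, h ^ 4 = 1 ∧ g = h ^ 2} =
      Nat.card {g : H | ∃ h : H, h ^ 4 = 1 ∧ g = h ^ 2} := by
  refine Nat.card_congr (e.toEquiv.subtypeEquiv fun g => ⟨?_, ?_⟩)
  · rintro ⟨h, h4, rfl⟩
    exact ⟨e h, by rw [← map_pow, h4, map_one], map_pow e h 2⟩
  · rintro ⟨h, h4, hg⟩
    refine ⟨e.symm h, by rw [← map_pow, h4, map_one], ?_⟩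
    rw [← map_pow, ← hg]
    exact (e.symm_apply_apply g).symm

variable [Fintype F]

open Classical in
/-- Rédei's criterion: the `4`-rank counts mutually residual splittings of the set of primes. -/
theorem card_isResidual (h4 : Fintype.card F % 4 = 1) {S : Finset F[X]}
    (hS : ∀ p ∈ S, p.Monic ∧ Irreducible p) (hodd : Odd (∏ p ∈ S, p).natDegree)
    [IsDedekindDomain (QRing (∏ p ∈ S, p))] :
    (S.powerset.filter fun U => IsResidual S U).card =
      2 * Nat.card {g : ClassGroup (QRing (∏ p ∈ S, p)) |
        ∃ h : ClassGroup (QRing (∏ p ∈ S, p)), h ^ 4 = 1 ∧ g = h ^ 2} := by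
  obtain ⟨i, hi⟩ := FiniteField.isSquare_neg_one_iff.2 (by omega : Fintype.card F % 4 ≠ 3)
  replace hi := hi.symm
  have h2 : (2 : F) ≠ 0 := Ring.two_ne_zero (by
    intro h
    have := FiniteField.even_card_iff_char_two.1 h
    omega)
  have hf := squarefree_prod hS
  have hfm := prod_monic hS
  have hm : ∀ U ⊆ S, (∏ p ∈ U, p).Monic := fun U hU => prod_monic fun p hp => hS p (hU hp)
  have hmul : ∀ U ⊆ S, (∏ p ∈ U, p) * ∏ p ∈ S \ U, p = ∏ p ∈ S, p := fun U hU => by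
    rw [mul_comm, Finset.prod_sdiff hU]
  have hinj : ∀ U ⊆ S, ∀ V ⊆ S, ∏ p ∈ U, p = ∏ p ∈ V, p → U = V := fun U hU V hV =>
    prod_injective (fun p hp => hS p (hU hp)) fun p hp => hS p (hV hp)
  have hres : ∀ U ⊆ S, ((∃ h, idlClass (∏ p ∈ S, p) (∏ p ∈ U, p) = h ^ 2) ↔ IsResidual S U) :=
    fun U hU => (idlClass_isSquare_iff hi h2 hf hfm hodd (hm U hU) (hmul U hU)).trans
      ⟨isResidual_of_solution h4 hi hS hU, fun h => h.exists_solution h4 hi hS hodd hU⟩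
  set c : Finset F[X] → ClassGroup (QRing (∏ p ∈ S, p)) :=
    fun U => idlClass (∏ p ∈ S, p) (∏ p ∈ U, p)
  have himage : {g : ClassGroup (QRing (∏ p ∈ S, p)) |
      ∃ h : ClassGroup (QRing (∏ p ∈ S, p)), h ^ 4 = 1 ∧ g = h ^ 2} =
      ↑((S.powerset.filter fun U => IsResidual S U).image c) := by
    ext g
    simp only [Set.mem_ofPred_eq, Finset.coe_image, Set.mem_image, Finset.mem_coe,
      Finset.mem_filter, Finset.mem_powerset]
    constructor
    · rintro ⟨h, h1, rfl⟩
      obtain ⟨D, hD, hDf, hh⟩ := (mul_self_eq_one_iff_exists_idlClass hi h2 hf hfm hodd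
        (h ^ 2)).1 (by rw [← h1]; group)
      obtain ⟨U, hU, rfl⟩ := exists_eq_prod_of_dvd hS hD hDf
      exact ⟨U, ⟨hU, (hres U hU).1 ⟨h, hh.symm⟩⟩, hh.symm⟩
    · rintro ⟨U, ⟨hU, hUr⟩, rfl⟩
      obtain ⟨h, hh⟩ := (hres U hU).2 hUr
      refine ⟨h, ?_, hh⟩
      have := (mul_self_eq_one_iff_exists_idlClass hi h2 hf hfm hodd (h ^ 2)).2
        ⟨_, hm U hU, ⟨_, (hmul U hU).symm⟩, hh.symm⟩
      rw [← this]; group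
  rw [himage, Nat.card_coe_set_eq, Set.ncard_coe_finset]
  have hSne : S.Nonempty := by
    rw [Finset.nonempty_iff_ne_empty]
    rintro rfl
    simp at hodd
  have hfib : ∀ g ∈ (S.powerset.filter fun U => IsResidual S U).image c,
      ((S.powerset.filter fun U => IsResidual S U).filter fun V => c V = g).card = 2 := by
    intro g hg
    obtain ⟨U, hU, rfl⟩ := Finset.mem_image.1 hg
    rw [Finset.mem_filter, Finset.mem_powerset] at hU
    have hne : U ≠ S \ U := by
      intro h
      obtain ⟨p, hp⟩ := hSne
      by_cases hpU : p ∈ U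
      · exact (Finset.mem_sdiff.1 (h ▸ hpU)).2 hpU
      · exact hpU (h ▸ Finset.mem_sdiff.2 ⟨hp, hpU⟩)
    rw [Finset.card_eq_two]
    refine ⟨U, S \ U, hne, ?_⟩
    ext V
    simp only [Finset.mem_filter, Finset.mem_powerset, Finset.mem_insert, Finset.mem_singleton]
    constructor
    · rintro ⟨⟨hV, hVr⟩, hVU⟩
      rcases (idlClass_eq_iff hi h2 hf hfm hodd (hm U hU.1) (hm V hV) (hmul U hU.1)
        (hmul V hV)).1 hVU.symm with h | h
      · exact Or.inl (hinj _ hU.1 _ hV h).symm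
      · exact Or.inr (hinj _ Finset.sdiff_subset _ hV h).symm
    · rintro (rfl | rfl)
      · exact ⟨hU, rfl⟩
      · have hss : S \ (S \ U) = U := sdiff_sdiff_eq_self hU.1
        refine ⟨⟨Finset.sdiff_subset, ?_, ?_⟩, ?_⟩
        · rw [hss]; exact hU.2.2
        · rw [hss]; exact hU.2.1
        · exact ((idlClass_eq_iff hi h2 hf hfm hodd (hm U hU.1) (hm _ Finset.sdiff_subset)
            (hmul U hU.1) (hmul _ Finset.sdiff_subset)).2 (Or.inr rfl)).symm
  rw [Finset.card_eq_sum_card_image c, Finset.sum_congr rfl hfib, Finset.sum_const, smul_eq_mul,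
    mul_comm]

open Classical in
theorem fourRankEq_prod_iff (h4 : Fintype.card F % 4 = 1) {S : Finset F[X]}
    (hS : ∀ p ∈ S, p.Monic ∧ Irreducible p) (hodd : Odd (∏ p ∈ S, p).natDegree) (r : ℕ) :
    fourRankEq (∏ p ∈ S, p) r ↔
      (S.powerset.filter fun U => IsResidual S U).card = 2 ^ (r + 1) := by
  obtain ⟨i, hi⟩ := FiniteField.isSquare_neg_one_iff.2 (by omega : Fintype.card F % 4 ≠ 3)
  replace hi := hi.symm
  have h2 : (2 : F) ≠ 0 := Ring.two_ne_zero (by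
    intro h
    have := FiniteField.even_card_iff_char_two.1 h
    omega)
  have hdom : IsDomain (QRing (∏ p ∈ S, p)) := qring_isDomain hi (prod_monic hS) hodd
  have hded : IsDedekindDomain (QRing (∏ p ∈ S, p)) :=
    qring_isDedekindDomain h2 (squarefree_prod hS) fun z hz =>
      qnorm_ne_zero hi (prod_monic hS) hodd hz
  have hdom' : IsDomain (hyperellipticRing (∏ p ∈ S, p)) :=
    MulEquiv.isDomain _ (hyperellipticEquiv (∏ p ∈ S, p)).toMulEquiv
  rw [card_isResidual h4 hS hodd, pow_succ', Nat.mul_right_inj two_ne_zero,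
    ← setOf_sq_congr (ClassGroup.mulEquiv (hyperellipticEquiv (∏ p ∈ S, p)))]
  exact ⟨fun h => h, fun h _ => h⟩

end QuadraticRing

end FourRank

namespace FourRank

/-- The sign `-1` as an element `1` of the field with two elements. -/
def signBit (a : ℤ) : ZMod 2 := if a = -1 then 1 else 0

theorem prod_eq_one_iff_sum_signBit {ι : Type*} (s : Finset ι) (x : ι → ℤ)
    (hx : ∀ i ∈ s, x i = 1 ∨ x i = -1) :
    ∏ i ∈ s, x i = 1 ↔ ∑ i ∈ s, signBit (x i) = 0 := by
  classical
  have key : ∏ i ∈ s, x i = if ∑ i ∈ s, signBit (x i) = 0 then 1 else -1 := by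
    induction s using Finset.induction_on with
    | empty => simp
    | insert a s ha ih =>
      rw [Finset.prod_insert ha, Finset.sum_insert ha,
        ih fun i hi => hx i (Finset.mem_insert_of_mem hi)]
      generalize ∑ i ∈ s, signBit (x i) = t
      rcases hx a (Finset.mem_insert_self _ _) with h | h <;> rw [h] <;> revert t <;> decide
  rw [key]
  split_ifs with h <;> simp [h]

/-- The symmetric matrix of quadratic residue symbols over the field with two elements. -/
noncomputable def symbMatrix {F : Type} [Field F] [Fintype F] {V W : Type*} (φ : V → F[X])
    (ψ : W → F[X]) : Matrix V W (ZMod 2) :=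
  fun p q => signBit (symb (φ p) (ψ q))

open Classical in
theorem card_isResidual_eq_lapKer {F : Type} [Field F] [Fintype F] {V : Type} [Fintype V]
    {S : Finset F[X]} (hS : ∀ p ∈ S, p.Monic ∧ Irreducible p) (φ : V → F[X])
    (hφ : Function.Injective φ) (hφS : Finset.univ.image φ = S) :
    (S.powerset.filter fun U => IsResidual S U).card = lapKer (symbMatrix φ φ) := by
  have hmem : ∀ p, φ p ∈ S := fun p => hφS ▸ Finset.mem_image_of_mem _ (Finset.mem_univ p)
  have hsymb : ∀ p q, p ≠ q → symb (φ p) (φ q) = 1 ∨ symb (φ p) (φ q) = -1 := fun p q hpq => by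
    refine symb_eq_one_or _ _ (hS _ (hmem p)).1.ne_zero ?_
    exact isCoprime_of_monic_irreducible (hS _ (hmem p)).1 (hS _ (hmem q)).1 (hS _ (hmem p)).2
      (hS _ (hmem q)).2 fun h => hpq (hφ h)
  have h01 : ∀ a : ZMod 2, a = 0 ∨ a = 1 := by decide
  have hres : ∀ v : V → ZMod 2, IsResidual S ((Finset.univ.filter fun p => v p = 1).image φ) ↔
      ∀ p, ∑ q, symbMatrix φ φ p q * (v q + v p) = 0 := by
    intro v
    have hsd : S \ (Finset.univ.filter fun p => v p = 1).image φ =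
        (Finset.univ.filter fun p => v p = 0).image φ := by
      ext x
      simp only [← hφS, Finset.mem_sdiff, Finset.mem_image, Finset.mem_univ, true_and,
        Finset.mem_filter]
      constructor
      · rintro ⟨⟨p, rfl⟩, h⟩
        exact ⟨p, (h01 (v p)).resolve_right fun h' => h ⟨p, h', rfl⟩, rfl⟩
      · rintro ⟨p, hp, rfl⟩
        refine ⟨⟨p, rfl⟩, ?_⟩
        rintro ⟨q, hq, hqp⟩
        rw [hφ hqp, hp] at hq
        exact absurd hq (by decide)
    have hP : ∀ (a b : ZMod 2), a ≠ b → ∀ p, v p = a →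
        (∏ q ∈ (Finset.univ.filter fun p => v p = b).image φ, symb (φ p) q = 1 ↔
          ∑ q, symbMatrix φ φ p q * (v q + v p) = 0) := by
      intro a b hab p hp
      rw [Finset.prod_image fun x _ y _ h => hφ h, prod_eq_one_iff_sum_signBit, Finset.sum_filter]
      · rw [iff_iff_eq]
        congr 1
        refine Finset.sum_congr rfl fun q _ => ?_
        rw [hp]
        have : ∀ (a b c : ZMod 2) e, a ≠ b → (if c = b then e else 0) = e * (c + a) := by decide
        exact this a b (v q) _ hab
      · intro q hq
        refine hsymb p q ?_
        rintro rfl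
        exact hab (hp.symm.trans (Finset.mem_filter.1 hq).2)
    unfold IsResidual
    rw [hsd]
    constructor
    · rintro ⟨h0, h1⟩ p
      rcases h01 (v p) with hp | hp
      · exact (hP 0 1 (by decide) p hp).1 (h0 _ (Finset.mem_image_of_mem _ (by simpa using hp)))
      · exact (hP 1 0 (by decide) p hp).1 (h1 _ (Finset.mem_image_of_mem _ (by simpa using hp)))
    · intro h
      constructor
      · intro x hx
        obtain ⟨p, hp, rfl⟩ := Finset.mem_image.1 hx
        exact (hP 0 1 (by decide) p (Finset.mem_filter.1 hp).2).2 (h p)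
      · intro x hx
        obtain ⟨p, hp, rfl⟩ := Finset.mem_image.1 hx
        exact (hP 1 0 (by decide) p (Finset.mem_filter.1 hp).2).2 (h p)
  rw [lapKer, Nat.card_eq_fintype_card, Fintype.card_subtype]
  symm
  refine Finset.card_bij (fun v _ => (Finset.univ.filter fun p => v p = 1).image φ) ?_ ?_ ?_
  · intro v hv
    rw [Finset.mem_filter, Finset.mem_powerset]
    refine ⟨?_, (hres v).2 (Finset.mem_filter.1 hv).2⟩
    rw [← hφS]
    exact Finset.image_subset_image (Finset.filter_subset _ _)
  · intro v _ w _ h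
    have h' := Finset.image_injective hφ h
    funext p
    have := Finset.ext_iff.1 h' p
    simp only [Finset.mem_filter, Finset.mem_univ, true_and] at this
    have hdec : ∀ a b : ZMod 2, (a = 1 ↔ b = 1) → a = b := by decide
    exact hdec _ _ this
  · intro U hU
    rw [Finset.mem_filter, Finset.mem_powerset] at hU
    have hUeq : (Finset.univ.filter fun p => (if φ p ∈ U then (1 : ZMod 2) else 0) = 1).image φ
        = U := by
      ext x
      simp only [Finset.mem_image, Finset.mem_filter, Finset.mem_univ, true_and,
        ite_eq_left_iff, zero_ne_one, imp_false, not_not]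
      constructor
      · rintro ⟨p, hp, rfl⟩; exact hp
      · intro hx
        obtain ⟨p, -, rfl⟩ := Finset.mem_image.1 (hφS ▸ hU.1 hx)
        exact ⟨p, hx, rfl⟩
    refine ⟨fun p => if φ p ∈ U then 1 else 0, ?_, hUeq⟩
    rw [Finset.mem_filter]
    exact ⟨Finset.mem_univ _, (hres _).1 (by rw [hUeq]; exact hU.2)⟩

end FourRank

namespace FourRank

variable (F : Type) [Field F] [Fintype F]

open Classical in
/-- The monic irreducible polynomials of degree at most `n`. -/
noncomputable def primesLE (n : ℕ) : Finset F[X] := (Finset.range (n + 1)).biUnion (primes F)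

theorem mem_primesLE {n : ℕ} {p : F[X]} :
    p ∈ primesLE F n ↔ p.Monic ∧ Irreducible p ∧ p.natDegree ≤ n := by
  simp only [primesLE, Finset.mem_biUnion, Finset.mem_range, mem_primes, Nat.lt_succ_iff]
  constructor
  · rintro ⟨k, hk, h1, h2, rfl⟩
    exact ⟨h1, h2, hk⟩
  · rintro ⟨h1, h2, h3⟩
    exact ⟨_, h3, h1, h2, rfl⟩

variable {F}

/-- The total degree of a set of polynomials. -/
noncomputable def wt (S : Finset F[X]) : ℕ := ∑ p ∈ S, p.natDegree

/-- The reciprocal `q⁻ᵈ` of the norm of a polynomial of degree `d`. -/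
noncomputable def iv (p : F[X]) : ℝ := ((Fintype.card F : ℝ) ^ p.natDegree)⁻¹

theorem card_pos_real : 0 < (Fintype.card F : ℝ) := by exact_mod_cast Fintype.card_pos

theorem iv_pos (p : F[X]) : 0 < iv p := inv_pos.2 (pow_pos card_pos_real _)

theorem prod_iv (S : Finset F[X]) : ∏ p ∈ S, iv p = ((Fintype.card F : ℝ) ^ wt S)⁻¹ := by
  simp only [iv, wt]
  rw [Finset.prod_inv_distrib, Finset.prod_pow_eq_pow_sum]

variable (F) in
/-- The sets of monic irreducible polynomials of total degree `d`. -/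
noncomputable def primeSets (d : ℕ) : Finset (Finset F[X]) :=
  (primesLE F d).powerset.filter fun S => wt S = d

theorem natDegree_le_wt {S : Finset F[X]} {p : F[X]} (hp : p ∈ S) : p.natDegree ≤ wt S :=
  Finset.single_le_sum (f := fun p : F[X] => p.natDegree) (fun _ _ => Nat.zero_le _) hp

theorem mem_primeSets {d : ℕ} {S : Finset F[X]} :
    S ∈ primeSets F d ↔ (∀ p ∈ S, p.Monic ∧ Irreducible p) ∧ wt S = d := by
  simp only [primeSets, Finset.mem_filter, Finset.mem_powerset]
  constructor
  · rintro ⟨h, h'⟩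
    exact ⟨fun p hp => ⟨((mem_primesLE F).1 (h hp)).1, ((mem_primesLE F).1 (h hp)).2.1⟩, h'⟩
  · rintro ⟨h, h'⟩
    exact ⟨fun p hp => (mem_primesLE F).2 ⟨(h p hp).1, (h p hp).2, h' ▸ natDegree_le_wt hp⟩, h'⟩

theorem sum_iv_primesLE_le (n : ℕ) : ∑ p ∈ primesLE F n, iv p ≤ 1 + Real.log n := by
  classical
  refine le_trans ?_ (harmonic_le_one_add_log n)
  rw [primesLE, Finset.sum_biUnion, Finset.sum_range_succ']
  · have h0 : primes F 0 = ∅ := by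
      rw [Finset.eq_empty_iff_forall_notMem]
      intro p hp
      have := (mem_primes.1 hp)
      exact absurd this.2.2 this.2.1.natDegree_pos.ne'
    rw [h0, Finset.sum_empty, add_zero, harmonic]
    push_cast
    refine Finset.sum_le_sum fun k _ => ?_
    have h1 : ∀ p ∈ primes F (k + 1), iv p = ((Fintype.card F : ℝ) ^ (k + 1))⁻¹ := fun p hp => by
      rw [iv, (mem_primes.1 hp).2.2]
    rw [Finset.sum_congr rfl h1, Finset.sum_const, nsmul_eq_mul, ← div_eq_mul_inv,
      div_le_iff₀ (pow_pos card_pos_real _), ← div_eq_inv_mul, le_div_iff₀ (by positivity)]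
    have := mul_card_primes_le (F := F) (k + 1)
    rw [mul_comm]
    exact_mod_cast this
  · intro a _ b _ hab
    rw [Function.onFun, Finset.disjoint_left]
    intro p hp hq
    exact hab ((mem_primes.1 hp).2.2.symm.trans (mem_primes.1 hq).2.2)

theorem sum_powerset_prod_le_exp (U : Finset F[X]) (g : F[X] → ℝ) (hg : ∀ p ∈ U, 0 ≤ g p) :
    ∑ S ∈ U.powerset, ∏ p ∈ S, g p ≤ Real.exp (∑ p ∈ U, g p) := by
  classical
  rw [← Finset.prod_one_add, Real.exp_sum]
  exact Finset.prod_le_prod (fun p hp => by linarith [hg p hp])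
    fun p hp => by linarith [Real.add_one_le_exp (g p)]

open Classical in
/-- Removing one prime, weighted by its degree, from a set of primes of total degree `d`. -/
theorem sum_sum_natDegree_mul_le (d : ℕ) (Ψ : Finset F[X] → ℝ) (hΨ : ∀ S, 0 ≤ Ψ S) :
    ∑ S ∈ primeSets F d, ∑ p ∈ S, (p.natDegree : ℝ) * Ψ (S.erase p) ≤
      (Fintype.card F : ℝ) ^ d *
        ∑ S ∈ (primesLE F d).powerset.filter (fun S => wt S ≤ d), Ψ S * ∏ p ∈ S, iv p := by
  rw [Finset.mul_sum, Finset.sum_sigma']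
  set 𝒮 := (primesLE F d).powerset.filter (fun S => wt S ≤ d)
  have hinj : Set.InjOn (fun x : (_ : Finset F[X]) × F[X] =>
      (⟨x.1.erase x.2, x.2⟩ : (_ : Finset F[X]) × F[X])) ((primeSets F d).sigma fun S => S) := by
    rintro ⟨S, p⟩ hS ⟨T, r⟩ hT h
    simp only [Finset.coe_sigma, Set.mem_sigma_iff, Finset.mem_coe] at hS hT
    simp only [Sigma.mk.injEq, heq_eq_eq] at h
    obtain ⟨h, rfl⟩ := h
    rw [← Finset.insert_erase hS.2, ← Finset.insert_erase hT.2, h]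
  calc _ = ∑ x ∈ ((primeSets F d).sigma fun S => S).image (fun x : (_ : Finset F[X]) × F[X] =>
        (⟨x.1.erase x.2, x.2⟩ : (_ : Finset F[X]) × F[X])), (x.2.natDegree : ℝ) * Ψ x.1 := by
        rw [Finset.sum_image hinj]
    _ ≤ ∑ x ∈ 𝒮.sigma fun S => primes F (d - wt S), (x.2.natDegree : ℝ) * Ψ x.1 := by
        refine Finset.sum_le_sum_of_subset_of_nonneg ?_ fun x _ _ =>
          mul_nonneg (Nat.cast_nonneg _) (hΨ _)
        intro x hx
        obtain ⟨⟨S, p⟩, hS, rfl⟩ := Finset.mem_image.1 hx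
        obtain ⟨hS, hp⟩ := Finset.mem_sigma.1 hS
        have hmem := mem_primeSets.1 hS
        have hsum : wt (S.erase p) + p.natDegree = d := by
          rw [← hmem.2]; exact Finset.sum_erase_add _ _ hp
        rw [Finset.mem_sigma, mem_primes, Finset.mem_filter, Finset.mem_powerset]
        refine ⟨⟨fun r hr => ?_, by change wt (S.erase p) ≤ d; omega⟩, (hmem.1 p hp).1,
          (hmem.1 p hp).2, ?_⟩
        · exact Finset.mem_powerset.1 (Finset.mem_filter.1 hS).1 (Finset.mem_of_mem_erase hr)
        · change p.natDegree = d - wt (S.erase p)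
          omega
    _ ≤ _ := by
        rw [Finset.sum_sigma]
        refine Finset.sum_le_sum fun S hS => ?_
        have hSd : wt S ≤ d := (Finset.mem_filter.1 hS).2
        have h1 : ∀ p ∈ primes F (d - wt S), (p.natDegree : ℝ) * Ψ S =
            ((d - wt S : ℕ) : ℝ) * Ψ S := fun p hp => by rw [(mem_primes.1 hp).2.2]
        rw [Finset.sum_congr rfl h1, Finset.sum_const, nsmul_eq_mul, prod_iv]
        have h2 : (Fintype.card F : ℝ) ^ d * ((Fintype.card F : ℝ) ^ wt S)⁻¹ =
            (Fintype.card F : ℝ) ^ (d - wt S) :=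
          (pow_sub₀ _ card_pos_real.ne' hSd).symm
        calc ((primes F (d - wt S)).card : ℝ) * (((d - wt S : ℕ) : ℝ) * Ψ S)
            = (((d - wt S) * (primes F (d - wt S)).card : ℕ) : ℝ) * Ψ S := by push_cast; ring
          _ ≤ ((Fintype.card F ^ (d - wt S) : ℕ) : ℝ) * Ψ S :=
              mul_le_mul_of_nonneg_right (by exact_mod_cast mul_card_primes_le _) (hΨ S)
          _ = _ := by push_cast; rw [← h2]; ring

/-- An upper bound for the mean value of a nonnegative multiplicative function on squarefree
polynomials. -/
theorem mul_sum_prod_le (d : ℕ) (g : F[X] → ℝ) {A : ℝ} (hg : ∀ p, 0 ≤ g p) (hA : ∀ p, g p ≤ A) :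
    (d : ℝ) * ∑ S ∈ primeSets F d, ∏ p ∈ S, g p ≤
      A * (Fintype.card F : ℝ) ^ d * Real.exp (∑ p ∈ primesLE F d, g p * iv p) := by
  classical
  have hA0 : 0 ≤ A := (hg 0).trans (hA 0)
  have h1 : (d : ℝ) * ∑ S ∈ primeSets F d, ∏ p ∈ S, g p ≤
      ∑ S ∈ primeSets F d, ∑ p ∈ S, (p.natDegree : ℝ) * (A * ∏ r ∈ S.erase p, g r) := by
    rw [Finset.mul_sum]
    refine Finset.sum_le_sum fun S hS => ?_
    have : (d : ℝ) = ∑ p ∈ S, (p.natDegree : ℝ) := by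
      rw [← (mem_primeSets.1 hS).2, wt]; push_cast; rfl
    rw [this, Finset.sum_mul]
    refine Finset.sum_le_sum fun p hp => mul_le_mul_of_nonneg_left ?_ (Nat.cast_nonneg _)
    rw [← Finset.mul_prod_erase S g hp]
    exact mul_le_mul_of_nonneg_right (hA p) (Finset.prod_nonneg fun r _ => hg r)
  refine h1.trans ((sum_sum_natDegree_mul_le d (fun S => A * ∏ r ∈ S, g r) fun S =>
    mul_nonneg hA0 (Finset.prod_nonneg fun r _ => hg r)).trans ?_)
  rw [mul_comm A, mul_assoc]
  refine mul_le_mul_of_nonneg_left ?_ (pow_nonneg card_pos_real.le _)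
  refine le_trans ?_ (mul_le_mul_of_nonneg_left (sum_powerset_prod_le_exp (primesLE F d)
    (fun p => g p * iv p) fun p _ => mul_nonneg (hg p) (iv_pos p).le) hA0)
  rw [Finset.mul_sum]
  refine (Finset.sum_le_sum_of_subset_of_nonneg (Finset.filter_subset _ _) fun S _ _ => ?_).trans
    (le_of_eq (Finset.sum_congr rfl fun S _ => ?_))
  · exact mul_nonneg (mul_nonneg hA0 (Finset.prod_nonneg fun r _ => hg r))
      (Finset.prod_nonneg fun p _ => (iv_pos p).le)
  · rw [Finset.prod_mul_distrib, mul_assoc]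

end FourRank

namespace FourRank

variable {F : Type} [Field F] [Fintype F]

theorem natDegree_prod_eq_wt {S : Finset F[X]} (hS : ∀ p ∈ S, p.Monic ∧ Irreducible p) :
    (∏ p ∈ S, p).natDegree = wt S :=
  natDegree_prod_of_monic _ _ fun p hp => (hS p hp).1

theorem exists_eq_prod_of_squarefree {f : F[X]} (hf : f.Monic) (hs : Squarefree f) :
    ∃ S : Finset F[X], (∀ p ∈ S, p.Monic ∧ Irreducible p) ∧ ∏ p ∈ S, p = f := by
  classical
  set S := (primesLE F f.natDegree).filter (· ∣ f)
  have hS : ∀ p ∈ S, p.Monic ∧ Irreducible p := fun p hp => by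
    have := (mem_primesLE F).1 (Finset.mem_filter.1 hp).1
    exact ⟨this.1, this.2.1⟩
  refine ⟨S, hS, ?_⟩
  obtain ⟨K, hK⟩ : ∏ p ∈ S, p ∣ f := by
    refine Finset.prod_dvd_of_coprime (fun p hp q hq hpq => ?_)
      fun p hp => (Finset.mem_filter.1 hp).2
    exact isCoprime_of_monic_irreducible (hS p hp).1 (hS q hq).1 (hS p hp).2 (hS q hq).2 hpq
  have hKm : K.Monic := (prod_monic hS).of_mul_monic_left (hK ▸ hf)
  suffices hKu : IsUnit K by
    rw [hK, hKm.eq_one_of_isUnit hKu, mul_one]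
  by_contra hKu
  obtain ⟨p, hpm, hp, hpK⟩ := exists_monic_irreducible_factor K hKu
  have hpf : p ∣ f := hK ▸ hpK.mul_left _
  have hpS : p ∈ S := Finset.mem_filter.2
    ⟨(mem_primesLE F).2 ⟨hpm, hp, natDegree_le_of_dvd hpf hf.ne_zero⟩, hpf⟩
  have hpU : p ∣ ∏ p ∈ S, p := Finset.dvd_prod_of_mem _ hpS
  exact hp.not_isUnit (hs p (hK ▸ mul_dvd_mul hpU hpK))

open Classical in
theorem card_squarefree_eq (d : ℕ) (Q : F[X] → Prop) :
    Nat.card {f : F[X] // f.Monic ∧ Squarefree f ∧ f.natDegree = d ∧ Q f} =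
      ((primeSets F d).filter fun S => Q (∏ p ∈ S, p)).card := by
  rw [Nat.subtype_card (((primeSets F d).filter fun S => Q (∏ p ∈ S, p)).image
    fun S => ∏ p ∈ S, p)]
  · refine Finset.card_image_of_injOn fun S hS T hT h => ?_
    exact prod_injective (mem_primeSets.1 (Finset.mem_filter.1 hS).1).1
      (mem_primeSets.1 (Finset.mem_filter.1 hT).1).1 h
  · intro f
    simp only [Finset.mem_image, Finset.mem_filter, mem_primeSets]
    constructor
    · rintro ⟨S, ⟨⟨hS, rfl⟩, hQ⟩, rfl⟩
      exact ⟨prod_monic hS, squarefree_prod hS, natDegree_prod_eq_wt hS, hQ⟩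
    · rintro ⟨hf, hs, rfl, hQ⟩
      obtain ⟨S, hS, rfl⟩ := exists_eq_prod_of_squarefree hf hs
      exact ⟨S, ⟨⟨hS, (natDegree_prod_eq_wt hS).symm⟩, hQ⟩, rfl⟩

theorem card_primeSets_le (d : ℕ) : (primeSets F d).card ≤ Fintype.card F ^ d := by
  rw [← card_monics (F := F) d]
  refine Finset.card_le_card_of_injOn (fun S => ∏ p ∈ S, p) (fun S hS => ?_) fun S hS T hT h => ?_
  · have := mem_primeSets.1 hS
    exact mem_monics.2 ⟨prod_monic this.1, (natDegree_prod_eq_wt this.1).trans this.2⟩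
  · exact prod_injective (mem_primeSets.1 hS).1 (mem_primeSets.1 hT).1 h

/-- At least three quarters of all monic polynomials are squarefree over a field with at least
five elements. -/
theorem three_mul_pow_le_card_primeSets (hq : 5 ≤ Fintype.card F) (d : ℕ) :
    3 * Fintype.card F ^ d ≤ 4 * (primeSets F d).card := by
  classical
  set q := Fintype.card F
  have hsf : (monics F d).filter Squarefree ⊆ (primeSets F d).image fun S => ∏ p ∈ S, p := by
    intro f hf
    obtain ⟨hf, hs⟩ := Finset.mem_filter.1 hf
    obtain ⟨hf, hd⟩ := mem_monics.1 hf
    obtain ⟨S, hS, rfl⟩ := exists_eq_prod_of_squarefree hf hs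
    exact Finset.mem_image_of_mem _
      (mem_primeSets.2 ⟨hS, (natDegree_prod_eq_wt hS).symm.trans hd⟩)
  have hnsf : (monics F d).filter (fun f => ¬Squarefree f) ⊆
      (Finset.range d).biUnion fun n => (primes F (n + 1)).biUnion fun p =>
        if 2 * (n + 1) ≤ d then (monics F (d - 2 * (n + 1))).image fun g => p * p * g else ∅ := by
    intro f hf
    obtain ⟨hf, hs⟩ := Finset.mem_filter.1 hf
    obtain ⟨hf, hd⟩ := mem_monics.1 hf
    rw [squarefree_iff_irreducible_sq_not_dvd_of_ne_zero hf.ne_zero] at hs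
    push Not at hs
    obtain ⟨x, hx, hxf⟩ := hs
    obtain ⟨p, hpm, hp, hpx⟩ := exists_monic_irreducible_factor x hx.not_isUnit
    obtain ⟨g, rfl⟩ : p * p ∣ f := (mul_dvd_mul hpx hpx).trans hxf
    have hgm : g.Monic := (hpm.mul hpm).of_mul_monic_left hf
    have hdeg : 2 * p.natDegree + g.natDegree = d := by
      rw [← hd, (hpm.mul hpm).natDegree_mul hgm, hpm.natDegree_mul hpm]; ring
    have hpos := hp.natDegree_pos
    rw [Finset.mem_biUnion]
    refine ⟨p.natDegree - 1, Finset.mem_range.2 (by omega), Finset.mem_biUnion.2 ⟨p,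
      mem_primes.2 ⟨hpm, hp, by omega⟩, ?_⟩⟩
    rw [if_pos (by omega)]
    exact Finset.mem_image_of_mem _ (mem_monics.2 ⟨hgm, by omega⟩)
  have hcard : ∀ n ∈ Finset.range d, ((primes F (n + 1)).biUnion fun p =>
      if 2 * (n + 1) ≤ d then (monics F (d - 2 * (n + 1))).image fun g => p * p * g
        else ∅).card ≤ q ^ (d - 1 - n) := by
    intro n hn
    rw [Finset.mem_range] at hn
    refine Finset.card_biUnion_le.trans ?_
    split_ifs with h
    · refine (Finset.sum_le_card_nsmul _ _ (q ^ (d - 2 * (n + 1))) fun p _ =>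
        Finset.card_image_le.trans (card_monics _).le).trans ?_
      have h1 : (primes F (n + 1)).card ≤ q ^ (n + 1) :=
        (Nat.le_mul_of_pos_left _ n.succ_pos).trans (mul_card_primes_le (n + 1))
      calc _ ≤ q ^ (n + 1) * q ^ (d - 2 * (n + 1)) := Nat.mul_le_mul_right _ h1
        _ = _ := by rw [← pow_add]; congr 1; omega
    · simp
  have h1 : ((monics F d).filter fun f => ¬Squarefree f).card ≤ ∑ n ∈ Finset.range d, q ^ n := by
    refine ((Finset.card_le_card hnsf).trans Finset.card_biUnion_le).trans ?_
    rw [← Finset.sum_range_reflect (fun k => q ^ k)]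
    exact Finset.sum_le_sum hcard
  have h2 : ∀ n, 4 * ∑ k ∈ Finset.range n, q ^ k ≤ q ^ n := by
    intro n
    induction n with
    | zero => simp
    | succ n ih =>
      rw [Finset.sum_range_succ, pow_succ]
      nlinarith [Nat.mul_le_mul_left (q ^ n) hq]
  have h3 := Finset.card_filter_add_card_filter_not (s := monics F d) Squarefree
  rw [card_monics] at h3
  have h4 := (Finset.card_le_card hsf).trans Finset.card_image_le
  have h5 := h2 d
  change _ = q ^ d at h3
  omega

end FourRank

namespace FourRank

variable {F : Type} [Field F] [Fintype F]

open Classical in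
/-- The monic divisors of a polynomial. -/
noncomputable def monicDivisors (f : F[X]) : Finset F[X] :=
  ((Finset.range (f.natDegree + 1)).biUnion (monics F)).filter (· ∣ f)

theorem mem_monicDivisors {f g : F[X]} (hf : f ≠ 0) : g ∈ monicDivisors f ↔ g.Monic ∧ g ∣ f := by
  simp only [monicDivisors, Finset.mem_filter, Finset.mem_biUnion, Finset.mem_range, mem_monics]
  constructor
  · rintro ⟨⟨_, _, h, _⟩, h'⟩
    exact ⟨h, h'⟩
  · rintro ⟨h, h'⟩
    exact ⟨⟨_, Nat.lt_succ_of_le (natDegree_le_of_dvd h' hf), h, rfl⟩, h'⟩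

/-- The sum of a function over the monic divisors. -/
noncomputable def divisorSum (χ : F[X] → ℤ) (f : F[X]) : ℤ := ∑ g ∈ monicDivisors f, χ g

theorem divisorSum_mul {χ : F[X] → ℤ} (hmul : ∀ a b, a ≠ 0 → b ≠ 0 → χ (a * b) = χ a * χ b)
    {f h : F[X]} (hf : f ≠ 0) (hh : h ≠ 0) (hfh : IsRelPrime f h) :
    divisorSum χ (f * h) = divisorSum χ f * divisorSum χ h := by
  classical
  rw [divisorSum, divisorSum, divisorSum, Finset.sum_mul_sum, ← Finset.sum_product']
  symm
  refine Finset.sum_bij (fun x _ => x.1 * x.2) ?_ ?_ ?_ ?_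
  · rintro ⟨a, b⟩ hab
    rw [Finset.mem_product, mem_monicDivisors hf, mem_monicDivisors hh] at hab
    exact (mem_monicDivisors (mul_ne_zero hf hh)).2
      ⟨hab.1.1.mul hab.2.1, mul_dvd_mul hab.1.2 hab.2.2⟩
  · rintro ⟨a, b⟩ hab ⟨a', b'⟩ hab' heq
    rw [Finset.mem_product, mem_monicDivisors hf, mem_monicDivisors hh] at hab hab'
    have key : ∀ a b a' b' : F[X], a ∣ f → b' ∣ h → a * b = a' * b' → a ∣ a' := by
      intro a b a' b' ha hb' heq
      exact ((hfh.of_dvd_left ha).of_dvd_right hb').dvd_of_dvd_mul_right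
        (heq ▸ dvd_mul_right a b)
    have h1 := eq_of_monic_of_associated hab.1.1 hab'.1.1
      (associated_of_dvd_dvd (key _ _ _ _ hab.1.2 hab'.2.2 heq)
        (key _ _ _ _ hab'.1.2 hab.2.2 heq.symm))
    dsimp only at h1 heq
    subst h1
    rw [mul_left_cancel₀ hab.1.1.ne_zero heq]
  · intro g hg
    obtain ⟨hgm, hg⟩ := (mem_monicDivisors (mul_ne_zero hf hh)).1 hg
    obtain ⟨a, b, ha, hb, rfl⟩ := exists_dvd_and_dvd_of_dvd_mul hg
    have ha0 : a ≠ 0 := fun h => by rw [h, zero_mul] at hgm; exact hgm.ne_zero rfl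
    have hb0 : b ≠ 0 := fun h => by rw [h, mul_zero] at hgm; exact hgm.ne_zero rfl
    have hl : a.leadingCoeff * b.leadingCoeff = 1 := by rw [← leadingCoeff_mul]; exact hgm
    refine ⟨(a * C b.leadingCoeff, b * C a.leadingCoeff), ?_, ?_⟩
    · have hua : IsUnit (C a.leadingCoeff) := isUnit_C.2 (isUnit_iff_ne_zero.2
        (leadingCoeff_ne_zero.2 ha0))
      have hub : IsUnit (C b.leadingCoeff) := isUnit_C.2 (isUnit_iff_ne_zero.2
        (leadingCoeff_ne_zero.2 hb0))
      rw [Finset.mem_product, mem_monicDivisors hf, mem_monicDivisors hh]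
      refine ⟨⟨?_, (hub.mul_right_dvd).2 ha⟩, ?_, (hua.mul_right_dvd).2 hb⟩
      · rw [Monic, leadingCoeff_mul, leadingCoeff_C, hl]
      · rw [Monic, leadingCoeff_mul, leadingCoeff_C, mul_comm, hl]
    · dsimp only
      rw [mul_mul_mul_comm, ← C_mul, mul_comm b.leadingCoeff, hl, C_1, mul_one]
  · rintro ⟨a, b⟩ hab
    rw [Finset.mem_product, mem_monicDivisors hf, mem_monicDivisors hh] at hab
    exact (hmul a b hab.1.1.ne_zero hab.2.1.ne_zero).symm

theorem divisorSum_isUnit {χ : F[X] → ℤ} (h1 : χ 1 = 1) {f : F[X]} (hf : IsUnit f) :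
    divisorSum χ f = 1 := by
  have : monicDivisors f = {1} := by
    ext g
    rw [mem_monicDivisors hf.ne_zero, Finset.mem_singleton]
    constructor
    · rintro ⟨hg, hgf⟩
      exact hg.eq_one_of_isUnit (isUnit_of_dvd_unit hgf hf)
    · rintro rfl
      exact ⟨monic_one, one_dvd _⟩
  rw [divisorSum, this, Finset.sum_singleton, h1]

theorem divisorSum_prime_pow {χ : F[X] → ℤ} (h1 : χ 1 = 1)
    (hmul : ∀ a b, a ≠ 0 → b ≠ 0 → χ (a * b) = χ a * χ b) {p : F[X]} (hpm : p.Monic)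
    (hp : Irreducible p) (n : ℕ) :
    divisorSum χ (p ^ n) = ∑ i ∈ Finset.range (n + 1), χ p ^ i := by
  classical
  have hpow : ∀ i, χ (p ^ i) = χ p ^ i := by
    intro i
    induction i with
    | zero => simp [h1]
    | succ i ih => rw [pow_succ, hmul _ _ (pow_ne_zero _ hpm.ne_zero) hpm.ne_zero, ih, pow_succ]
  have : monicDivisors (p ^ n) = (Finset.range (n + 1)).image fun i => p ^ i := by
    ext g
    rw [mem_monicDivisors (pow_ne_zero _ hpm.ne_zero), Finset.mem_image]
    constructor
    · rintro ⟨hg, hgp⟩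
      obtain ⟨i, hi, h⟩ := (dvd_prime_pow hp.prime n).1 hgp
      exact ⟨i, Finset.mem_range.2 (by omega),
        (eq_of_monic_of_associated hg (hpm.pow i) h).symm⟩
    · rintro ⟨i, hi, rfl⟩
      exact ⟨hpm.pow i, pow_dvd_pow p (Nat.lt_succ_iff.1 (Finset.mem_range.1 hi))⟩
  rw [divisorSum, this, Finset.sum_image]
  · exact Finset.sum_congr rfl fun i _ => hpow i
  · intro i _ j _ h
    have := congrArg natDegree h
    dsimp only at this
    rw [hpm.natDegree_pow, hpm.natDegree_pow] at this
    exact Nat.eq_of_mul_eq_mul_right hp.natDegree_pos this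

theorem divisorSum_mul_isUnit {χ : F[X] → ℤ} {f u : F[X]} (hf : f ≠ 0) (hu : IsUnit u) :
    divisorSum χ (f * u) = divisorSum χ f := by
  have : monicDivisors (f * u) = monicDivisors f := by
    ext g
    rw [mem_monicDivisors hf, mem_monicDivisors (mul_ne_zero hf hu.ne_zero), hu.dvd_mul_right]
  rw [divisorSum, divisorSum, this]

theorem divisorSum_nonneg {χ : F[X] → ℤ} (h1 : χ 1 = 1)
    (hmul : ∀ a b, a ≠ 0 → b ≠ 0 → χ (a * b) = χ a * χ b)
    (htri : ∀ a, χ a = 1 ∨ χ a = 0 ∨ χ a = -1) {f : F[X]} (hf : f ≠ 0) :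
    0 ≤ divisorSum χ f := by
  induction f using UniqueFactorizationMonoid.induction_on_coprime with
  | h0 => exact absurd rfl hf
  | h1 hu => rw [divisorSum_isUnit h1 hu]; exact zero_le_one
  | hpr i hp =>
    rename_i p
    have hp0 := hp.ne_zero
    have hl : p.leadingCoeff⁻¹ ≠ 0 := inv_ne_zero (leadingCoeff_ne_zero.2 hp0)
    have hu : IsUnit (C p.leadingCoeff⁻¹) := isUnit_C.2 (isUnit_iff_ne_zero.2 hl)
    rw [← divisorSum_mul_isUnit (pow_ne_zero i hp0) (hu.pow i), ← mul_pow,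
      divisorSum_prime_pow h1 hmul (monic_mul_leadingCoeff_inv hp0)
        ((irreducible_mul_isUnit hu).2 hp.irreducible)]
    rcases htri (p * C p.leadingCoeff⁻¹) with h | h | h <;> rw [h]
    · exact Finset.sum_nonneg fun _ _ => by simp
    · exact Finset.sum_nonneg fun _ _ => pow_nonneg le_rfl _
    · rw [neg_one_geom_sum]
      split_ifs <;> decide
  | hcp hxy hx hy =>
    have hx0 := left_ne_zero_of_mul hf
    have hy0 := right_ne_zero_of_mul hf
    rw [divisorSum_mul hmul hx0 hy0 hxy]
    exact mul_nonneg (hx hx0) (hy hy0)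

theorem divisorSum_prod {χ : F[X] → ℤ} (h1 : χ 1 = 1)
    (hmul : ∀ a b, a ≠ 0 → b ≠ 0 → χ (a * b) = χ a * χ b) {S : Finset F[X]}
    (hS : ∀ p ∈ S, p.Monic ∧ Irreducible p) (hχ : ∀ p ∈ S, χ p = 1) :
    divisorSum χ (∏ p ∈ S, p) = 2 ^ S.card := by
  classical
  induction S using Finset.induction_on with
  | empty => simp [divisorSum_isUnit h1]
  | insert p S hp ih =>
    have hS' : ∀ q ∈ S, q.Monic ∧ Irreducible q := fun q hq => hS q (Finset.mem_insert_of_mem hq)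
    have hp' := hS p (Finset.mem_insert_self _ _)
    have hcop : IsRelPrime p (∏ q ∈ S, q) :=
      IsCoprime.isRelPrime (IsCoprime.prod_right fun q hq =>
        isCoprime_of_monic_irreducible hp'.1 (hS' q hq).1 hp'.2 (hS' q hq).2
          (by rintro rfl; exact hp hq))
    have h2 := divisorSum_prime_pow h1 hmul hp'.1 hp'.2 1
    rw [pow_one, hχ p (Finset.mem_insert_self _ _)] at h2
    rw [Finset.prod_insert hp, divisorSum_mul hmul hp'.1.ne_zero (prod_monic hS').ne_zero hcop, h2,
      ih hS' fun q hq => hχ q (Finset.mem_insert_of_mem hq), Finset.card_insert_of_notMem hp,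
      pow_succ']
    simp

theorem sum_divisorSum_monics (χ : F[X] → ℤ) (n : ℕ) :
    ∑ f ∈ monics F n, divisorSum χ f =
      ∑ k ∈ Finset.range (n + 1), (Fintype.card F : ℤ) ^ (n - k) * ∑ g ∈ monics F k, χ g := by
  classical
  have hR : ∀ k ∈ Finset.range (n + 1), (Fintype.card F : ℤ) ^ (n - k) * ∑ g ∈ monics F k, χ g =
      ∑ x ∈ monics F k ×ˢ monics F (n - k), χ x.1 := by
    intro k _
    rw [Finset.sum_product, Finset.mul_sum]
    refine Finset.sum_congr rfl fun g _ => ?_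
    change _ = ∑ y ∈ monics F (n - k), χ g
    rw [Finset.sum_const, card_monics, nsmul_eq_mul]
    push_cast
    rfl
  rw [Finset.sum_congr rfl hR, Finset.sum_sigma']
  unfold divisorSum
  rw [Finset.sum_sigma']
  symm
  refine Finset.sum_bij (fun x _ => ⟨x.2.1 * x.2.2, x.2.1⟩) ?_ ?_ ?_ ?_
  · rintro ⟨k, g, h⟩ hx
    simp only [Finset.mem_sigma, Finset.mem_range, Finset.mem_product, mem_monics] at hx
    obtain ⟨hk, ⟨hg, rfl⟩, hh, hd⟩ := hx
    rw [Finset.mem_sigma, mem_monics, mem_monicDivisors (hg.mul hh).ne_zero]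
    exact ⟨⟨hg.mul hh, by rw [hg.natDegree_mul hh]; omega⟩, hg, dvd_mul_right _ _⟩
  · rintro ⟨k, g, h⟩ hx ⟨k', g', h'⟩ hx' heq
    simp only [Finset.mem_sigma, Finset.mem_range, Finset.mem_product, mem_monics] at hx hx'
    simp only [Sigma.mk.injEq, heq_eq_eq] at heq
    obtain ⟨heq, rfl⟩ := heq
    have h1 := mul_left_cancel₀ hx.2.1.1.ne_zero heq
    have h2 : k = k' := hx.2.1.2.symm.trans hx'.2.1.2
    rw [h1, h2]
  · rintro ⟨f, g⟩ hx
    simp only [Finset.mem_sigma] at hx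
    obtain ⟨hf, hd⟩ := mem_monics.1 hx.1
    obtain ⟨hg, h, rfl⟩ := (mem_monicDivisors hf.ne_zero).1 hx.2
    have hh : h.Monic := hg.of_mul_monic_left hf
    rw [hg.natDegree_mul hh] at hd
    refine ⟨⟨g.natDegree, g, h⟩, ?_, rfl⟩
    simp only [Finset.mem_sigma, Finset.mem_range, Finset.mem_product, mem_monics]
    exact ⟨by omega, ⟨hg, trivial⟩, hh, by omega⟩
  · rintro ⟨k, g, h⟩ _
    rfl

/-- Weighted count of products of primes at which the quadratic character of `c` takes the
value `1`. -/
theorem sum_two_pow_mul_iv_le (h4 : Fintype.card F % 4 = 1) {c : F[X]} (hc : c.Monic)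
    (hs : Squarefree c) (hd : 0 < c.natDegree) (d : ℕ) (𝒮 : Finset (Finset F[X]))
    (h𝒮 : ∀ S ∈ 𝒮, (∀ p ∈ S, p.Monic ∧ Irreducible p ∧ symb c p = 1) ∧ wt S ≤ d) :
    ∑ S ∈ 𝒮, (2 : ℝ) ^ S.card * ∏ p ∈ S, iv p ≤ (d + 1) * c.natDegree := by
  classical
  have hχ1 : symb c 1 = 1 := symb_one_right c
  have hmul : ∀ a b, a ≠ 0 → b ≠ 0 → symb c (a * b) = symb c a * symb c b :=
    fun a b ha hb => symb_mul_right c a b ha hb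
  have htri : ∀ a, symb c a = 1 ∨ symb c a = 0 ∨ symb c a = -1 := by
    intro a
    by_cases h : IsCoprime c a
    · rcases symb_eq_one_or c a hc.ne_zero h with h | h
      · exact Or.inl h
      · exact Or.inr (Or.inr h)
    · exact Or.inr (Or.inl ((symb_eq_zero_iff c a hc.ne_zero).2 h))
  have hinj : Set.InjOn (fun S : Finset F[X] => ∏ p ∈ S, p) 𝒮 := fun S hS T hT h =>
    prod_injective (fun p hp => ⟨((h𝒮 S hS).1 p hp).1, ((h𝒮 S hS).1 p hp).2.1⟩)
      (fun p hp => ⟨((h𝒮 T hT).1 p hp).1, ((h𝒮 T hT).1 p hp).2.1⟩) h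
  have hq := card_pos_real (F := F)
  have hnn : ∀ f : F[X], f.Monic → 0 ≤ (divisorSum (symb c) f : ℝ) * iv f := fun f hf =>
    mul_nonneg (by exact_mod_cast divisorSum_nonneg hχ1 hmul htri hf.ne_zero) (iv_pos f).le
  have hdisj : ∀ a ∈ Finset.range (d + 1), ∀ b ∈ Finset.range (d + 1), a ≠ b →
      Disjoint (monics F a) (monics F b) := by
    intro a _ b _ hab
    rw [Finset.disjoint_left]
    intro f hf hf'
    exact hab ((mem_monics.1 hf).2.symm.trans (mem_monics.1 hf').2)
  have hinner : ∀ n, ∑ f ∈ monics F n, (divisorSum (symb c) f : ℝ) * iv f ≤ c.natDegree := by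
    intro n
    have h1 : ∀ f ∈ monics F n, (divisorSum (symb c) f : ℝ) * iv f =
        (divisorSum (symb c) f : ℝ) * ((Fintype.card F : ℝ) ^ n)⁻¹ := fun f hf => by
      rw [iv, (mem_monics.1 hf).2]
    rw [Finset.sum_congr rfl h1, ← Finset.sum_mul]
    have h2 := congrArg (Int.cast : ℤ → ℝ) (sum_divisorSum_monics (symb c) n)
    push_cast at h2
    rw [h2, Finset.sum_mul]
    calc _ ≤ ∑ k ∈ Finset.range (n + 1), if k < c.natDegree then (1 : ℝ) else 0 := by
          refine Finset.sum_le_sum fun k hk => ?_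
          have hkn : k ≤ n := Nat.lt_succ_iff.1 (Finset.mem_range.1 hk)
          split_ifs with h
          · have h3 : ∑ g ∈ monics F k, (symb c g : ℝ) ≤ (Fintype.card F : ℝ) ^ k := by
              calc _ ≤ ∑ g ∈ monics F k, (1 : ℝ) := Finset.sum_le_sum fun g _ => by
                    rcases htri g with h | h | h <;> rw [h] <;> norm_num
                _ = _ := by rw [Finset.sum_const, card_monics]; simp
            rw [← div_eq_mul_inv, div_le_one (pow_pos hq n)]
            calc _ ≤ (Fintype.card F : ℝ) ^ (n - k) * (Fintype.card F : ℝ) ^ k :=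
                  mul_le_mul_of_nonneg_left h3 (pow_nonneg hq.le _)
              _ = _ := by rw [← pow_add, Nat.sub_add_cancel hkn]
          · have h3 := congrArg (Int.cast : ℤ → ℝ)
              (sum_symb_monics h4 c hc hs hd (not_lt.1 h))
            push_cast at h3
            rw [h3, mul_zero, zero_mul]
      _ ≤ _ := by
          rw [← Finset.sum_filter, Finset.sum_const, nsmul_eq_mul, mul_one]
          have : (Finset.range (n + 1)).filter (· < c.natDegree) ⊆ Finset.range c.natDegree :=
            fun k hk => Finset.mem_range.2 (Finset.mem_filter.1 hk).2
          exact_mod_cast (Finset.card_le_card this).trans (Finset.card_range _).le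
  calc _ = ∑ S ∈ 𝒮, (divisorSum (symb c) (∏ p ∈ S, p) : ℝ) * iv (∏ p ∈ S, p) := by
        refine Finset.sum_congr rfl fun S hS => ?_
        have hS' : ∀ p ∈ S, p.Monic ∧ Irreducible p := fun p hp =>
          ⟨((h𝒮 S hS).1 p hp).1, ((h𝒮 S hS).1 p hp).2.1⟩
        rw [divisorSum_prod hχ1 hmul hS' fun p hp => ((h𝒮 S hS).1 p hp).2.2, prod_iv, iv,
          natDegree_prod_eq_wt hS']
        push_cast
        rfl
    _ = ∑ f ∈ 𝒮.image fun S => ∏ p ∈ S, p, (divisorSum (symb c) f : ℝ) * iv f := by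
        rw [Finset.sum_image hinj]
    _ ≤ ∑ f ∈ (Finset.range (d + 1)).biUnion (monics F),
        (divisorSum (symb c) f : ℝ) * iv f := by
        refine Finset.sum_le_sum_of_subset_of_nonneg ?_ fun f hf _ => ?_
        · intro f hf
          obtain ⟨S, hS, rfl⟩ := Finset.mem_image.1 hf
          have hS' : ∀ p ∈ S, p.Monic ∧ Irreducible p := fun p hp =>
            ⟨((h𝒮 S hS).1 p hp).1, ((h𝒮 S hS).1 p hp).2.1⟩
          exact Finset.mem_biUnion.2 ⟨wt S, Finset.mem_range.2 (Nat.lt_succ_of_le (h𝒮 S hS).2),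
            mem_monics.2 ⟨prod_monic hS', natDegree_prod_eq_wt hS'⟩⟩
        · obtain ⟨n, -, hn⟩ := Finset.mem_biUnion.1 hf
          exact hnn f (mem_monics.1 hn).1
    _ = ∑ n ∈ Finset.range (d + 1), ∑ f ∈ monics F n,
        (divisorSum (symb c) f : ℝ) * iv f := Finset.sum_biUnion hdisj
    _ ≤ ∑ n ∈ Finset.range (d + 1), (c.natDegree : ℝ) :=
        Finset.sum_le_sum fun n _ => hinner n
    _ = _ := by rw [Finset.sum_const, Finset.card_range, nsmul_eq_mul]; push_cast; ring

end FourRank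

namespace FourRank

variable {F : Type} [Field F] [Fintype F]

theorem card_primes_le_pow {n : ℕ} (hn : 0 < n) : (primes F n).card ≤ Fintype.card F ^ n :=
  (Nat.le_mul_of_pos_left _ hn).trans (mul_card_primes_le n)

theorem abs_symb_le_one (a b : F[X]) : |(symb a b : ℝ)| ≤ 1 := by
  rcases symb_trichotomy a b with h | h | h <;> rw [h] <;> norm_num

/-- The mean square of a character sum over primes. -/
theorem sum_monics_sq_le (h4 : Fintype.card F % 4 = 1) {m n : ℕ} (hm : 0 < m) (hmn : 2 * m ≤ n)
    {Z : Finset F[X]} (hZ : Z ⊆ primes F m) :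
    ∑ g ∈ monics F n, (∑ y ∈ Z, (symb g y : ℝ)) ^ 2 ≤ Z.card * (Fintype.card F : ℝ) ^ n := by
  classical
  have hp : ∀ y ∈ Z, y.Monic ∧ Irreducible y ∧ y.natDegree = m := fun y hy => mem_primes.1 (hZ hy)
  have h1 : ∀ g, (∑ y ∈ Z, (symb g y : ℝ)) ^ 2 = ∑ y ∈ Z, ∑ y' ∈ Z, (symb (y * y') g : ℝ) := by
    intro g
    rw [pow_two, Finset.sum_mul_sum]
    refine Finset.sum_congr rfl fun y hy => Finset.sum_congr rfl fun y' hy' => ?_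
    rw [symb_comm h4 (y * y') g, symb_mul_right g y y' (hp y hy).1.ne_zero (hp y' hy').1.ne_zero]
    push_cast
    rfl
  simp only [h1]
  rw [Finset.sum_comm, ← nsmul_eq_mul, ← Finset.sum_const]
  refine Finset.sum_le_sum fun y hy => ?_
  rw [Finset.sum_comm, ← Finset.add_sum_erase Z _ hy]
  have h2 : ∀ y' ∈ Z.erase y, ∑ g ∈ monics F n, (symb (y * y') g : ℝ) = 0 := by
    intro y' hy'
    obtain ⟨hne, hy'⟩ := Finset.mem_erase.1 hy'
    have hcop := isCoprime_of_monic_irreducible (hp y hy).1 (hp y' hy').1 (hp y hy).2.1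
      (hp y' hy').2.1 hne.symm
    have hdeg : (y * y').natDegree = 2 * m := by
      rw [(hp y hy).1.natDegree_mul (hp y' hy').1, (hp y hy).2.2, (hp y' hy').2.2, two_mul]
    exact_mod_cast sum_symb_monics h4 (y * y') ((hp y hy).1.mul (hp y' hy').1)
      ((squarefree_mul_iff).2 ⟨hcop.isRelPrime, (hp y hy).2.1.squarefree,
        (hp y' hy').2.1.squarefree⟩) (by omega) (by omega)
  rw [Finset.sum_eq_zero h2, add_zero]
  calc _ ≤ ∑ g ∈ monics F n, (1 : ℝ) :=
        Finset.sum_le_sum fun g _ => (le_abs_self _).trans (abs_symb_le_one _ _)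
    _ = _ := by rw [Finset.sum_const, card_monics]; simp

open Classical in
theorem sum_product_primes_le {n : ℕ} {X : Finset F[X]} (hX : X ⊆ primes F n) (f : F[X] → ℝ)
    (hf : ∀ g, 0 ≤ f g) :
    ∑ x ∈ X ×ˢ X, f (x.1 * x.2) ≤ 2 * ∑ g ∈ monics F (2 * n), f g := by
  have hp : ∀ y ∈ X, y.Monic ∧ Irreducible y ∧ y.natDegree = n := fun y hy => mem_primes.1 (hX hy)
  have hmaps : ∀ x ∈ X ×ˢ X, x.1 * x.2 ∈ monics F (2 * n) := by
    intro x hx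
    obtain ⟨h1, h2⟩ := Finset.mem_product.1 hx
    refine mem_monics.2 ⟨(hp _ h1).1.mul (hp _ h2).1, ?_⟩
    rw [(hp _ h1).1.natDegree_mul (hp _ h2).1, (hp _ h1).2.2, (hp _ h2).2.2, two_mul]
  rw [← Finset.sum_fiberwise_of_maps_to hmaps, Finset.mul_sum]
  refine Finset.sum_le_sum fun g _ => ?_
  have h1 : ∀ x ∈ (X ×ˢ X).filter (fun x => x.1 * x.2 = g), f (x.1 * x.2) = f g := fun x hx => by
    rw [(Finset.mem_filter.1 hx).2]
  rw [Finset.sum_congr rfl h1, Finset.sum_const, nsmul_eq_mul]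
  refine mul_le_mul_of_nonneg_right ?_ (hf g)
  rcases ((X ×ˢ X).filter fun x => x.1 * x.2 = g).eq_empty_or_nonempty with h | ⟨x, hx⟩
  · rw [h]; simp
  · obtain ⟨hxm, hxg⟩ := Finset.mem_filter.1 hx
    subst hxg
    obtain ⟨hx1, hx2⟩ := Finset.mem_product.1 hxm
    have hsub : ((X ×ˢ X).filter fun z => z.1 * z.2 = x.1 * x.2) ⊆ {x, (x.2, x.1)} := by
      rintro ⟨y, y'⟩ hy
      obtain ⟨hy, heq⟩ := Finset.mem_filter.1 hy
      obtain ⟨hy1, hy2⟩ := Finset.mem_product.1 hy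
      dsimp only at hy1 hy2 heq
      have hdvd : y ∣ x.1 * x.2 := heq ▸ dvd_mul_right _ _
      rw [Finset.mem_insert, Finset.mem_singleton]
      rcases (hp y hy1).2.1.prime.dvd_or_dvd hdvd with h | h
      · have h1 := eq_of_monic_of_associated (hp y hy1).1 (hp _ hx1).1
          ((hp y hy1).2.1.associated_of_dvd (hp _ hx1).2.1 h)
        subst h1
        left
        rw [mul_left_cancel₀ (hp _ hy1).1.ne_zero heq]
      · have h1 := eq_of_monic_of_associated (hp y hy1).1 (hp _ hx2).1
          ((hp y hy1).2.1.associated_of_dvd (hp _ hx2).2.1 h)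
        subst h1
        right
        rw [mul_comm x.1] at heq
        rw [mul_left_cancel₀ (hp _ hy1).1.ne_zero heq]
    exact_mod_cast (Finset.card_le_card hsub).trans Finset.card_le_two

/-- A bilinear estimate for sums of quadratic residue symbols over primes. -/
theorem bilinear_pow_four_le (h4 : Fintype.card F % 4 = 1) {m n : ℕ} (hm : 0 < m) (hmn : m ≤ n)
    {X Z : Finset F[X]} (hX : X ⊆ primes F n) (hZ : Z ⊆ primes F m) (a b : F[X] → ℝ)
    (ha : ∀ x, |a x| ≤ 1) (hb : ∀ x, |b x| ≤ 1) :
    (∑ x ∈ X, ∑ y ∈ Z, a x * b y * symb x y) ^ 4 ≤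
      2 * (Fintype.card F : ℝ) ^ (4 * n + 3 * m) := by
  classical
  have hp : ∀ y ∈ X, y.Monic ∧ Irreducible y ∧ y.natDegree = n := fun y hy => mem_primes.1 (hX hy)
  have hq := card_pos_real (F := F)
  have hXc : (X.card : ℝ) ≤ (Fintype.card F : ℝ) ^ n := by
    exact_mod_cast (Finset.card_le_card hX).trans (card_primes_le_pow (hm.trans_le hmn))
  have hZc : (Z.card : ℝ) ≤ (Fintype.card F : ℝ) ^ m := by
    exact_mod_cast (Finset.card_le_card hZ).trans (card_primes_le_pow hm)
  set q : ℝ := (Fintype.card F : ℝ)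
  set V : F[X] → ℝ := fun g => ∑ y ∈ Z, (symb g y : ℝ)
  set W : ℝ := ∑ x ∈ X ×ˢ X, a x.1 * a x.2 * V (x.1 * x.2)
  have h1 : (∑ x ∈ X, ∑ y ∈ Z, a x * b y * symb x y) ^ 2 ≤ Z.card * W := by
    have e1 : ∑ x ∈ X, ∑ y ∈ Z, a x * b y * symb x y =
        ∑ y ∈ Z, b y * ∑ x ∈ X, a x * symb x y := by
      rw [Finset.sum_comm]
      refine Finset.sum_congr rfl fun y _ => ?_
      rw [Finset.mul_sum]
      exact Finset.sum_congr rfl fun x _ => by ring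
    have e2 : W = ∑ y ∈ Z, (∑ x ∈ X, a x * symb x y) ^ 2 := by
      simp only [W, V, Finset.mul_sum]
      rw [Finset.sum_comm]
      refine Finset.sum_congr rfl fun y hy => ?_
      rw [pow_two, Finset.sum_mul_sum, Finset.sum_product]
      refine Finset.sum_congr rfl fun x hx => Finset.sum_congr rfl fun x' hx' => ?_
      rw [symb_mul_left y x x' (hp x hx).1.ne_zero (hp x' hx').1.ne_zero]
      push_cast
      ring
    rw [e1, e2]
    refine sq_sum_le_card_mul_sum_sq.trans ?_
    refine mul_le_mul_of_nonneg_left (Finset.sum_le_sum fun y _ => ?_) (Nat.cast_nonneg _)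
    rw [mul_pow]
    refine mul_le_of_le_one_left (sq_nonneg _) ?_
    rw [← sq_abs]
    exact pow_le_one₀ (abs_nonneg _) (hb y)
  have h2 : W ^ 2 ≤ (X.card : ℝ) ^ 2 * (2 * (Z.card * q ^ (2 * n))) := by
    calc W ^ 2 ≤ ((X ×ˢ X).card : ℝ) *
          ∑ x ∈ X ×ˢ X, (a x.1 * a x.2 * V (x.1 * x.2)) ^ 2 := sq_sum_le_card_mul_sum_sq
      _ ≤ ((X ×ˢ X).card : ℝ) * ∑ x ∈ X ×ˢ X, V (x.1 * x.2) ^ 2 := by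
          refine mul_le_mul_of_nonneg_left (Finset.sum_le_sum fun x _ => ?_) (Nat.cast_nonneg _)
          rw [mul_pow]
          refine mul_le_of_le_one_left (sq_nonneg _) ?_
          rw [← sq_abs, abs_mul]
          exact pow_le_one₀ (by positivity) (mul_le_one₀ (ha _) (abs_nonneg _) (ha _))
      _ ≤ ((X ×ˢ X).card : ℝ) * (2 * ∑ g ∈ monics F (2 * n), V g ^ 2) :=
          mul_le_mul_of_nonneg_left (sum_product_primes_le hX (fun g => V g ^ 2)
            fun g => sq_nonneg _) (Nat.cast_nonneg _)
      _ ≤ _ := by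
          rw [Finset.card_product]
          push_cast
          rw [← pow_two]
          gcongr
          exact sum_monics_sq_le h4 hm (by omega) hZ
  calc (∑ x ∈ X, ∑ y ∈ Z, a x * b y * symb x y) ^ 4
      = ((∑ x ∈ X, ∑ y ∈ Z, a x * b y * symb x y) ^ 2) ^ 2 := by ring
    _ ≤ (Z.card * W) ^ 2 := pow_le_pow_left₀ (sq_nonneg _) h1 2
    _ = (Z.card : ℝ) ^ 2 * W ^ 2 := by ring
    _ ≤ (Z.card : ℝ) ^ 2 * ((X.card : ℝ) ^ 2 * (2 * (Z.card * q ^ (2 * n)))) :=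
        mul_le_mul_of_nonneg_left h2 (sq_nonneg _)
    _ ≤ (q ^ m) ^ 2 * ((q ^ n) ^ 2 * (2 * (q ^ m * q ^ (2 * n)))) := by gcongr
    _ = _ := by ring

/-- The bilinear estimate in symmetric form. -/
theorem abs_bilinear_le (h4 : Fintype.card F % 4 = 1) {m n t : ℕ} (hm : 4 * t < m)
    (hn : 4 * t < n) {X Z : Finset F[X]} (hX : X ⊆ primes F n) (hZ : Z ⊆ primes F m)
    (a b : F[X] → ℝ) (ha : ∀ x, |a x| ≤ 1) (hb : ∀ x, |b x| ≤ 1) :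
    |∑ x ∈ X, ∑ y ∈ Z, a x * b y * symb x y| ≤
      2 * (Fintype.card F : ℝ) ^ (n + m) / (Fintype.card F : ℝ) ^ t := by
  have hq1 : 1 ≤ (Fintype.card F : ℝ) := by exact_mod_cast Fintype.card_pos
  have hq := card_pos_real (F := F)
  set q : ℝ := (Fintype.card F : ℝ)
  have key : ∀ k l, 4 * t ≤ k → 2 * q ^ (4 * l + 3 * k) ≤ (2 * q ^ (l + k) / q ^ t) ^ 4 := by
    intro k l hk
    rw [div_pow, le_div_iff₀ (by positivity)]
    calc 2 * q ^ (4 * l + 3 * k) * (q ^ t) ^ 4 = 2 * (q ^ (4 * l + 3 * k) * q ^ (4 * t)) := by ring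
      _ ≤ 16 * (q ^ (4 * l + 3 * k) * q ^ k) := by
          have := pow_le_pow_right₀ hq1 hk
          have h0 : 0 ≤ q ^ (4 * l + 3 * k) * q ^ k := by positivity
          nlinarith [mul_le_mul_of_nonneg_left this (pow_nonneg hq.le (4 * l + 3 * k))]
      _ = _ := by ring
  refine le_of_pow_le_pow_left₀ (n := 4) (by norm_num) (by positivity) ?_
  rw [Even.pow_abs (by decide)]
  rcases le_total m n with h | h
  · exact (bilinear_pow_four_le h4 (by omega) h hX hZ a b ha hb).trans (key m n hm.le)
  · have hsw : ∑ x ∈ X, ∑ y ∈ Z, a x * b y * symb x y =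
        ∑ y ∈ Z, ∑ x ∈ X, b y * a x * symb y x := by
      rw [Finset.sum_comm]
      refine Finset.sum_congr rfl fun y _ => Finset.sum_congr rfl fun x _ => ?_
      rw [symb_comm h4 x y]
      ring
    rw [hsw, add_comm n m]
    exact (bilinear_pow_four_le h4 (by omega) h hZ hX b a hb ha).trans (key n m hn.le)

end FourRank

namespace FourRank

section Tuples

variable {ι : Type*} [Fintype ι] [DecidableEq ι] {α : Type*}

theorem card_mul_sum_piFinset (X : ι → Finset α) (i : ι) (G : (ι → α) → ℝ) :
    (X i).card * ∑ P ∈ Fintype.piFinset X, G P =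
      ∑ P ∈ Fintype.piFinset X, ∑ x ∈ X i, G (Function.update P i x) := by
  rw [← Finset.sum_product', ← nsmul_eq_mul, ← Finset.sum_const, ← Finset.sum_product']
  have hmem : ∀ z : α × (ι → α), z ∈ X i ×ˢ Fintype.piFinset X →
      (Function.update z.2 i z.1, z.2 i) ∈ Fintype.piFinset X ×ˢ X i := by
    rintro ⟨x, P⟩ hz
    obtain ⟨hx, hP⟩ := Finset.mem_product.1 hz
    rw [Fintype.mem_piFinset] at hP
    refine Finset.mem_product.2 ⟨Fintype.mem_piFinset.2 fun k => ?_, hP i⟩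
    by_cases hk : k = i
    · subst hk; simpa using hx
    · simpa [hk] using hP k
  refine Finset.sum_nbij' (fun z => (Function.update z.2 i z.1, z.2 i))
    (fun z => (z.1 i, Function.update z.1 i z.2)) (fun z hz => hmem z hz) (fun z hz => ?_)
    (fun z _ => by simp) (fun z _ => by simp) (fun z _ => by simp)
  have := hmem (z.2, z.1) (Finset.mem_product.2 (Finset.mem_product.1 hz).symm)
  exact Finset.mem_product.2 (Finset.mem_product.1 this).symm

theorem abs_sum_piFinset_le (X : ι → Finset α) {i j : ι} (hij : i ≠ j) (h : α → α → ℝ)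
    {B : ℝ} (hB : ∀ a b : α → ℝ, (∀ x, |a x| ≤ 1) → (∀ x, |b x| ≤ 1) →
      |∑ x ∈ X i, ∑ y ∈ X j, a x * b y * h x y| ≤ B)
    (u v : (ι → α) → ℝ) (hu : ∀ P, |u P| ≤ 1) (hv : ∀ P, |v P| ≤ 1)
    (huj : ∀ P y, u (Function.update P j y) = u P) (hvi : ∀ P x, v (Function.update P i x) = v P)
    (n : ι → ℝ) (hn : ∀ k, ((X k).card : ℝ) ≤ n k) :
    |∑ P ∈ Fintype.piFinset X, u P * v P * h (P i) (P j)| ≤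
      B * ∏ k ∈ (Finset.univ.erase i).erase j, n k := by
  set T := ∑ P ∈ Fintype.piFinset X, u P * v P * h (P i) (P j)
  have hB0 : 0 ≤ B := by
    have := hB (fun _ => 0) (fun _ => 0) (by simp) (by simp)
    exact (abs_nonneg _).trans this
  have hn0 : ∀ k, 0 ≤ n k := fun k => (Nat.cast_nonneg _).trans (hn k)
  have h1 : (X j).card * ((X i).card * T) = ∑ P ∈ Fintype.piFinset X,
      ∑ x ∈ X i, ∑ y ∈ X j, u (Function.update P i x) * v (Function.update P j y) * h x y := by
    rw [card_mul_sum_piFinset X i, card_mul_sum_piFinset X j]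
    refine Finset.sum_congr rfl fun P _ => ?_
    rw [Finset.sum_comm]
    refine Finset.sum_congr rfl fun x _ => Finset.sum_congr rfl fun y _ => ?_
    rw [hvi, Function.update_comm hij.symm y x P, huj]
    simp [hij]
  have h2 : |(X j).card * ((X i).card * T)| ≤ (∏ k, ((X k).card : ℝ)) * B := by
    rw [h1]
    refine (Finset.abs_sum_le_sum_abs _ _).trans ?_
    calc _ ≤ ∑ P ∈ Fintype.piFinset X, B := Finset.sum_le_sum fun P _ =>
          hB (fun x => u (Function.update P i x)) (fun y => v (Function.update P j y))
            (fun _ => hu _) (fun _ => hv _)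
      _ = _ := by rw [Finset.sum_const, nsmul_eq_mul, Fintype.card_piFinset]; push_cast; rfl
  have hji : j ∈ Finset.univ.erase i := Finset.mem_erase.2 ⟨hij.symm, Finset.mem_univ _⟩
  rw [← Finset.mul_prod_erase _ _ (Finset.mem_univ i), ← Finset.mul_prod_erase _ _ hji,
    abs_mul, abs_mul, Nat.abs_cast, Nat.abs_cast] at h2
  rcases Nat.eq_zero_or_pos ((X i).card * (X j).card) with h0 | h0
  · have : T = 0 := by
      refine Finset.sum_eq_zero fun P hP => ?_
      rw [Fintype.mem_piFinset] at hP
      rcases Nat.mul_eq_zero.1 h0 with h0 | h0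
      · exact absurd (hP i) (by rw [Finset.card_eq_zero.1 h0]; simp)
      · exact absurd (hP j) (by rw [Finset.card_eq_zero.1 h0]; simp)
    rw [this, abs_zero]
    exact mul_nonneg hB0 (Finset.prod_nonneg fun k _ => hn0 k)
  · have h3 : (0 : ℝ) < (X i).card * (X j).card := by exact_mod_cast h0
    have h4 : |T| ≤ B * ∏ k ∈ (Finset.univ.erase i).erase j, ((X k).card : ℝ) := by
      refine le_of_mul_le_mul_left ?_ h3
      linarith
    exact h4.trans (mul_le_mul_of_nonneg_left
      (Finset.prod_le_prod (fun k _ => Nat.cast_nonneg _) fun k _ => hn k) hB0)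

end Tuples

variable {F : Type} [Field F] [Fintype F]

theorem abs_sum_symb_tuple_le (h4 : Fintype.card F % 4 = 1) {m t : ℕ} {n : Fin m → ℕ}
    (hn : ∀ k, 4 * t < n k) {X : Fin m → Finset F[X]} (hX : ∀ k, X k ⊆ primes F (n k))
    {i j : Fin m} (hij : i < j) (w : Fin m × Fin m → F[X] → F[X] → ℝ)
    (hw : ∀ e x y, |w e x y| ≤ 1) {E : Finset (Fin m × Fin m)} (hE : ∀ e ∈ E, e.1 < e.2)
    (hne : (i, j) ∉ E) :
    |∑ P ∈ Fintype.piFinset X, (symb (P i) (P j) : ℝ) * ∏ e ∈ E, w e (P e.1) (P e.2)| ≤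
      2 * (∏ k, (Fintype.card F : ℝ) ^ n k) / (Fintype.card F : ℝ) ^ t := by
  classical
  have hprod : ∀ (E' : Finset (Fin m × Fin m)) (P : Fin m → F[X]),
      |∏ e ∈ E', w e (P e.1) (P e.2)| ≤ 1 := fun E' P => by
    rw [Finset.abs_prod]
    exact Finset.prod_le_one (fun _ _ => abs_nonneg _) fun _ _ => hw _ _ _
  have key := abs_sum_piFinset_le X hij.ne (fun x y => (symb x y : ℝ))
    (fun a b ha hb => abs_bilinear_le h4 (hn j) (hn i) (hX i) (hX j) a b ha hb)
    (fun P => ∏ e ∈ E.filter (fun e => ¬(e.1 = j ∨ e.2 = j)), w e (P e.1) (P e.2))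
    (fun P => ∏ e ∈ E.filter (fun e => e.1 = j ∨ e.2 = j), w e (P e.1) (P e.2))
    (hprod _) (hprod _) (fun P y => Finset.prod_congr rfl fun e he => by
      have := (Finset.mem_filter.1 he).2
      push Not at this
      rw [Function.update_of_ne this.1, Function.update_of_ne this.2])
    (fun P x => Finset.prod_congr rfl fun e he => by
      obtain ⟨he, h⟩ := Finset.mem_filter.1 he
      have hlt := hE e he
      have h1 : e.1 ≠ i ∧ e.2 ≠ i := by
        rcases h with h | h
        · rw [h] at hlt ⊢
          exact ⟨hij.ne', (hij.trans hlt).ne'⟩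
        · refine ⟨fun h' => hne ?_, by rw [h]; exact hij.ne'⟩
          rw [← h, ← h']
          exact he
      rw [Function.update_of_ne h1.1, Function.update_of_ne h1.2])
    (fun k => (Fintype.card F : ℝ) ^ n k)
    (fun k => by
      exact_mod_cast (Finset.card_le_card (hX k)).trans
        (card_primes_le_pow ((Nat.zero_le _).trans_lt (hn k))))
  have hji : j ∈ Finset.univ.erase i := Finset.mem_erase.2 ⟨hij.ne', Finset.mem_univ _⟩
  calc _ = _ := by
        congr 1
        refine Finset.sum_congr rfl fun P _ => ?_
        rw [← Finset.prod_filter_mul_prod_filter_not E (fun e => e.1 = j ∨ e.2 = j)]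
        ring
    _ ≤ _ := key
    _ = _ := by
        rw [← Finset.mul_prod_erase Finset.univ _ (Finset.mem_univ i),
          ← Finset.mul_prod_erase _ _ hji, pow_add]
        ring

end FourRank

namespace FourRank

variable {F : Type} [Field F] [Fintype F]

theorem symb_self (p : F[X]) (hp : p.Monic) (hirr : Irreducible p) : symb p p = 0 := by
  rw [symb_eq_zero_iff _ _ hp.ne_zero]
  exact fun h => hirr.not_isUnit (isCoprime_self.1 h)

theorem symbMatrix_mem_alts (h4 : Fintype.card F % 4 = 1) {κ : Type} [Fintype κ] {P : κ → F[X]}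
    (hP : ∀ k, (P k).Monic ∧ Irreducible (P k)) : symbMatrix P P ∈ alts κ := by
  refine mem_alts.2 ⟨?_, fun k => ?_⟩
  · ext k l
    simp only [Matrix.transpose_apply, symbMatrix]
    rw [symb_comm h4]
  · simp only [symbMatrix]
    rw [symb_self _ (hP k).1 (hP k).2]
    rfl

theorem symb_eq_ite {p q : F[X]} (hp : p.Monic ∧ Irreducible p) (hq : q.Monic ∧ Irreducible q)
    (hpq : p ≠ q) : symb p q = if signBit (symb p q) = 1 then -1 else 1 := by
  rcases symb_eq_one_or p q hp.1.ne_zero (isCoprime_of_monic_irreducible hp.1 hq.1 hp.2 hq.2 hpq)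
    with h | h <;> rw [h] <;> decide

/-- The pairs of distinct indices. -/
def ltPairs (m : ℕ) : Finset (Fin m × Fin m) := Finset.univ.filter fun e => e.1 < e.2

open Classical in
theorem prod_ltPairs_sq {m : ℕ} {P : Fin m → F[X]} (hP : ∀ k, (P k).Monic ∧ Irreducible (P k)) :
    ∏ e ∈ ltPairs m, (symb (P e.1) (P e.2) : ℝ) ^ 2 = if Function.Injective P then 1 else 0 := by
  split_ifs with h
  · refine Finset.prod_eq_one fun e he => ?_
    have hne : P e.1 ≠ P e.2 := h.ne (Finset.mem_filter.1 he).2.ne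
    rw [symb_eq_ite (hP _) (hP _) hne]
    split_ifs <;> norm_num
  · rw [Function.not_injective_iff] at h
    obtain ⟨k, l, hkl, hne⟩ := h
    wlog hlt : k < l generalizing k l
    · exact this l k hkl.symm hne.symm (lt_of_le_of_ne (not_lt.1 hlt) hne.symm)
    refine Finset.prod_eq_zero (i := (k, l)) (by simp [ltPairs, hlt]) ?_
    dsimp only
    rw [hkl, symb_self _ (hP l).1 (hP l).2]
    norm_num

open Classical in
theorem prod_ltPairs_add (h4 : Fintype.card F % 4 = 1) {m : ℕ} {P : Fin m → F[X]}
    (hP : ∀ k, (P k).Monic ∧ Irreducible (P k)) {γ : Matrix (Fin m) (Fin m) (ZMod 2)}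
    (hγ : γ ∈ alts (Fin m)) :
    ∏ e ∈ ltPairs m, ((if γ e.1 e.2 = 1 then -1 else 1) * (symb (P e.1) (P e.2) : ℝ) +
      (symb (P e.1) (P e.2) : ℝ) ^ 2) =
    if Function.Injective P ∧ symbMatrix P P = γ then (2 : ℝ) ^ (ltPairs m).card else 0 := by
  by_cases hinj : Function.Injective P
  · by_cases hg : symbMatrix P P = γ
    · rw [if_pos ⟨hinj, hg⟩, ← Finset.prod_const]
      refine Finset.prod_congr rfl fun e he => ?_
      have hne : P e.1 ≠ P e.2 := hinj.ne (Finset.mem_filter.1 he).2.ne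
      rw [← hg, symb_eq_ite (hP _) (hP _) hne, symbMatrix]
      split_ifs <;> norm_num
    · rw [if_neg fun h => hg h.2]
      have hex : ∃ e ∈ ltPairs m, symbMatrix P P e.1 e.2 ≠ γ e.1 e.2 := by
        by_contra! hall
        refine hg ?_
        have h1 := mem_alts.1 (symbMatrix_mem_alts h4 hP)
        have h2 := mem_alts.1 hγ
        ext k l
        rcases lt_trichotomy k l with h | h | h
        · exact hall (k, l) (by simp [ltPairs, h])
        · rw [h, h1.2, h2.2]
        · rw [← h1.1.apply, ← h2.1.apply]
          exact hall (l, k) (by simp [ltPairs, h])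
      obtain ⟨e, he, hne'⟩ := hex
      refine Finset.prod_eq_zero he ?_
      have hne : P e.1 ≠ P e.2 := hinj.ne (Finset.mem_filter.1 he).2.ne
      have h01 : ∀ a : ZMod 2, a = 0 ∨ a = 1 := by decide
      have hz : (0 : ZMod 2) ≠ 1 := by decide
      rw [symb_eq_ite (hP _) (hP _) hne]
      unfold symbMatrix at hne'
      rcases h01 (γ e.1 e.2) with h | h <;>
        rcases h01 (signBit (symb (P e.1) (P e.2))) with h' | h' <;>
        rw [h, h'] at hne' ⊢ <;> first | exact absurd rfl hne' | simp [hz]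
  · rw [if_neg fun h => hinj h.1]
    rw [Function.not_injective_iff] at hinj
    obtain ⟨k, l, hkl, hne⟩ := hinj
    wlog hlt : k < l generalizing k l
    · exact this l k hkl.symm hne.symm (lt_of_le_of_ne (not_lt.1 hlt) hne.symm)
    refine Finset.prod_eq_zero (i := (k, l)) (by simp [ltPairs, hlt]) ?_
    dsimp only
    rw [hkl, symb_self _ (hP l).1 (hP l).2]
    norm_num

/-- The tuples of distinct primes from given sets. -/
noncomputable def injTuples {m : ℕ} (X : Fin m → Finset F[X]) : Finset (Fin m → F[X]) :=
  open Classical in (Fintype.piFinset X).filter Function.Injective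

open Classical in
theorem abs_card_symbMatrix_eq_sub_le (h4 : Fintype.card F % 4 = 1) {m t : ℕ} {n : Fin m → ℕ}
    (hn : ∀ k, 4 * t < n k) {X : Fin m → Finset F[X]} (hX : ∀ k, X k ⊆ primes F (n k))
    {γ : Matrix (Fin m) (Fin m) (ZMod 2)} (hγ : γ ∈ alts (Fin m)) :
    |(2 : ℝ) ^ (ltPairs m).card * ((injTuples X).filter fun P => symbMatrix P P = γ).card -
      (injTuples X).card| ≤ 2 ^ (ltPairs m).card *
        (2 * (∏ k, (Fintype.card F : ℝ) ^ n k) / (Fintype.card F : ℝ) ^ t) := by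
  set B := 2 * (∏ k, (Fintype.card F : ℝ) ^ n k) / (Fintype.card F : ℝ) ^ t
  have hp : ∀ P ∈ Fintype.piFinset X, ∀ k, (P k).Monic ∧ Irreducible (P k) := fun P hP k => by
    have := mem_primes.1 (hX k (Fintype.mem_piFinset.1 hP k))
    exact ⟨this.1, this.2.1⟩
  have e1 : (2 : ℝ) ^ (ltPairs m).card *
      ((injTuples X).filter fun P => symbMatrix P P = γ).card =
      ∑ P ∈ Fintype.piFinset X, ∏ e ∈ ltPairs m, ((if γ e.1 e.2 = 1 then -1 else 1) *
        (symb (P e.1) (P e.2) : ℝ) + (symb (P e.1) (P e.2) : ℝ) ^ 2) := by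
    rw [Finset.sum_congr rfl fun P hP => prod_ltPairs_add h4 (hp P hP) hγ, ← Finset.sum_filter,
      Finset.sum_const, nsmul_eq_mul, mul_comm, injTuples, Finset.filter_filter]
  have e2 : ((injTuples X).card : ℝ) = ∑ P ∈ Fintype.piFinset X, ∏ e ∈ ltPairs m,
      (symb (P e.1) (P e.2) : ℝ) ^ 2 := by
    rw [Finset.sum_congr rfl fun P hP => prod_ltPairs_sq (hp P hP), ← Finset.sum_filter,
      Finset.sum_const, nsmul_eq_mul, mul_one, injTuples]
  have e3 : ∀ P : Fin m → F[X], ∏ e ∈ ltPairs m, ((if γ e.1 e.2 = 1 then -1 else 1) *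
        (symb (P e.1) (P e.2) : ℝ) + (symb (P e.1) (P e.2) : ℝ) ^ 2) -
        ∏ e ∈ ltPairs m, (symb (P e.1) (P e.2) : ℝ) ^ 2 =
      ∑ E ∈ (ltPairs m).powerset.erase ∅,
        (∏ e ∈ E, (if γ e.1 e.2 = 1 then -1 else 1) * (symb (P e.1) (P e.2) : ℝ)) *
        ∏ e ∈ ltPairs m \ E, (symb (P e.1) (P e.2) : ℝ) ^ 2 := by
    intro P
    rw [Finset.prod_add, ← Finset.add_sum_erase _ _ (Finset.empty_mem_powerset (ltPairs m))]
    simp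
  rw [e1, e2, ← Finset.sum_sub_distrib, Finset.sum_congr rfl fun P _ => e3 P, Finset.sum_comm]
  refine (Finset.abs_sum_le_sum_abs _ _).trans ?_
  have hB : 0 ≤ B := by positivity
  have hterm : ∀ E ∈ (ltPairs m).powerset.erase ∅, |∑ P ∈ Fintype.piFinset X,
        (∏ e ∈ E, (if γ e.1 e.2 = 1 then -1 else 1) * (symb (P e.1) (P e.2) : ℝ)) *
        ∏ e ∈ ltPairs m \ E, (symb (P e.1) (P e.2) : ℝ) ^ 2| ≤ B := by
    intro E hE
    obtain ⟨hne, hE⟩ := Finset.mem_erase.1 hE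
    rw [Finset.mem_powerset] at hE
    obtain ⟨⟨i, j⟩, hij⟩ := Finset.nonempty_of_ne_empty hne
    have hlt : ∀ e ∈ ltPairs m, e.1 < e.2 := fun e he => (Finset.mem_filter.1 he).2
    have hsgn : ∀ e : Fin m × Fin m, |(if γ e.1 e.2 = 1 then (-1 : ℝ) else 1)| = 1 := fun e => by
      split_ifs <;> simp
    have key := abs_sum_symb_tuple_le h4 hn hX (hlt _ (hE hij))
      (fun e x y => if e ∈ E then (if γ e.1 e.2 = 1 then -1 else 1) * (symb x y : ℝ)
        else (symb x y : ℝ) ^ 2)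
      (fun e x y => by
        split_ifs
        · simpa using abs_symb_le_one x y
        · simpa using abs_symb_le_one x y
        · rw [abs_pow]; exact pow_le_one₀ (abs_nonneg _) (abs_symb_le_one x y))
      (E := (ltPairs m).erase (i, j)) (fun e he => hlt e (Finset.mem_of_mem_erase he))
      (Finset.notMem_erase _ _)
    refine le_trans (le_of_eq ?_) key
    have e4 : ∀ P : Fin m → F[X],
        (∏ e ∈ E, (if γ e.1 e.2 = 1 then -1 else 1) * (symb (P e.1) (P e.2) : ℝ)) *
          ∏ e ∈ ltPairs m \ E, (symb (P e.1) (P e.2) : ℝ) ^ 2 =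
        (if γ i j = 1 then -1 else 1) * ((symb (P i) (P j) : ℝ) *
          ∏ e ∈ (ltPairs m).erase (i, j), if e ∈ E then
            (if γ e.1 e.2 = 1 then -1 else 1) * (symb (P e.1) (P e.2) : ℝ)
            else (symb (P e.1) (P e.2) : ℝ) ^ 2) := by
      intro P
      have e5 : ∏ e ∈ ltPairs m, (if e ∈ E then
            (if γ e.1 e.2 = 1 then -1 else 1) * (symb (P e.1) (P e.2) : ℝ)
            else (symb (P e.1) (P e.2) : ℝ) ^ 2) =
          (∏ e ∈ E, (if γ e.1 e.2 = 1 then -1 else 1) * (symb (P e.1) (P e.2) : ℝ)) *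
          ∏ e ∈ ltPairs m \ E, (symb (P e.1) (P e.2) : ℝ) ^ 2 := by
        rw [Finset.prod_ite]
        congr 1
        · refine Finset.prod_congr ?_ fun _ _ => rfl
          ext e
          simp only [Finset.mem_filter]
          exact ⟨fun h => h.2, fun h => ⟨hE h, h⟩⟩
        · refine Finset.prod_congr ?_ fun _ _ => rfl
          ext e
          simp only [Finset.mem_filter, Finset.mem_sdiff]
      rw [← e5, ← Finset.mul_prod_erase _ _ (hE hij), if_pos hij, mul_assoc]
    rw [Finset.sum_congr rfl fun P _ => e4 P, ← Finset.mul_sum, abs_mul, hsgn (i, j), one_mul]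
  refine (Finset.sum_le_sum hterm).trans ?_
  rw [Finset.sum_const, nsmul_eq_mul]
  refine mul_le_mul_of_nonneg_right ?_ hB
  calc (((ltPairs m).powerset.erase ∅).card : ℝ) ≤ (ltPairs m).powerset.card := by
        exact_mod_cast Finset.card_le_card (Finset.erase_subset _ _)
    _ = _ := by rw [Finset.card_powerset]; push_cast; rfl

open Classical in
/-- The matrix of residue symbols of a tuple of distinct primes is nearly equidistributed. -/
theorem abs_card_symbMatrix_mem_sub_le (h4 : Fintype.card F % 4 = 1) {m t : ℕ} {n : Fin m → ℕ}
    (hn : ∀ k, 4 * t < n k) {X : Fin m → Finset F[X]} (hX : ∀ k, X k ⊆ primes F (n k))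
    (Γ : Matrix (Fin m) (Fin m) (ZMod 2) → Prop) :
    |(((injTuples X).filter fun P => Γ (symbMatrix P P)).card : ℝ) * (alts (Fin m)).card -
      ((alts (Fin m)).filter Γ).card * (injTuples X).card| ≤
        ((alts (Fin m)).filter Γ).card * (alts (Fin m)).card *
        (4 * (∏ k, (Fintype.card F : ℝ) ^ n k) / (Fintype.card F : ℝ) ^ t) := by
  set B := (∏ k, (Fintype.card F : ℝ) ^ n k) / (Fintype.card F : ℝ) ^ t with hB
  set c : Matrix (Fin m) (Fin m) (ZMod 2) → ℝ := fun γ =>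
    ((injTuples X).filter fun P => symbMatrix P P = γ).card with hc
  have hmaps : ∀ P ∈ injTuples X, symbMatrix P P ∈ alts (Fin m) := fun P hP =>
    symbMatrix_mem_alts h4 fun k => by
      have := mem_primes.1 (hX k (Fintype.mem_piFinset.1 (Finset.mem_filter.1 hP).1 k))
      exact ⟨this.1, this.2.1⟩
  have e1 : ((injTuples X).card : ℝ) = ∑ γ ∈ alts (Fin m), c γ := by
    rw [Finset.card_eq_sum_card_fiberwise hmaps]
    push_cast
    rfl
  have e2 : (((injTuples X).filter fun P => Γ (symbMatrix P P)).card : ℝ) =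
      ∑ γ ∈ (alts (Fin m)).filter Γ, c γ := by
    rw [Finset.card_eq_sum_card_fiberwise (t := (alts (Fin m)).filter Γ)
      (f := fun P => symbMatrix P P)]
    · push_cast
      refine Finset.sum_congr rfl fun γ hγ => ?_
      simp only [hc, Finset.filter_filter]
      congr 2
      refine Finset.filter_congr fun P _ => ?_
      exact ⟨fun h => h.2, fun h => ⟨h ▸ (Finset.mem_filter.1 hγ).2, h⟩⟩
    · intro P hP
      have := Finset.mem_filter.1 hP
      exact Finset.mem_filter.2 ⟨hmaps P this.1, this.2⟩
  have h2 : (0 : ℝ) < 2 ^ (ltPairs m).card := by positivity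
  have hdiff : ∀ γ ∈ alts (Fin m), ∀ γ' ∈ alts (Fin m), |c γ - c γ'| ≤ 4 * B := by
    intro γ hγ γ' hγ'
    have h := abs_card_symbMatrix_eq_sub_le h4 hn hX hγ
    have h' := abs_card_symbMatrix_eq_sub_le h4 hn hX hγ'
    rw [mul_div_assoc, ← hB] at h h'
    refine le_of_mul_le_mul_left ?_ h2
    rw [← abs_of_pos h2, ← abs_mul, abs_of_pos h2]
    rw [abs_le] at h h' ⊢
    constructor <;> nlinarith [h.1, h.2, h'.1, h'.2]
  have e3 : (((injTuples X).filter fun P => Γ (symbMatrix P P)).card : ℝ) * (alts (Fin m)).card -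
      ((alts (Fin m)).filter Γ).card * (injTuples X).card =
      ∑ γ ∈ (alts (Fin m)).filter Γ, ∑ γ' ∈ alts (Fin m), (c γ - c γ') := by
    simp only [Finset.sum_sub_distrib, Finset.sum_const, nsmul_eq_mul]
    rw [← Finset.mul_sum, ← e1, ← e2]
    ring
  rw [e3, mul_div_assoc, ← hB]
  refine (Finset.abs_sum_le_sum_abs _ _).trans ?_
  calc _ ≤ ∑ γ ∈ (alts (Fin m)).filter Γ, ∑ γ' ∈ alts (Fin m), 4 * B :=
        Finset.sum_le_sum fun γ hγ => (Finset.abs_sum_le_sum_abs _ _).trans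
          (Finset.sum_le_sum fun γ' hγ' => hdiff γ (Finset.mem_filter.1 hγ).1 γ' hγ')
    _ = _ := by simp only [Finset.sum_const, nsmul_eq_mul]; ring

end FourRank

namespace FourRank

variable {F : Type} [Field F] [Fintype F]

/-- The members of degree at most `T`. -/
def tinyPart (T : ℕ) (S : Finset F[X]) : Finset F[X] := S.filter fun p => p.natDegree ≤ T

/-- The members of degree exceeding `T`. -/
def largePart (T : ℕ) (S : Finset F[X]) : Finset F[X] := S.filter fun p => ¬ p.natDegree ≤ T

theorem sum_iv_le_of_subset {n : ℕ} {S : Finset F[X]} (hS : S ⊆ primesLE F n) :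
    ∑ p ∈ S, iv p ≤ 1 + Real.log n :=
  (Finset.sum_le_sum_of_subset_of_nonneg hS fun p _ _ => (iv_pos p).le).trans
    (sum_iv_primesLE_le n)

open Classical in
theorem mul_card_largePart_lt_le (d T M : ℕ) :
    (d : ℝ) * ((primeSets F d).filter fun S =>
      (largePart T S).card < (tinyPart T S).card + M).card ≤
      2 ^ M * (2 * (Fintype.card F : ℝ) ^ d *
        Real.exp (2 * (1 + Real.log T) + 1 / 2 * (1 + Real.log d))) := by
  set g : F[X] → ℝ := fun p => if p.natDegree ≤ T then 2 else 1 / 2 with hg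
  have hg0 : ∀ p, 0 ≤ g p := fun p => by simp only [hg]; split_ifs <;> norm_num
  have hg2 : ∀ p, g p ≤ 2 := fun p => by simp only [hg]; split_ifs <;> norm_num
  have h1 : (((primeSets F d).filter fun S =>
      (largePart T S).card < (tinyPart T S).card + M).card : ℝ) ≤
      2 ^ M * ∑ S ∈ primeSets F d, ∏ p ∈ S, g p := by
    rw [Finset.card_eq_sum_ones, Nat.cast_sum, Finset.mul_sum, Finset.sum_filter]
    refine Finset.sum_le_sum fun S _ => ?_
    have hpos : 0 ≤ ∏ p ∈ S, g p := Finset.prod_nonneg fun p _ => hg0 p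
    split_ifs with h
    · have e : ∏ p ∈ S, g p = 2 ^ (tinyPart T S).card * (1 / 2) ^ (largePart T S).card := by
        simp only [hg, Finset.prod_ite, Finset.prod_const, tinyPart, largePart]
      rw [e, one_div, inv_pow, ← mul_assoc, ← div_eq_mul_inv, le_div_iff₀ (by positivity),
        ← pow_add]
      push_cast
      rw [one_mul]
      exact pow_le_pow_right₀ one_le_two (by omega)
    · positivity
  have h2 : ∑ p ∈ primesLE F d, g p * iv p ≤
      2 * (1 + Real.log T) + 1 / 2 * (1 + Real.log d) := by
    rw [← Finset.sum_filter_add_sum_filter_not _ (fun p : F[X] => p.natDegree ≤ T)]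
    have e1 : ∑ p ∈ (primesLE F d).filter (fun p => p.natDegree ≤ T), g p * iv p =
        2 * ∑ p ∈ (primesLE F d).filter (fun p => p.natDegree ≤ T), iv p := by
      rw [Finset.mul_sum]
      exact Finset.sum_congr rfl fun p hp => by simp only [hg, if_pos (Finset.mem_filter.1 hp).2]
    have e2 : ∑ p ∈ (primesLE F d).filter (fun p => ¬ p.natDegree ≤ T), g p * iv p =
        1 / 2 * ∑ p ∈ (primesLE F d).filter (fun p => ¬ p.natDegree ≤ T), iv p := by
      rw [Finset.mul_sum]
      exact Finset.sum_congr rfl fun p hp => by simp only [hg, if_neg (Finset.mem_filter.1 hp).2]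
    rw [e1, e2]
    have b1 := sum_iv_le_of_subset (F := F) (n := T)
      (S := (primesLE F d).filter (fun p => p.natDegree ≤ T)) fun p hp => by
        obtain ⟨hp, h⟩ := Finset.mem_filter.1 hp
        rw [mem_primesLE] at hp ⊢
        exact ⟨hp.1, hp.2.1, h⟩
    have b2 := sum_iv_le_of_subset (F := F) (n := d)
      (S := (primesLE F d).filter (fun p => ¬ p.natDegree ≤ T)) (Finset.filter_subset _ _)
    linarith
  calc _ ≤ (d : ℝ) * (2 ^ M * ∑ S ∈ primeSets F d, ∏ p ∈ S, g p) :=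
        mul_le_mul_of_nonneg_left h1 (Nat.cast_nonneg _)
    _ = 2 ^ M * (d * ∑ S ∈ primeSets F d, ∏ p ∈ S, g p) := by ring
    _ ≤ 2 ^ M * (2 * (Fintype.card F : ℝ) ^ d * Real.exp (∑ p ∈ primesLE F d, g p * iv p)) :=
        mul_le_mul_of_nonneg_left (mul_sum_prod_le d g hg0 hg2) (by positivity)
    _ ≤ _ := by gcongr

open Classical in
theorem mul_card_lt_card_le (d K : ℕ) :
    2 ^ K * ((d : ℝ) * ((primeSets F d).filter fun S => K < S.card).card) ≤
      2 * (Fintype.card F : ℝ) ^ d * Real.exp (2 * (1 + Real.log d)) := by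
  have h1 : 2 ^ K * (((primeSets F d).filter fun S => K < S.card).card : ℝ) ≤
      ∑ S ∈ primeSets F d, ∏ p ∈ S, (2 : ℝ) := by
    rw [Finset.card_eq_sum_ones, Nat.cast_sum, Finset.mul_sum, Finset.sum_filter]
    refine Finset.sum_le_sum fun S _ => ?_
    rw [Finset.prod_const]
    split_ifs with h
    · push_cast
      rw [mul_one]
      exact pow_le_pow_right₀ one_le_two h.le
    · positivity
  calc _ = (d : ℝ) * (2 ^ K * ((primeSets F d).filter fun S => K < S.card).card) := by ring
    _ ≤ d * ∑ S ∈ primeSets F d, ∏ p ∈ S, (2 : ℝ) :=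
        mul_le_mul_of_nonneg_left h1 (Nat.cast_nonneg _)
    _ ≤ _ := mul_sum_prod_le d (fun _ => 2) (fun _ => zero_le_two) fun _ => le_rfl
    _ ≤ _ := by
        gcongr
        rw [← Finset.mul_sum]
        exact mul_le_mul_of_nonneg_left (sum_iv_primesLE_le d) (by norm_num)

/-- The number of large members at which the residue symbol of the product of `c` is `-1`. -/
noncomputable def negCount (T : ℕ) (c S : Finset F[X]) : ℕ :=
  ((largePart T S).filter fun P => symb (∏ p ∈ c, p) P = -1).card

open Classical in
theorem sum_symb_eq_one_le (h4 : Fintype.card F % 4 = 1) {c : Finset F[X]}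
    (hc : ∀ p ∈ c, p.Monic ∧ Irreducible p) (hne : c.Nonempty) {w : ℕ} (hw : wt c ≤ w) (d : ℕ) :
    ∑ S ∈ ((primesLE F d).filter fun P => symb (∏ p ∈ c, p) P = 1).powerset.filter
      (fun S => wt S ≤ d), ∏ p ∈ S, iv p ≤
    Real.sqrt ((d + 1) * w * Real.exp (1 / 2 * (1 + Real.log d))) := by
  set 𝒮 := ((primesLE F d).filter fun P => symb (∏ p ∈ c, p) P = 1).powerset.filter
      (fun S => wt S ≤ d) with h𝒮
  refine Real.le_sqrt_of_sq_le ?_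
  have hpos : ∀ S : Finset F[X], 0 ≤ ∏ p ∈ S, iv p := fun S =>
    Finset.prod_nonneg fun p _ => (iv_pos p).le
  have hcs := Finset.sum_sq_le_sum_mul_sum_of_sq_le_mul 𝒮
    (r := fun S => ∏ p ∈ S, iv p) (f := fun S => (2 : ℝ) ^ S.card * ∏ p ∈ S, iv p)
    (g := fun S => ((2 : ℝ) ^ S.card)⁻¹ * ∏ p ∈ S, iv p)
    (fun S _ => mul_nonneg (by positivity) (hpos S))
    (fun S _ => mul_nonneg (by positivity) (hpos S)) (fun S _ => by
      have : (2 : ℝ) ^ S.card ≠ 0 := by positivity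
      refine le_of_eq ?_
      field_simp)
  refine hcs.trans ?_
  have hdeg : (∏ p ∈ c, p).natDegree = wt c := natDegree_prod_eq_wt hc
  have h0 : 0 < wt c := by
    obtain ⟨p, hp⟩ := hne
    exact (hc p hp).2.natDegree_pos.trans_le (natDegree_le_wt hp)
  have h1 := sum_two_pow_mul_iv_le h4 (prod_monic hc) (squarefree_prod hc)
    (hdeg ▸ h0) d 𝒮 (fun S hS => by
      obtain ⟨hS, hw⟩ := Finset.mem_filter.1 hS
      refine ⟨fun p hp => ?_, hw⟩
      obtain ⟨h, h'⟩ := Finset.mem_filter.1 (Finset.mem_powerset.1 hS hp)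
      rw [mem_primesLE] at h
      exact ⟨h.1, h.2.1, h'⟩)
  have h2 : ∑ S ∈ 𝒮, ((2 : ℝ) ^ S.card)⁻¹ * ∏ p ∈ S, iv p ≤
      Real.exp (1 / 2 * (1 + Real.log d)) := by
    calc _ ≤ ∑ S ∈ (primesLE F d).powerset, ∏ p ∈ S, (1 / 2 * iv p) := by
          refine le_trans (le_of_eq ?_) (Finset.sum_le_sum_of_subset_of_nonneg (s := 𝒮) ?_ ?_)
          · refine Finset.sum_congr rfl fun S _ => ?_
            rw [Finset.prod_mul_distrib, Finset.prod_const, one_div, inv_pow]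
          · intro S hS
            rw [Finset.mem_powerset]
            exact (Finset.mem_powerset.1 (Finset.mem_filter.1 hS).1).trans
              (Finset.filter_subset _ _)
          · exact fun S _ _ => Finset.prod_nonneg fun p _ => by
              have := iv_pos p
              positivity
      _ ≤ Real.exp (∑ p ∈ primesLE F d, 1 / 2 * iv p) :=
          sum_powerset_prod_le_exp _ _ fun p _ => by
            have := iv_pos p
            positivity
      _ ≤ _ := by
          rw [← Finset.mul_sum]
          gcongr
          exact sum_iv_primesLE_le d
  rw [hdeg] at h1
  have hw' : (wt c : ℝ) ≤ w := by exact_mod_cast hw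
  calc _ ≤ ((d + 1) * w : ℝ) * Real.exp (1 / 2 * (1 + Real.log d)) := by
        refine mul_le_mul (h1.trans ?_) h2 (Finset.sum_nonneg fun S _ =>
          mul_nonneg (by positivity) (hpos S)) (by positivity)
        gcongr

end FourRank

namespace FourRank

variable {F : Type} [Field F] [Fintype F]

theorem isCoprime_prod_of_notMem {c : Finset F[X]} (hc : ∀ p ∈ c, p.Monic ∧ Irreducible p)
    {P : F[X]} (hP : P.Monic ∧ Irreducible P) (hPc : P ∉ c) : IsCoprime (∏ p ∈ c, p) P :=
  IsCoprime.prod_left fun p hp => isCoprime_of_monic_irreducible (hc p hp).1 hP.1 (hc p hp).2 hP.2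
    fun h => hPc (h ▸ hp)

open Classical in
theorem sum_negCount_le_one_le (h4 : Fintype.card F % 4 = 1) {c : Finset F[X]} {T d w : ℕ}
    (hc : c ⊆ primesLE F T) (hne : c.Nonempty) (hw : wt c ≤ w) :
    ∑ S ∈ ((primesLE F d).powerset.filter fun S => wt S ≤ d).filter
      (fun S => c ⊆ S ∧ negCount T c S ≤ 1), ∏ p ∈ S, iv p ≤
    (∏ p ∈ c, iv p) * (Real.exp (1 + Real.log T) * ((2 + Real.log d) *
      Real.sqrt ((d + 1) * w * Real.exp (1 / 2 * (1 + Real.log d))))) := by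
  set 𝒮 := ((primesLE F d).powerset.filter fun S => wt S ≤ d).filter
      (fun S => c ⊆ S ∧ negCount T c S ≤ 1) with h𝒮
  have hcp : ∀ p ∈ c, p.Monic ∧ Irreducible p := fun p hp => by
    have := (mem_primesLE F).1 (hc hp)
    exact ⟨this.1, this.2.1⟩
  have hpos : ∀ S : Finset F[X], 0 ≤ ∏ p ∈ S, iv p := fun S =>
    Finset.prod_nonneg fun p _ => (iv_pos p).le
  set χ : F[X] → ℤ := fun P => symb (∏ p ∈ c, p) P
  set 𝒜 := (primesLE F T).powerset
  set ℰ := (primesLE F d).powerset.filter fun S => S.card ≤ 1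
  set ℬ := ((primesLE F d).filter fun P => χ P = 1).powerset.filter (fun S => wt S ≤ d)
  let f : Finset F[X] → Finset F[X] × Finset F[X] × Finset F[X] := fun S =>
    (tinyPart T S \ c, (largePart T S).filter (fun P => χ P = -1),
      (largePart T S).filter (fun P => χ P = 1))
  have hbase : ∀ S ∈ 𝒮, S ⊆ primesLE F d ∧ wt S ≤ d ∧ c ⊆ S ∧ negCount T c S ≤ 1 := by
    intro S hS
    simp only [h𝒮, Finset.mem_filter, Finset.mem_powerset] at hS
    exact ⟨hS.1.1, hS.1.2, hS.2⟩
  have hctiny : ∀ S ∈ 𝒮, c ⊆ tinyPart T S := fun S hS p hp =>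
    Finset.mem_filter.2 ⟨(hbase S hS).2.2.1 hp, ((mem_primesLE F).1 (hc hp)).2.2⟩
  have hsplit : ∀ S ∈ 𝒮, ∀ P ∈ largePart T S, χ P = 1 ∨ χ P = -1 := by
    intro S hS P hP
    obtain ⟨hP, hdeg⟩ := Finset.mem_filter.1 hP
    have h := (mem_primesLE F).1 ((hbase S hS).1 hP)
    refine symb_eq_one_or _ _ (prod_monic hcp).ne_zero
      (isCoprime_prod_of_notMem hcp ⟨h.1, h.2.1⟩ fun h' => hdeg ((mem_primesLE F).1 (hc h')).2.2)
  have hlarge : ∀ S ∈ 𝒮, (largePart T S).filter (fun P => ¬ χ P = -1) =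
      (largePart T S).filter (fun P => χ P = 1) := by
    intro S hS
    refine Finset.filter_congr fun P hP => ?_
    rcases hsplit S hS P hP with h | h <;> rw [h] <;> decide
  have hprod : ∀ S ∈ 𝒮, ∏ p ∈ S, iv p = (∏ p ∈ c, iv p) *
      ((∏ p ∈ (f S).1, iv p) * ((∏ p ∈ (f S).2.1, iv p) * ∏ p ∈ (f S).2.2, iv p)) := by
    intro S hS
    rw [← Finset.prod_filter_mul_prod_filter_not S (fun p => p.natDegree ≤ T)]
    change (∏ p ∈ tinyPart T S, iv p) * ∏ p ∈ largePart T S, iv p = _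
    rw [← Finset.prod_sdiff (hctiny S hS),
      ← Finset.prod_filter_mul_prod_filter_not (largePart T S) (fun P => χ P = -1), hlarge S hS]
    ring
  have hinj : Set.InjOn f 𝒮 := by
    have hrec : ∀ S ∈ 𝒮, S = (f S).1 ∪ c ∪ ((f S).2.1 ∪ (f S).2.2) := by
      intro S hS
      have e1 : (f S).2.1 ∪ (f S).2.2 = largePart T S := by
        rw [← Finset.filter_union_filter_not_eq (fun P => χ P = -1) (largePart T S), hlarge S hS]
      rw [e1, Finset.sdiff_union_of_subset (hctiny S hS)]
      exact (Finset.filter_union_filter_not_eq _ _).symm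
    intro S hS S' hS' h
    rw [hrec S hS, hrec S' hS', h]
  have hmaps : ∀ S ∈ 𝒮, f S ∈ 𝒜 ×ˢ ℰ ×ˢ ℬ := by
    intro S hS
    obtain ⟨h1, h2, -, h3⟩ := hbase S hS
    simp only [Finset.mem_product, 𝒜, ℰ, ℬ, Finset.mem_powerset, Finset.mem_filter, f]
    refine ⟨fun p hp => ?_, ⟨fun p hp => ?_, h3⟩, fun p hp => ?_, ?_⟩
    · obtain ⟨hp, hdeg⟩ := Finset.mem_filter.1 (Finset.mem_sdiff.1 hp).1
      have := (mem_primesLE F).1 (h1 hp)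
      exact (mem_primesLE F).2 ⟨this.1, this.2.1, hdeg⟩
    · exact h1 (Finset.mem_filter.1 (Finset.mem_filter.1 hp).1).1
    · have := Finset.mem_filter.1 hp
      exact Finset.mem_filter.2 ⟨h1 (Finset.mem_filter.1 this.1).1, this.2⟩
    · exact (Finset.sum_le_sum_of_subset ((Finset.filter_subset _ _).trans
        (Finset.filter_subset _ _))).trans h2
  rw [Finset.sum_congr rfl hprod, ← Finset.mul_sum]
  refine mul_le_mul_of_nonneg_left ?_ (hpos c)
  calc ∑ S ∈ 𝒮, ((∏ p ∈ (f S).1, iv p) * ((∏ p ∈ (f S).2.1, iv p) * ∏ p ∈ (f S).2.2, iv p))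
      = ∑ x ∈ 𝒮.image f, ((∏ p ∈ x.1, iv p) * ((∏ p ∈ x.2.1, iv p) * ∏ p ∈ x.2.2, iv p)) := by
        rw [Finset.sum_image hinj]
    _ ≤ ∑ x ∈ 𝒜 ×ˢ ℰ ×ˢ ℬ, ((∏ p ∈ x.1, iv p) * ((∏ p ∈ x.2.1, iv p) * ∏ p ∈ x.2.2, iv p)) :=
        Finset.sum_le_sum_of_subset_of_nonneg (Finset.image_subset_iff.2 hmaps) fun x _ _ =>
          mul_nonneg (hpos _) (mul_nonneg (hpos _) (hpos _))
    _ = (∑ A ∈ 𝒜, ∏ p ∈ A, iv p) * ((∑ E ∈ ℰ, ∏ p ∈ E, iv p) * ∑ B ∈ ℬ, ∏ p ∈ B, iv p) := by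
        rw [Finset.sum_product, Finset.sum_mul]
        refine Finset.sum_congr rfl fun A _ => ?_
        rw [Finset.sum_product, Finset.sum_mul, Finset.mul_sum]
        refine Finset.sum_congr rfl fun E _ => ?_
        rw [Finset.mul_sum, Finset.mul_sum]
    _ ≤ _ := by
        have hA : ∑ A ∈ 𝒜, ∏ p ∈ A, iv p ≤ Real.exp (1 + Real.log T) :=
          (sum_powerset_prod_le_exp _ _ fun p _ => (iv_pos p).le).trans
            (Real.exp_le_exp.2 (sum_iv_primesLE_le T))
        have hE : ∑ E ∈ ℰ, ∏ p ∈ E, iv p ≤ 2 + Real.log d := by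
          have hsub : ℰ ⊆ insert ∅ ((primesLE F d).image fun p => {p}) := by
            intro E hE
            obtain ⟨hE, h1⟩ := Finset.mem_filter.1 hE
            rw [Finset.mem_insert, Finset.mem_image]
            rcases Finset.eq_empty_or_nonempty E with h | h
            · exact Or.inl h
            · obtain ⟨p, rfl⟩ := Finset.card_eq_one.1 (le_antisymm h1 h.card_pos)
              exact Or.inr ⟨p, Finset.mem_powerset.1 hE (Finset.mem_singleton_self p), rfl⟩
          refine (Finset.sum_le_sum_of_subset_of_nonneg hsub fun x _ _ => hpos x).trans ?_
          rw [Finset.sum_insert (by simp), Finset.sum_image fun x _ y _ h => by simpa using h]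
          simp only [Finset.prod_empty, Finset.prod_singleton]
          linarith [sum_iv_primesLE_le (F := F) d]
        have hB := sum_symb_eq_one_le h4 hcp hne hw d
        have h0E : 0 ≤ ∑ E ∈ ℰ, ∏ p ∈ E, iv p := Finset.sum_nonneg fun x _ => hpos x
        have h0B : 0 ≤ ∑ B ∈ ℬ, ∏ p ∈ B, iv p := Finset.sum_nonneg fun x _ => hpos x
        exact mul_le_mul hA (mul_le_mul hE hB h0B (h0E.trans hE)) (mul_nonneg h0E h0B)
          (Real.exp_pos _).le

open Classical in
theorem wt_le_mul_card {T : ℕ} {S : Finset F[X]} (hS : ∀ p ∈ S, p.natDegree ≤ T) :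
    wt S ≤ T * S.card := by
  have := Finset.sum_le_card_nsmul S natDegree T hS
  rw [smul_eq_mul, mul_comm] at this
  exact this

open Classical in
/-- Few sets of primes have a subset of tiny members whose product has at most one large
non-residue. -/
theorem mul_card_negCount_le_one_le (h4 : Fintype.card F % 4 = 1) {T K d : ℕ}
    (hTK : 2 * (T * K) ≤ d) :
    (d : ℝ) * ((primeSets F d).filter fun S => S.card ≤ K ∧
      ∃ c ⊆ tinyPart T S, c.Nonempty ∧ negCount T c S ≤ 1).card ≤
    2 * (Fintype.card F : ℝ) ^ d * (Real.exp (1 + Real.log T) ^ 2 * ((2 + Real.log d) *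
      Real.sqrt ((d + 1) * (T * K : ℕ) * Real.exp (1 / 2 * (1 + Real.log d))))) := by
  set 𝓑 := (primeSets F d).filter fun S => S.card ≤ K ∧
      ∃ c ⊆ tinyPart T S, c.Nonempty ∧ negCount T c S ≤ 1
  set 𝒞 := (primesLE F T).powerset.filter fun c => c.Nonempty ∧ c.card ≤ K
  set Z := Real.exp (1 + Real.log T) * ((2 + Real.log d) *
      Real.sqrt ((d + 1) * (T * K : ℕ) * Real.exp (1 / 2 * (1 + Real.log d)))) with hZ
  have hlog : 0 ≤ Real.log d := Real.log_natCast_nonneg d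
  have hZ0 : 0 ≤ Z := by positivity
  set Ψ : Finset F[X] → ℝ := fun S => ∑ c ∈ 𝒞, if c ⊆ S ∧ negCount T c S ≤ 1 then 1 else 0
  have hΨ : ∀ S, 0 ≤ Ψ S := fun S => Finset.sum_nonneg fun c _ => by split_ifs <;> norm_num
  have hlow : ∀ S ∈ 𝓑, (d : ℝ) ≤ 2 * ∑ p ∈ S, (p.natDegree : ℝ) * Ψ (S.erase p) := by
    intro S hS
    obtain ⟨hS, hK, c, hc, hne, hneg⟩ := Finset.mem_filter.1 hS
    obtain ⟨hS, hwt⟩ := mem_primeSets.1 hS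
    have hc𝒞 : c ∈ 𝒞 := by
      refine Finset.mem_filter.2 ⟨Finset.mem_powerset.2 fun p hp => ?_, hne, ?_⟩
      · obtain ⟨h1, h2⟩ := Finset.mem_filter.1 (hc hp)
        exact (mem_primesLE F).2 ⟨(hS p h1).1, (hS p h1).2, h2⟩
      · exact (Finset.card_le_card (hc.trans (Finset.filter_subset _ _))).trans hK
    have hone : ∀ p ∈ largePart T S, 1 ≤ Ψ (S.erase p) := by
      intro p hp
      have h1 : c ⊆ S.erase p ∧ negCount T c (S.erase p) ≤ 1 := by
        refine ⟨fun r hr => Finset.mem_erase.2 ⟨?_, (Finset.mem_filter.1 (hc hr)).1⟩, ?_⟩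
        · rintro rfl
          exact (Finset.mem_filter.1 hp).2 (Finset.mem_filter.1 (hc hr)).2
        · refine le_trans (Finset.card_le_card ?_) hneg
          exact Finset.filter_subset_filter _ (Finset.filter_subset_filter _
            (Finset.erase_subset _ _))
      have h2 := Finset.single_le_sum (s := 𝒞)
        (f := fun c => if c ⊆ S.erase p ∧ negCount T c (S.erase p) ≤ 1 then (1 : ℝ) else 0)
        (fun c _ => by split_ifs <;> norm_num) hc𝒞
      rw [if_pos h1] at h2
      exact h2
    have htiny : wt (tinyPart T S) ≤ T * K :=
      (wt_le_mul_card fun p hp => (Finset.mem_filter.1 hp).2).trans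
        (Nat.mul_le_mul_left _ ((Finset.card_le_card (Finset.filter_subset _ _)).trans hK))
    have hsum : wt (tinyPart T S) + wt (largePart T S) = d := by
      rw [← hwt]
      exact Finset.sum_filter_add_sum_filter_not S _ _
    have hlarge : d ≤ 2 * wt (largePart T S) := by omega
    calc (d : ℝ) ≤ 2 * (wt (largePart T S) : ℝ) := by exact_mod_cast hlarge
      _ = 2 * ∑ p ∈ largePart T S, (p.natDegree : ℝ) := by unfold wt; push_cast; rfl
      _ ≤ 2 * ∑ p ∈ largePart T S, (p.natDegree : ℝ) * Ψ (S.erase p) := by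
          refine mul_le_mul_of_nonneg_left (Finset.sum_le_sum fun p hp => ?_) zero_le_two
          exact le_mul_of_one_le_right (Nat.cast_nonneg _) (hone p hp)
      _ ≤ _ := by
          refine mul_le_mul_of_nonneg_left ?_ zero_le_two
          exact Finset.sum_le_sum_of_subset_of_nonneg (Finset.filter_subset _ _) fun p _ _ =>
            mul_nonneg (Nat.cast_nonneg _) (hΨ _)
  have hup : ∑ S ∈ (primesLE F d).powerset.filter (fun S => wt S ≤ d), Ψ S * ∏ p ∈ S, iv p ≤
      Real.exp (1 + Real.log T) * Z := by
    simp only [Ψ, Finset.sum_mul]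
    rw [Finset.sum_comm]
    calc _ ≤ ∑ c ∈ 𝒞, (∏ p ∈ c, iv p) * Z := by
          refine Finset.sum_le_sum fun c hc => ?_
          obtain ⟨hc, hne, hK⟩ := Finset.mem_filter.1 hc
          rw [Finset.mem_powerset] at hc
          have hw : wt c ≤ T * K :=
            (wt_le_mul_card fun p hp => ((mem_primesLE F).1 (hc hp)).2.2).trans
              (Nat.mul_le_mul_left _ hK)
          refine le_trans (le_of_eq ?_) (sum_negCount_le_one_le h4 hc hne hw (d := d))
          rw [Finset.sum_filter (fun S => c ⊆ S ∧ negCount T c S ≤ 1)]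
          refine Finset.sum_congr rfl fun S _ => ?_
          split_ifs <;> simp
      _ = (∑ c ∈ 𝒞, ∏ p ∈ c, iv p) * Z := by rw [Finset.sum_mul]
      _ ≤ _ := by
          refine mul_le_mul_of_nonneg_right ?_ hZ0
          refine (Finset.sum_le_sum_of_subset_of_nonneg (Finset.filter_subset _ _) fun S _ _ =>
            Finset.prod_nonneg fun p _ => (iv_pos p).le).trans ?_
          exact (sum_powerset_prod_le_exp _ _ fun p _ => (iv_pos p).le).trans
            (Real.exp_le_exp.2 (sum_iv_primesLE_le T))
  calc (d : ℝ) * 𝓑.card = ∑ S ∈ 𝓑, (d : ℝ) := by rw [Finset.sum_const, nsmul_eq_mul, mul_comm]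
    _ ≤ ∑ S ∈ 𝓑, 2 * ∑ p ∈ S, (p.natDegree : ℝ) * Ψ (S.erase p) := Finset.sum_le_sum hlow
    _ ≤ ∑ S ∈ primeSets F d, 2 * ∑ p ∈ S, (p.natDegree : ℝ) * Ψ (S.erase p) :=
        Finset.sum_le_sum_of_subset_of_nonneg (Finset.filter_subset _ _) fun S _ _ =>
          mul_nonneg zero_le_two (Finset.sum_nonneg fun p _ =>
            mul_nonneg (Nat.cast_nonneg _) (hΨ _))
    _ = 2 * ∑ S ∈ primeSets F d, ∑ p ∈ S, (p.natDegree : ℝ) * Ψ (S.erase p) := by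
        rw [Finset.mul_sum]
    _ ≤ 2 * ((Fintype.card F : ℝ) ^ d * (Real.exp (1 + Real.log T) * Z)) :=
        mul_le_mul_of_nonneg_left ((sum_sum_natDegree_mul_le d Ψ hΨ).trans
          (mul_le_mul_of_nonneg_left hup (by positivity))) zero_le_two
    _ = _ := by rw [hZ]; ring

end FourRank

namespace FourRank

/-- Every nonzero combination of the rows has at least two nonzero entries. -/
def HasSpread {α κ : Type} [Fintype α] (b : Matrix α κ (ZMod 2)) : Prop :=
  ∀ c : α → ZMod 2, c ≠ 0 → ∃ i j, i ≠ j ∧ (bᵀ *ᵥ c) i ≠ 0 ∧ (bᵀ *ᵥ c) j ≠ 0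

variable {F : Type} [Field F] [Fintype F]

theorem symbMatrix_sumElim (h4 : Fintype.card F % 4 = 1) {V W : Type*} (φ : V → F[X])
    (ψ : W → F[X]) : symbMatrix (Sum.elim φ ψ) (Sum.elim φ ψ) =
      fromBlocks (symbMatrix φ φ) (symbMatrix φ ψ) (symbMatrix φ ψ)ᵀ (symbMatrix ψ ψ) := by
  ext (i | i) (j | j)
  · rfl
  · rfl
  · simp only [symbMatrix, fromBlocks_apply₂₁, transpose_apply, Sum.elim_inl, Sum.elim_inr]
    rw [symb_comm h4]
  · rfl

open Classical in
theorem card_isResidual_union_image (h4 : Fintype.card F % 4 = 1) {A : Finset F[X]}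
    (hA : ∀ p ∈ A, p.Monic ∧ Irreducible p) {m : ℕ} {P : Fin m → F[X]}
    (hP : ∀ k, (P k).Monic ∧ Irreducible (P k)) (hinj : Function.Injective P)
    (hPA : ∀ k, P k ∉ A) :
    ((A ∪ Finset.univ.image P).powerset.filter
      fun U => IsResidual (A ∪ Finset.univ.image P) U).card =
    lapKer (fromBlocks (symbMatrix (fun a : A => (a : F[X])) fun a : A => (a : F[X]))
      (symbMatrix (fun a : A => (a : F[X])) P) (symbMatrix (fun a : A => (a : F[X])) P)ᵀ
      (symbMatrix P P)) := by
  rw [← symbMatrix_sumElim h4]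
  refine card_isResidual_eq_lapKer ?_ _ ?_ ?_
  · intro p hp
    rcases Finset.mem_union.1 hp with h | h
    · exact hA p h
    · obtain ⟨k, -, rfl⟩ := Finset.mem_image.1 h
      exact hP k
  · exact Subtype.val_injective.sumElim hinj fun a k h => hPA k (h ▸ a.2)
  · ext p
    simp

/-- Tuples of distinct primes of large degree, with prescribed total degree, whose residue symbols
with the members of `A` are spread out. -/
noncomputable def spreadTuples (A : Finset F[X]) (T m D : ℕ) : Finset (Fin m → F[X]) :=
  open Classical in
  (Fintype.piFinset fun _ : Fin m => (primesLE F D).filter fun p => T < p.natDegree).filter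
    fun P => Function.Injective P ∧ ∑ k, (P k).natDegree = D ∧
      HasSpread (symbMatrix (fun a : A => (a : F[X])) P)

theorem mem_spreadTuples {A : Finset F[X]} {T m D : ℕ} {P : Fin m → F[X]} :
    P ∈ spreadTuples A T m D ↔ (∀ k, (P k).Monic ∧ Irreducible (P k) ∧ T < (P k).natDegree) ∧
      Function.Injective P ∧ ∑ k, (P k).natDegree = D ∧
      HasSpread (symbMatrix (fun a : A => (a : F[X])) P) := by
  classical
  simp only [spreadTuples, Finset.mem_filter, Fintype.mem_piFinset, mem_primesLE]
  constructor
  · rintro ⟨h1, h2⟩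
    exact ⟨fun k => ⟨(h1 k).1.1, (h1 k).1.2.1, (h1 k).2⟩, h2⟩
  · rintro ⟨h1, h2, h3, h4⟩
    refine ⟨fun k => ⟨⟨(h1 k).1, (h1 k).2.1, ?_⟩, (h1 k).2.2⟩, h2, h3, h4⟩
    rw [← h3]
    exact Finset.single_le_sum (f := fun k => (P k).natDegree) (fun _ _ => Nat.zero_le _)
      (Finset.mem_univ k)

open Classical in
/-- The distribution of the kernel for tuples of given degrees and given symbols with `A`. -/
theorem abs_card_injTuples_sub_le (h4 : Fintype.card F % 4 = 1) {r M : ℕ} {μ ε : ℝ}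
    (hμ : ∀ N, M ≤ N → |(symCount (Fin N) r : ℝ) / symTotal (Fin N) - μ| ≤ ε)
    {A : Finset F[X]} {m t D : ℕ} (hm : A.card + M + 1 ≤ m)
    {n : Fin m → ℕ} (hn : ∀ k, 4 * t < n k) (hnD : ∑ k, n k = D)
    {β : Matrix A (Fin m) (ZMod 2)} (hβ : HasSpread β) {X : Fin m → Finset F[X]}
    (hX : ∀ k, X k ⊆ primes F (n k)) :
    |(((injTuples X).filter fun P => lapKer (fromBlocks
      (symbMatrix (fun a : A => (a : F[X])) fun a : A => (a : F[X])) β βᵀ (symbMatrix P P)) =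
        2 ^ (r + 1)).card : ℝ) - μ * (injTuples X).card| ≤
      ε * (injTuples X).card +
        2 ^ (m * m) * (4 * (Fintype.card F : ℝ) ^ D / (Fintype.card F : ℝ) ^ t) := by
  set α := symbMatrix (fun a : A => (a : F[X])) fun a : A => (a : F[X])
  have hne : Nonempty (Fin m) := ⟨⟨0, by omega⟩⟩
  have hsym : α.IsSymm := by
    ext i j
    simp only [α, transpose_apply, symbMatrix]
    rw [symb_comm h4]
  obtain ⟨N, hN, h⟩ := card_alts_lapKer α hsym β hβ
  have hNM : M ≤ N := by
    simp only [Fintype.card_fin, Fintype.card_coe] at hN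
    omega
  have hμN := hμ N hNM
  have hN0 : (0 : ℝ) < symTotal (Fin N) := by exact_mod_cast symTotal_fin_pos N
  obtain ⟨Γ, hΓd⟩ : ∃ Γ : Matrix (Fin m) (Fin m) (ZMod 2) → Prop,
      ∀ γ, lapKer (fromBlocks α β βᵀ γ) = 2 ^ (r + 1) ↔ Γ γ := ⟨_, fun _ => Iff.rfl⟩
  have hr := h r
  rw [Finset.filter_congr fun γ _ => hΓd γ] at hr
  rw [Finset.filter_congr fun P _ => hΓd (symbMatrix P P)]
  have hΓ : (((alts (Fin m)).filter Γ).card : ℝ) =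
      (symCount (Fin N) r : ℝ) / symTotal (Fin N) * (alts (Fin m)).card := by
    rw [div_mul_eq_mul_div, eq_div_iff hN0.ne']
    exact_mod_cast hr
  have halt : (0 : ℝ) < (alts (Fin m)).card := by
    have : (0 : Matrix (Fin m) (Fin m) (ZMod 2)) ∈ alts (Fin m) :=
      mem_alts.2 ⟨Matrix.isSymm_zero, fun _ => rfl⟩
    exact_mod_cast Finset.card_pos.2 ⟨_, this⟩
  have hΓ2 : (((alts (Fin m)).filter Γ).card : ℝ) ≤ 2 ^ (m * m) := by
    have := Finset.card_le_univ ((alts (Fin m)).filter Γ)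
    have e : Fintype.card (Matrix (Fin m) (Fin m) (ZMod 2)) = 2 ^ (m * m) := by
      change Fintype.card (Fin m → Fin m → ZMod 2) = _
      simp [pow_mul]
    rw [e] at this
    exact_mod_cast this
  have key := abs_card_symbMatrix_mem_sub_le h4 hn hX Γ
  rw [Finset.prod_pow_eq_pow_sum, hnD] at key
  set I := ((injTuples X).card : ℝ)
  set C := (((injTuples X).filter fun P => Γ (symbMatrix P P)).card : ℝ)
  set p := (symCount (Fin N) r : ℝ) / symTotal (Fin N)
  set B := 4 * (Fintype.card F : ℝ) ^ D / (Fintype.card F : ℝ) ^ t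
  have hB : 0 ≤ B := by positivity
  have hI : 0 ≤ I := Nat.cast_nonneg _
  have h1 : |C - p * I| ≤ ((alts (Fin m)).filter Γ).card * B := by
    refine le_of_mul_le_mul_left ?_ halt
    rw [← abs_of_pos halt, ← abs_mul, abs_of_pos halt]
    refine le_trans (le_of_eq ?_) (key.trans (le_of_eq ?_))
    · congr 1
      rw [hΓ]
      ring
    · ring
  calc |C - μ * I| = |(C - p * I) + (p - μ) * I| := by congr 1; ring
    _ ≤ |C - p * I| + |(p - μ) * I| := abs_add_le _ _
    _ ≤ 2 ^ (m * m) * B + ε * I := by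
        rw [abs_mul, abs_of_nonneg hI]
        gcongr
        exact h1.trans (mul_le_mul_of_nonneg_right hΓ2 hB)
    _ = _ := by ring

open Classical in
theorem abs_card_spreadTuples_sub_le (h4 : Fintype.card F % 4 = 1) {r M : ℕ} {μ ε : ℝ}
    (hμ : ∀ N, M ≤ N → |(symCount (Fin N) r : ℝ) / symTotal (Fin N) - μ| ≤ ε)
    {m t D : ℕ} {A : Finset F[X]}
    (hA : ∀ p ∈ A, p.Monic ∧ Irreducible p ∧ p.natDegree ≤ 4 * t) (hm : A.card + M + 1 ≤ m) :
    |(((spreadTuples A (4 * t) m D).filter fun P => ((A ∪ Finset.univ.image P).powerset.filter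
      fun U => IsResidual (A ∪ Finset.univ.image P) U).card = 2 ^ (r + 1)).card : ℝ) -
      μ * (spreadTuples A (4 * t) m D).card| ≤ ε * (spreadTuples A (4 * t) m D).card +
      ((D : ℝ) + 1) ^ m * 2 ^ (A.card * m) * (2 ^ (m * m) *
        (4 * (Fintype.card F : ℝ) ^ D / (Fintype.card F : ℝ) ^ t)) := by
  set val : A → F[X] := fun a => (a : F[X])
  set R : (Fin m → F[X]) → Prop := fun P => ((A ∪ Finset.univ.image P).powerset.filter
      fun U => IsResidual (A ∪ Finset.univ.image P) U).card = 2 ^ (r + 1)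
  set B := 2 ^ (m * m) * (4 * (Fintype.card F : ℝ) ^ D / (Fintype.card F : ℝ) ^ t)
  have hB : 0 ≤ B := by positivity
  set 𝒬 := spreadTuples A (4 * t) m D
  let f : (Fin m → F[X]) → (Fin m → ℕ) × Matrix A (Fin m) (ZMod 2) := fun P =>
    (fun k => (P k).natDegree, symbMatrix val P)
  set 𝒯 : Finset ((Fin m → ℕ) × Matrix A (Fin m) (ZMod 2)) :=
    (Fintype.piFinset fun _ => Finset.range (D + 1)) ×ˢ Finset.univ
  have hmaps : ∀ P ∈ 𝒬, f P ∈ 𝒯 := by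
    intro P hP
    obtain ⟨-, -, h, -⟩ := mem_spreadTuples.1 hP
    refine Finset.mem_product.2 ⟨Fintype.mem_piFinset.2 fun k => ?_, Finset.mem_univ _⟩
    rw [Finset.mem_range, Nat.lt_succ_iff, ← h]
    exact Finset.single_le_sum (f := fun k => (P k).natDegree) (fun _ _ => Nat.zero_le _)
      (Finset.mem_univ k)
  have h𝒯 : (𝒯.card : ℝ) = ((D : ℝ) + 1) ^ m * 2 ^ (A.card * m) := by
    rw [Finset.card_product, Fintype.card_piFinset, Finset.card_univ]
    have : Fintype.card (Matrix A (Fin m) (ZMod 2)) = 2 ^ (A.card * m) := by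
      change Fintype.card (A → Fin m → ZMod 2) = _
      simp [pow_mul, pow_right_comm]
    rw [this]
    simp
  have hfib : ∀ τ ∈ 𝒯, |((((𝒬.filter R).filter fun P => f P = τ).card : ℝ)) -
      μ * (𝒬.filter fun P => f P = τ).card| ≤ ε * (𝒬.filter fun P => f P = τ).card + B := by
    rintro ⟨n, β⟩ -
    rcases (𝒬.filter fun P => f P = (n, β)).eq_empty_or_nonempty with h0 | ⟨P₀, hP₀⟩
    · have : (𝒬.filter R).filter (fun P => f P = (n, β)) = ∅ := by
        rw [Finset.filter_filter, Finset.filter_eq_empty_iff]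
        intro P hP h
        exact (Finset.filter_eq_empty_iff.1 h0) hP h.2
      rw [this, h0]
      simpa using hB
    · obtain ⟨hP₀, hf⟩ := Finset.mem_filter.1 hP₀
      obtain ⟨h1, -, h3, h4'⟩ := mem_spreadTuples.1 hP₀
      have hn : ∀ k, (P₀ k).natDegree = n k := fun k => congrFun (congrArg Prod.fst hf) k
      have hβ : symbMatrix val P₀ = β := congrArg Prod.snd hf
      set X : Fin m → Finset F[X] := fun k =>
        (primes F (n k)).filter fun p => ∀ a : A, signBit (symb (a : F[X]) p) = β a k
      have hX : ∀ k, X k ⊆ primes F (n k) := fun k => Finset.filter_subset _ _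
      have hmem : ∀ P, P ∈ 𝒬.filter (fun P => f P = (n, β)) ↔ P ∈ injTuples X := by
        intro P
        simp only [injTuples, Finset.mem_filter, Fintype.mem_piFinset, X, mem_primes, 𝒬,
          mem_spreadTuples]
        constructor
        · rintro ⟨⟨g1, g2, -, -⟩, g⟩
          refine ⟨fun k => ⟨⟨(g1 k).1, (g1 k).2.1, congrFun (congrArg Prod.fst g) k⟩,
            fun a => congrFun (congrFun (congrArg Prod.snd g) a) k⟩, g2⟩
        · rintro ⟨g1, g2⟩
          have e : symbMatrix val P = β := by
            ext a k
            exact (g1 k).2 a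
          refine ⟨⟨fun k => ⟨(g1 k).1.1, (g1 k).1.2.1, ?_⟩, g2, ?_, ?_⟩, ?_⟩
          · rw [(g1 k).1.2.2, ← hn k]
            exact (h1 k).2.2
          · rw [← h3]
            exact Finset.sum_congr rfl fun k _ => by rw [(g1 k).1.2.2, hn k]
          · change HasSpread (symbMatrix val P)
            rw [e, ← hβ]
            exact h4'
          · exact Prod.ext (funext fun k => (g1 k).1.2.2) e
      have hset : 𝒬.filter (fun P => f P = (n, β)) = injTuples X := Finset.ext hmem
      have hR : ((𝒬.filter R).filter fun P => f P = (n, β)) = (injTuples X).filter fun P =>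
          lapKer (fromBlocks (symbMatrix val val) β βᵀ (symbMatrix P P)) = 2 ^ (r + 1) := by
        rw [Finset.filter_comm, hset]
        refine Finset.filter_congr fun P hP => ?_
        obtain ⟨hP, hfP⟩ := Finset.mem_filter.1 ((hmem P).2 hP)
        obtain ⟨g1, g2, -, -⟩ := mem_spreadTuples.1 hP
        have e : symbMatrix val P = β := congrArg Prod.snd hfP
        have := card_isResidual_union_image h4 (fun p hp => ⟨(hA p hp).1, (hA p hp).2.1⟩)
          (fun k => ⟨(g1 k).1, (g1 k).2.1⟩) g2
          fun k hk => absurd (hA _ hk).2.2 (not_le.2 (g1 k).2.2)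
        rw [← e]
        exact Eq.congr this rfl
      rw [hR, hset]
      refine abs_card_injTuples_sub_le h4 hμ hm (fun k => ?_) ?_ ?_ hX
      · rw [← hn k]; exact (h1 k).2.2
      · rw [← h3]; exact Finset.sum_congr rfl fun k _ => (hn k).symm
      · rw [← hβ]; exact h4'
  have e1 : ((𝒬.filter R).card : ℝ) =
      ∑ τ ∈ 𝒯, (((𝒬.filter R).filter fun P => f P = τ).card : ℝ) := by
    rw [Finset.card_eq_sum_card_fiberwise (f := f) (t := 𝒯)
      fun P hP => hmaps P (Finset.mem_filter.1 hP).1]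
    push_cast
    rfl
  have e2 : (𝒬.card : ℝ) = ∑ τ ∈ 𝒯, ((𝒬.filter fun P => f P = τ).card : ℝ) := by
    rw [Finset.card_eq_sum_card_fiberwise (f := f) (t := 𝒯) hmaps]
    push_cast
    rfl
  rw [e1, e2, Finset.mul_sum, Finset.mul_sum, ← Finset.sum_sub_distrib]
  refine (Finset.abs_sum_le_sum_abs _ _).trans ((Finset.sum_le_sum hfib).trans (le_of_eq ?_))
  rw [Finset.sum_add_distrib, Finset.sum_const, nsmul_eq_mul, h𝒯]

end FourRank

namespace FourRank

variable {F : Type} [Field F] [Fintype F]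

open Classical in
theorem tinyPart_union_image {A : Finset F[X]} {T m : ℕ} (hA : ∀ p ∈ A, p.natDegree ≤ T)
    {P : Fin m → F[X]} (hP : ∀ k, T < (P k).natDegree) :
    tinyPart T (A ∪ Finset.univ.image P) = A ∧
      largePart T (A ∪ Finset.univ.image P) = Finset.univ.image P := by
  constructor
  · rw [tinyPart, Finset.filter_union, Finset.filter_true_of_mem hA,
      Finset.filter_false_of_mem, Finset.union_empty]
    intro p hp
    obtain ⟨k, -, rfl⟩ := Finset.mem_image.1 hp
    exact not_le.2 (hP k)
  · rw [largePart, Finset.filter_union, Finset.filter_false_of_mem, Finset.empty_union,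
      Finset.filter_true_of_mem]
    · intro p hp
      obtain ⟨k, -, rfl⟩ := Finset.mem_image.1 hp
      exact not_le.2 (hP k)
    · exact fun p hp => not_not.2 (hA p hp)

open Classical in
theorem symbMatrix_mulVec_ne_zero_iff (h4 : Fintype.card F % 4 = 1) {A : Finset F[X]}
    (hA : ∀ p ∈ A, p.Monic ∧ Irreducible p) {m : ℕ} {P : Fin m → F[X]}
    (hP : ∀ k, (P k).Monic ∧ Irreducible (P k)) (hPA : ∀ k, P k ∉ A) (v : A → ZMod 2)
    (k : Fin m) :
    ((symbMatrix (fun a : A => (a : F[X])) P)ᵀ *ᵥ v) k ≠ 0 ↔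
      symb (∏ p ∈ (Finset.univ.filter fun a => v a = 1).image fun a : A => (a : F[X]), p) (P k) =
        -1 := by
  set c := Finset.univ.filter fun a => v a = 1
  have hc : ∀ p ∈ c.image fun a : A => (a : F[X]), p ∈ A := fun p hp => by
    obtain ⟨a, -, rfl⟩ := Finset.mem_image.1 hp
    exact a.2
  have hcop := isCoprime_prod_of_notMem (fun p hp => hA p (hc p hp)) (hP k)
    fun h => hPA k (hc _ h)
  have h1 : ∀ a : A, symb (a : F[X]) (P k) = 1 ∨ symb (a : F[X]) (P k) = -1 := fun a =>
    symb_eq_one_or _ _ (hA _ a.2).1.ne_zero (isCoprime_of_monic_irreducible (hA _ a.2).1 (hP k).1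
      (hA _ a.2).2 (hP k).2 fun h => hPA k (h ▸ a.2))
  have h2 : symb (∏ p ∈ c.image fun a : A => (a : F[X]), p) (P k) =
      ∏ a ∈ c, symb (a : F[X]) (P k) := by
    rw [symb_comm h4, symb_prod_right _ _ _ fun p hp => (hA p (hc p hp)).1.ne_zero,
      Finset.prod_image fun x _ y _ h => Subtype.ext h]
    exact Finset.prod_congr rfl fun a _ => symb_comm h4 _ _
  have h3 : ((symbMatrix (fun a : A => (a : F[X])) P)ᵀ *ᵥ v) k =
      ∑ a ∈ c, signBit (symb (a : F[X]) (P k)) := by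
    simp only [mulVec, dotProduct, transpose_apply, symbMatrix, c, Finset.sum_filter]
    refine Finset.sum_congr rfl fun a _ => ?_
    have h01 : ∀ z : ZMod 2, z = 0 ∨ z = 1 := by decide
    rcases h01 (v a) with h | h <;> simp [h]
  rw [h3, ← not_iff_not, not_not, ← prod_eq_one_iff_sum_signBit _ _ fun a _ => h1 a, ← h2]
  rcases symb_eq_one_or _ _ (prod_monic fun p hp => hA p (hc p hp)).ne_zero hcop with h | h <;>
    rw [h] <;> decide

open Classical in
theorem hasSpread_iff (h4 : Fintype.card F % 4 = 1) {A : Finset F[X]} {T m : ℕ}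
    (hA : ∀ p ∈ A, p.Monic ∧ Irreducible p ∧ p.natDegree ≤ T) {P : Fin m → F[X]}
    (hP : ∀ k, (P k).Monic ∧ Irreducible (P k) ∧ T < (P k).natDegree)
    (hinj : Function.Injective P) :
    HasSpread (symbMatrix (fun a : A => (a : F[X])) P) ↔
      ∀ c ⊆ A, c.Nonempty → 2 ≤ negCount T c (A ∪ Finset.univ.image P) := by
  have hPA : ∀ k, P k ∉ A := fun k hk => absurd (hA _ hk).2.2 (not_le.2 (hP k).2.2)
  have key := symbMatrix_mulVec_ne_zero_iff h4 (fun p hp => ⟨(hA p hp).1, (hA p hp).2.1⟩)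
    (fun k => ⟨(hP k).1, (hP k).2.1⟩) hPA
  have hneg : ∀ c, negCount T c (A ∪ Finset.univ.image P) =
      (Finset.univ.filter fun k => symb (∏ p ∈ c, p) (P k) = -1).card := fun c => by
    rw [negCount, (tinyPart_union_image (fun p hp => (hA p hp).2.2) fun k => (hP k).2.2).2,
      Finset.filter_image, Finset.card_image_of_injective _ hinj]
  have htwo : ∀ v : A → ZMod 2, (∃ i j, i ≠ j ∧
      ((symbMatrix (fun a : A => (a : F[X])) P)ᵀ *ᵥ v) i ≠ 0 ∧
      ((symbMatrix (fun a : A => (a : F[X])) P)ᵀ *ᵥ v) j ≠ 0) ↔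
      2 ≤ negCount T ((Finset.univ.filter fun a => v a = 1).image fun a : A => (a : F[X]))
        (A ∪ Finset.univ.image P) := by
    intro v
    rw [hneg, ← Nat.lt_iff_add_one_le, Finset.one_lt_card]
    simp only [key, Finset.mem_filter, Finset.mem_univ, true_and]
    constructor
    · rintro ⟨i, j, h1, h2, h3⟩
      exact ⟨i, h2, j, h3, h1⟩
    · rintro ⟨i, h2, j, h3, h1⟩
      exact ⟨i, j, h1, h2, h3⟩
  have h01 : ∀ z : ZMod 2, z ≠ 0 → z = 1 := by decide
  constructor
  · intro h c hc hne
    have hcv : (Finset.univ.filter fun a : A => (if (a : F[X]) ∈ c then (1 : ZMod 2) else 0) =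
        1).image (fun a : A => (a : F[X])) = c := by
      ext p
      simp only [Finset.mem_image, Finset.mem_filter, Finset.mem_univ, true_and]
      constructor
      · rintro ⟨a, ha, rfl⟩
        by_contra hn
        rw [if_neg hn] at ha
        exact absurd ha (by decide)
      · exact fun hp => ⟨⟨p, hc hp⟩, by rw [if_pos hp], rfl⟩
    have := (htwo fun a => if (a : F[X]) ∈ c then 1 else 0).1 (h _ fun h0 => by
      obtain ⟨p, hp⟩ := hne
      have := congrFun h0 ⟨p, hc hp⟩
      rw [if_pos hp] at this
      exact one_ne_zero this)
    rwa [hcv] at this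
  · intro h v hv
    refine (htwo v).2 (h _ ?_ ?_)
    · intro p hp
      obtain ⟨a, -, rfl⟩ := Finset.mem_image.1 hp
      exact a.2
    · obtain ⟨a, ha⟩ := Function.ne_iff.1 hv
      exact ⟨a, Finset.mem_image_of_mem _ (Finset.mem_filter.2 ⟨Finset.mem_univ _, h01 _ ha⟩)⟩

open Classical in
theorem card_filter_injective_piFinset {α : Type*} {m : ℕ} {B : Finset α} (hB : B.card = m) :
    ((Fintype.piFinset fun _ : Fin m => B).filter Function.Injective).card = m.factorial := by
  have h1 : Fintype.card (Fin m ↪ B) = m.factorial := by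
    rw [Fintype.card_embedding_eq, Fintype.card_coe, Fintype.card_fin, hB, Nat.descFactorial_self]
  rw [← h1, ← Finset.card_univ]
  symm
  refine Finset.card_bij (fun e _ k => (e k : α)) (fun e _ => ?_) (fun e _ e' _ h => ?_) ?_
  · exact Finset.mem_filter.2 ⟨Fintype.mem_piFinset.2 fun k => (e k).2,
      Subtype.val_injective.comp e.injective⟩
  · ext k
    exact congrFun h k
  · intro P hP
    obtain ⟨hP, hinj⟩ := Finset.mem_filter.1 hP
    rw [Fintype.mem_piFinset] at hP
    exact ⟨⟨fun k => ⟨P k, hP k⟩, fun k l h => hinj (congrArg Subtype.val h)⟩,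
      Finset.mem_univ _, rfl⟩

/-- The sets of primes of total degree `d` with few tiny members, spread residue symbols, and at
most `K` members. -/
noncomputable def goodSets (F : Type) [Field F] [Fintype F] (T M K d : ℕ) : Finset (Finset F[X]) :=
  open Classical in
  (primeSets F d).filter fun S => S.card ≤ K ∧ (tinyPart T S).card + M + 1 ≤ (largePart T S).card ∧
    ∀ c ⊆ tinyPart T S, c.Nonempty → 2 ≤ negCount T c S

open Classical in
theorem mem_spreadTuples_iff (h4 : Fintype.card F % 4 = 1) {A : Finset F[X]} {T M K m d D : ℕ}
    (hA : ∀ p ∈ A, p.Monic ∧ Irreducible p ∧ p.natDegree ≤ T) (hD : wt A + D = d)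
    (hm : A.card + M + 1 ≤ m) (hK : A.card + m ≤ K) {P : Fin m → F[X]} :
    P ∈ spreadTuples A T m D ↔ Function.Injective P ∧ (∀ k, T < (P k).natDegree) ∧
      A ∪ Finset.univ.image P ∈ goodSets F T M K d := by
  rw [mem_spreadTuples, goodSets, Finset.mem_filter, mem_primeSets]
  have hwt : Function.Injective P → (∀ k, T < (P k).natDegree) →
      wt (A ∪ Finset.univ.image P) = wt A + ∑ k, (P k).natDegree ∧
      (A ∪ Finset.univ.image P).card = A.card + m := by
    intro hinj hT
    have hdis : Disjoint A (Finset.univ.image P) := by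
      rw [Finset.disjoint_left]
      intro p hp hp'
      obtain ⟨k, -, rfl⟩ := Finset.mem_image.1 hp'
      exact absurd (hA _ hp).2.2 (not_le.2 (hT k))
    constructor
    · rw [wt, Finset.sum_union hdis, Finset.sum_image fun x _ y _ h => hinj h]
      rfl
    · rw [Finset.card_union_of_disjoint hdis, Finset.card_image_of_injective _ hinj,
        Finset.card_univ, Fintype.card_fin]
  constructor
  · rintro ⟨h1, h2, h3, h4'⟩
    have hT : ∀ k, T < (P k).natDegree := fun k => (h1 k).2.2
    obtain ⟨e1, e2⟩ := hwt h2 hT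
    obtain ⟨e3, e4⟩ := tinyPart_union_image (fun p hp => (hA p hp).2.2) hT
    refine ⟨h2, hT, ⟨⟨fun p hp => ?_, ?_⟩, ?_, ?_, ?_⟩⟩
    · rcases Finset.mem_union.1 hp with h | h
      · exact ⟨(hA p h).1, (hA p h).2.1⟩
      · obtain ⟨k, -, rfl⟩ := Finset.mem_image.1 h
        exact ⟨(h1 k).1, (h1 k).2.1⟩
    · rw [e1, h3, hD]
    · rw [e2]; exact hK
    · rw [e3, e4, Finset.card_image_of_injective _ h2, Finset.card_univ, Fintype.card_fin]
      exact hm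
    · rw [e3]
      exact (hasSpread_iff h4 hA h1 h2).1 h4'
  · rintro ⟨h2, hT, ⟨⟨g1, g2⟩, -, -, g3⟩⟩
    obtain ⟨e1, e2⟩ := hwt h2 hT
    obtain ⟨e3, e4⟩ := tinyPart_union_image (fun p hp => (hA p hp).2.2) hT
    have h1 : ∀ k, (P k).Monic ∧ Irreducible (P k) ∧ T < (P k).natDegree := fun k => by
      have := g1 (P k) (Finset.mem_union_right _ (Finset.mem_image_of_mem _ (Finset.mem_univ k)))
      exact ⟨this.1, this.2, hT k⟩
    refine ⟨h1, h2, by omega, ?_⟩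
    rw [e3] at g3
    exact (hasSpread_iff h4 hA h1 h2).2 g3

open Classical in
theorem card_filter_spreadTuples (h4 : Fintype.card F % 4 = 1) {A : Finset F[X]}
    {T M K m d D : ℕ} (hA : ∀ p ∈ A, p.Monic ∧ Irreducible p ∧ p.natDegree ≤ T)
    (hD : wt A + D = d) (hm : A.card + M + 1 ≤ m) (hK : A.card + m ≤ K)
    (Q : Finset F[X] → Prop) :
    ((spreadTuples A T m D).filter fun P => Q (A ∪ Finset.univ.image P)).card =
      (((goodSets F T M K d).filter fun S => tinyPart T S = A ∧ (largePart T S).card = m).filter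
        Q).card * m.factorial := by
  rw [Finset.card_eq_sum_card_fiberwise (f := fun P => A ∪ Finset.univ.image P)
    (t := ((goodSets F T M K d).filter fun S => tinyPart T S = A ∧
      (largePart T S).card = m).filter Q), ← smul_eq_mul, ← Finset.sum_const]
  · refine Finset.sum_congr rfl fun S hS => ?_
    simp only [Finset.mem_filter] at hS
    obtain ⟨⟨hS, htiny, hlarge⟩, hQ⟩ := hS
    rw [← card_filter_injective_piFinset hlarge]
    congr 1
    ext P
    simp only [Finset.mem_filter, mem_spreadTuples_iff h4 hA hD hm hK, Fintype.mem_piFinset]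
    have hAS : A ∪ largePart T S = S := by
      rw [← htiny]
      exact Finset.filter_union_filter_not_eq _ _
    constructor
    · rintro ⟨⟨⟨h1, h2, h3⟩, -⟩, h5⟩
      refine ⟨fun k => ?_, h1⟩
      rw [← h5, (tinyPart_union_image (fun p hp => (hA p hp).2.2) h2).2]
      exact Finset.mem_image_of_mem _ (Finset.mem_univ k)
    · rintro ⟨h1, h2⟩
      have himg : Finset.univ.image P = largePart T S := by
        refine Finset.eq_of_subset_of_card_le (Finset.image_subset_iff.2 fun k _ => h1 k) ?_
        rw [Finset.card_image_of_injective _ h2, Finset.card_univ, Fintype.card_fin, hlarge]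
      rw [himg, hAS]
      exact ⟨⟨⟨h2, fun k => not_le.1 (Finset.mem_filter.1 (h1 k)).2, hS⟩, hQ⟩, rfl⟩
  · intro P hP
    have hP := Finset.mem_filter.1 hP
    obtain ⟨h1, h2, h3⟩ := (mem_spreadTuples_iff h4 hA hD hm hK).1 hP.1
    obtain ⟨e3, e4⟩ := tinyPart_union_image (fun p hp => (hA p hp).2.2) h2
    refine Finset.mem_filter.2 ⟨Finset.mem_filter.2 ⟨h3, e3, ?_⟩, hP.2⟩
    rw [e4, Finset.card_image_of_injective _ h1, Finset.card_univ, Fintype.card_fin]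

end FourRank

namespace FourRank

variable {F : Type} [Field F] [Fintype F]

open Classical in
/-- The condition that exactly `2 ^ (r + 1)` subsets of `S` are residual. -/
def HasResidualRank (r : ℕ) (S : Finset F[X]) : Prop :=
  (S.powerset.filter fun U => IsResidual S U).card = 2 ^ (r + 1)

open Classical in
theorem abs_card_cell_sub_le (h4 : Fintype.card F % 4 = 1) {r M : ℕ} {μ ε : ℝ}
    (hμ : ∀ N, M ≤ N → |(symCount (Fin N) r : ℝ) / symTotal (Fin N) - μ| ≤ ε)
    {m t K d : ℕ} {A : Finset F[X]}
    (hA : ∀ p ∈ A, p.Monic ∧ Irreducible p ∧ p.natDegree ≤ 4 * t) (hd : wt A ≤ d)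
    (hm : A.card + M + 1 ≤ m) (hK : A.card + m ≤ K) :
    |((((goodSets F (4 * t) M K d).filter fun S => tinyPart (4 * t) S = A ∧
        (largePart (4 * t) S).card = m).filter (HasResidualRank r)).card : ℝ) -
      μ * ((goodSets F (4 * t) M K d).filter fun S => tinyPart (4 * t) S = A ∧
        (largePart (4 * t) S).card = m).card| ≤
      ε * ((goodSets F (4 * t) M K d).filter fun S => tinyPart (4 * t) S = A ∧
        (largePart (4 * t) S).card = m).card +
      ((d : ℝ) + 1) ^ K * (2 ^ (K * K) * 2 ^ (K * K)) *
        (4 * (Fintype.card F : ℝ) ^ d / (Fintype.card F : ℝ) ^ t) * ∏ p ∈ A, iv p := by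
  obtain ⟨D, hD⟩ := Nat.exists_eq_add_of_le hd
  have hq : (1 : ℝ) ≤ Fintype.card F := by exact_mod_cast Fintype.card_pos
  have h1 : |((((spreadTuples A (4 * t) m D).filter fun P =>
      HasResidualRank r (A ∪ Finset.univ.image P)).card : ℕ) : ℝ) -
        μ * (spreadTuples A (4 * t) m D).card| ≤ ε * (spreadTuples A (4 * t) m D).card +
      ((D : ℝ) + 1) ^ m * 2 ^ (A.card * m) *
        (2 ^ (m * m) * (4 * (Fintype.card F : ℝ) ^ D / (Fintype.card F : ℝ) ^ t)) := by
    convert abs_card_spreadTuples_sub_le (D := D) h4 hμ hA hm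
    exact Iff.rfl
  have h2 := card_filter_spreadTuples h4 hA hD.symm hm hK (HasResidualRank r)
  have h3 := card_filter_spreadTuples h4 hA hD.symm hm hK fun _ => True
  rw [Finset.filter_true, Finset.filter_true] at h3
  rw [h2, h3] at h1
  set a := (((goodSets F (4 * t) M K d).filter fun S => tinyPart (4 * t) S = A ∧
        (largePart (4 * t) S).card = m).filter (HasResidualRank r)).card
  set c := ((goodSets F (4 * t) M K d).filter fun S => tinyPart (4 * t) S = A ∧
        (largePart (4 * t) S).card = m).card
  have hf : (1 : ℝ) ≤ m.factorial := by exact_mod_cast m.factorial_pos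
  have hE : ((D : ℝ) + 1) ^ m * 2 ^ (A.card * m) *
      (2 ^ (m * m) * (4 * (Fintype.card F : ℝ) ^ D / (Fintype.card F : ℝ) ^ t)) ≤
      ((d : ℝ) + 1) ^ K * (2 ^ (K * K) * 2 ^ (K * K)) *
        (4 * (Fintype.card F : ℝ) ^ d / (Fintype.card F : ℝ) ^ t) * ∏ p ∈ A, iv p := by
    have hDd : (D : ℝ) ≤ d := by exact_mod_cast (by omega : D ≤ d)
    have e1 : ((D : ℝ) + 1) ^ m ≤ ((d : ℝ) + 1) ^ K :=
      (pow_le_pow_left₀ (by positivity) (by linarith) m).trans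
        (pow_le_pow_right₀ (by linarith [Nat.cast_nonneg (α := ℝ) d]) (by omega))
    have e2 : (2 : ℝ) ^ (A.card * m) ≤ 2 ^ (K * K) :=
      pow_le_pow_right₀ one_le_two (Nat.mul_le_mul (by omega) (by omega))
    have e3 : (2 : ℝ) ^ (m * m) ≤ 2 ^ (K * K) :=
      pow_le_pow_right₀ one_le_two (Nat.mul_le_mul (by omega) (by omega))
    have e4 : (Fintype.card F : ℝ) ^ D = (Fintype.card F : ℝ) ^ d * ∏ p ∈ A, iv p := by
      rw [prod_iv, hD, pow_add]
      field_simp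
    rw [e4]
    calc _ ≤ ((d : ℝ) + 1) ^ K * 2 ^ (K * K) * (2 ^ (K * K) *
          (4 * ((Fintype.card F : ℝ) ^ d * ∏ p ∈ A, iv p) / (Fintype.card F : ℝ) ^ t)) := by
          have : (0 : ℝ) ≤ ∏ p ∈ A, iv p := by
            rw [prod_iv]
            positivity
          gcongr
      _ = _ := by ring
  generalize ((d : ℝ) + 1) ^ K * (2 ^ (K * K) * 2 ^ (K * K)) *
        (4 * (Fintype.card F : ℝ) ^ d / (Fintype.card F : ℝ) ^ t) * ∏ p ∈ A, iv p = E at hE ⊢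
  have h5 := h1.trans (add_le_add_right hE _)
  have hE0 : 0 ≤ E := le_trans (by positivity) hE
  push_cast at h5
  rw [show (a : ℝ) * m.factorial - μ * (c * m.factorial) = (a - μ * c) * m.factorial by ring,
    abs_mul, abs_of_pos (by linarith : (0 : ℝ) < m.factorial)] at h5
  have h6 : |(a : ℝ) - μ * c| * m.factorial ≤ (ε * c + E) * m.factorial := by
    nlinarith
  exact le_of_mul_le_mul_right h6 (by linarith)

open Classical in
theorem abs_card_goodSets_sub_le (h4 : Fintype.card F % 4 = 1) {r M : ℕ} {μ ε : ℝ}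
    (hμ : ∀ N, M ≤ N → |(symCount (Fin N) r : ℝ) / symTotal (Fin N) - μ| ≤ ε) (t K d : ℕ) :
    |(((goodSets F (4 * t) M K d).filter (HasResidualRank r)).card : ℝ) -
      μ * (goodSets F (4 * t) M K d).card| ≤ ε * (goodSets F (4 * t) M K d).card +
      ((K : ℝ) + 1) * (((d : ℝ) + 1) ^ K * (2 ^ (K * K) * 2 ^ (K * K)) *
        (4 * (Fintype.card F : ℝ) ^ d / (Fintype.card F : ℝ) ^ t) *
          Real.exp (1 + Real.log (4 * t : ℕ))) := by
  set G := goodSets F (4 * t) M K d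
  set I := (primesLE F (4 * t)).powerset ×ˢ Finset.range (K + 1)
  set C := ((d : ℝ) + 1) ^ K * (2 ^ (K * K) * 2 ^ (K * K)) *
        (4 * (Fintype.card F : ℝ) ^ d / (Fintype.card F : ℝ) ^ t)
  have hC : 0 ≤ C := by positivity
  let cell : Finset F[X] × ℕ → Finset (Finset F[X]) := fun x =>
    G.filter fun S => tinyPart (4 * t) S = x.1 ∧ (largePart (4 * t) S).card = x.2
  have hcard : ∀ S ∈ G, (tinyPart (4 * t) S).card + (largePart (4 * t) S).card = S.card := by
    intro S _
    exact Finset.card_filter_add_card_filter_not _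
  have hmaps : ∀ S ∈ G, (tinyPart (4 * t) S, (largePart (4 * t) S).card) ∈ I := by
    intro S hS
    have h1 := Finset.mem_filter.1 hS
    have h2 := hcard S hS
    refine Finset.mem_product.2 ⟨Finset.mem_powerset.2 fun p hp => ?_,
      Finset.mem_range.2 (by omega)⟩
    have hp := Finset.mem_filter.1 hp
    have := (mem_primeSets.1 h1.1).1 p hp.1
    exact (mem_primesLE F).2 ⟨this.1, this.2, hp.2⟩
  have e1 : (G.card : ℝ) = ∑ x ∈ I, ((cell x).card : ℝ) := by
    rw [Finset.card_eq_sum_card_fiberwise (t := I) hmaps, Nat.cast_sum]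
    simp only [Prod.ext_iff, cell]
  have e2 : ((G.filter (HasResidualRank r)).card : ℝ) =
      ∑ x ∈ I, (((cell x).filter (HasResidualRank r)).card : ℝ) := by
    rw [Finset.card_eq_sum_card_fiberwise (s := G.filter (HasResidualRank r)) (t := I)
      fun S hS => hmaps S (Finset.mem_filter.1 hS).1, Nat.cast_sum]
    simp only [Prod.ext_iff, cell, Finset.filter_filter, and_comm]
  have hcell : ∀ x ∈ I, |(((cell x).filter (HasResidualRank r)).card : ℝ) - μ * (cell x).card| ≤
      ε * (cell x).card + C * ∏ p ∈ x.1, iv p := by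
    intro x hx
    rcases (cell x).eq_empty_or_nonempty with h0 | ⟨S, hS⟩
    · rw [h0]
      have : (0 : ℝ) ≤ ∏ p ∈ x.1, iv p := by
        rw [prod_iv]
        positivity
      simpa using mul_nonneg hC this
    · obtain ⟨hSG, h1, h2⟩ := Finset.mem_filter.1 hS
      obtain ⟨h3, h5, h6, -⟩ := Finset.mem_filter.1 hSG
      have h7 := hcard S hSG
      rw [h1, h2] at h6 h7
      refine abs_card_cell_sub_le h4 hμ (fun p hp => ?_) ?_ h6 (by omega)
      · exact (mem_primesLE F).1 (Finset.mem_powerset.1 (Finset.mem_product.1 hx).1 hp)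
      · rw [← (mem_primeSets.1 h3).2, ← h1]
        exact Finset.sum_le_sum_of_subset (Finset.filter_subset _ _)
  have hsum : ∑ x ∈ I, ∏ p ∈ x.1, iv p ≤ ((K : ℝ) + 1) * Real.exp (1 + Real.log (4 * t : ℕ)) := by
    rw [Finset.sum_product_right]
    simp only [Finset.sum_const, Finset.card_range, nsmul_eq_mul]
    push_cast
    gcongr
    exact (sum_powerset_prod_le_exp _ _ fun p hp => (iv_pos p).le).trans
      (Real.exp_le_exp.2 (by exact_mod_cast sum_iv_primesLE_le (F := F) (4 * t)))
  rw [e1, e2, Finset.mul_sum, ← Finset.sum_sub_distrib]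
  calc _ ≤ ∑ x ∈ I, (ε * (cell x).card + C * ∏ p ∈ x.1, iv p) :=
        (Finset.abs_sum_le_sum_abs _ _).trans (Finset.sum_le_sum hcell)
    _ = ε * ∑ x ∈ I, ((cell x).card : ℝ) + C * ∑ x ∈ I, ∏ p ∈ x.1, iv p := by
        rw [Finset.sum_add_distrib, Finset.mul_sum, Finset.mul_sum]
    _ ≤ _ := by
        rw [show ((K : ℝ) + 1) * (C * Real.exp (1 + Real.log (4 * t : ℕ))) =
          C * (((K : ℝ) + 1) * Real.exp (1 + Real.log (4 * t : ℕ))) by ring]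
        gcongr

end FourRank

namespace FourRank

variable {F : Type} [Field F] [Fintype F]

/-- The proportion of sets of primes of total degree `d` that are not good, up to a factor. -/
noncomputable def badBound (t M K d : ℕ) : ℝ :=
  (2 ^ (M + 1) * (2 * Real.exp (2 * (1 + Real.log (4 * t : ℕ)) + 1 / 2 * (1 + Real.log d)))) / d +
    2 * Real.exp (2 * (1 + Real.log d)) / (2 ^ K * d) +
    2 * (Real.exp (1 + Real.log (4 * t : ℕ)) ^ 2 * ((2 + Real.log d) *
      Real.sqrt ((d + 1) * (4 * t * K : ℕ) * Real.exp (1 / 2 * (1 + Real.log d))))) / d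

open Classical in
theorem card_primeSets_sdiff_goodSets_le (h4 : Fintype.card F % 4 = 1) {t M K d : ℕ}
    (hd : 0 < d) (hTK : 2 * (4 * t * K) ≤ d) :
    ((primeSets F d \ goodSets F (4 * t) M K d).card : ℝ) ≤
      (Fintype.card F : ℝ) ^ d * badBound t M K d := by
  have hd' : (0 : ℝ) < d := by exact_mod_cast hd
  have h1 := mul_card_largePart_lt_le (F := F) d (4 * t) (M + 1)
  have h2 := mul_card_lt_card_le (F := F) d K
  obtain ⟨B3, hB3, h3⟩ : ∃ B : Finset (Finset F[X]), (∀ S, S ∈ B ↔ S ∈ primeSets F d ∧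
      S.card ≤ K ∧ ∃ c ⊆ tinyPart (4 * t) S, c.Nonempty ∧ negCount (4 * t) c S ≤ 1) ∧
      (d : ℝ) * B.card ≤ 2 * (Fintype.card F : ℝ) ^ d * (Real.exp (1 + Real.log (4 * t : ℕ)) ^ 2 *
        ((2 + Real.log d) *
          Real.sqrt ((d + 1) * (4 * t * K : ℕ) * Real.exp (1 / 2 * (1 + Real.log d))))) :=
    ⟨_, fun S => Finset.mem_filter, mul_card_negCount_le_one_le (F := F) h4 hTK⟩
  set B1 := (primeSets F d).filter fun S =>
    (largePart (4 * t) S).card < (tinyPart (4 * t) S).card + (M + 1)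
  set B2 := (primeSets F d).filter fun S => K < S.card
  have hsub : primeSets F d \ goodSets F (4 * t) M K d ⊆ (B1 ∪ B2) ∪ B3 := by
    intro S hS
    rw [Finset.mem_sdiff, goodSets, Finset.mem_filter] at hS
    obtain ⟨hS, hn⟩ := hS
    by_cases c1 : (largePart (4 * t) S).card < (tinyPart (4 * t) S).card + (M + 1)
    · exact Finset.mem_union_left _ (Finset.mem_union_left _ (Finset.mem_filter.2 ⟨hS, c1⟩))
    by_cases c2 : K < S.card
    · exact Finset.mem_union_left _ (Finset.mem_union_right _ (Finset.mem_filter.2 ⟨hS, c2⟩))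
    refine Finset.mem_union_right _ ((hB3 S).2 ⟨hS, not_lt.1 c2, ?_⟩)
    by_contra hc
    refine hn ⟨hS, not_lt.1 c2, by omega, fun c hcS hne => ?_⟩
    by_contra hlt
    exact hc ⟨c, hcS, hne, by omega⟩
  have hcard : ((primeSets F d \ goodSets F (4 * t) M K d).card : ℝ) ≤
      B1.card + B2.card + B3.card := by
    exact_mod_cast (Finset.card_le_card hsub).trans ((Finset.card_union_le _ _).trans
      (Nat.add_le_add_right (Finset.card_union_le _ _) _))
  refine hcard.trans ?_
  rw [badBound, mul_add, mul_add]
  refine add_le_add (add_le_add ?_ ?_) ?_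
  · rw [mul_div_assoc', le_div_iff₀ hd']
    linarith
  · rw [mul_div_assoc', le_div_iff₀ (by positivity)]
    linarith
  · rw [mul_div_assoc', le_div_iff₀ hd']
    linarith

open Classical in
theorem abs_card_primeSets_sub_le (h4 : Fintype.card F % 4 = 1) (h5 : 5 ≤ Fintype.card F)
    {r M : ℕ} {μ ε : ℝ}
    (hμ : ∀ N, M ≤ N → |(symCount (Fin N) r : ℝ) / symTotal (Fin N) - μ| ≤ ε) {t K d : ℕ}
    (hd : 0 < d) (hTK : 2 * (4 * t * K) ≤ d) :
    |(((primeSets F d).filter (HasResidualRank r)).card : ℝ) - μ * (primeSets F d).card| ≤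
      (Fintype.card F : ℝ) ^ d * (ε + ((K : ℝ) + 1) * (((d : ℝ) + 1) ^ K *
        (2 ^ (K * K) * 2 ^ (K * K)) * (4 / 4 ^ t) * Real.exp (1 + Real.log (4 * t : ℕ))) +
        (1 + |μ|) * badBound t M K d) := by
  have hε : 0 ≤ ε := (abs_nonneg _).trans (hμ M le_rfl)
  have hq : (4 : ℝ) ≤ Fintype.card F := by exact_mod_cast (by omega : 4 ≤ Fintype.card F)
  have h1 := abs_card_goodSets_sub_le h4 hμ t K d
  have h2 := card_primeSets_sdiff_goodSets_le h4 (M := M) hd hTK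
  have hsub : goodSets F (4 * t) M K d ⊆ primeSets F d := Finset.filter_subset _ _
  have h3 : ((primeSets F d).card : ℝ) = (goodSets F (4 * t) M K d).card +
      (primeSets F d \ goodSets F (4 * t) M K d).card := by
    rw [← Nat.cast_add, add_comm, Finset.card_sdiff_add_card_eq_card hsub]
  have h6 : (((primeSets F d).filter (HasResidualRank r)).card : ℝ) =
      ((goodSets F (4 * t) M K d).filter (HasResidualRank r)).card +
      ((primeSets F d \ goodSets F (4 * t) M K d).filter (HasResidualRank r)).card := by
    rw [← Nat.cast_add, ← Finset.card_union_of_disjoint, ← Finset.filter_union,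
      Finset.union_sdiff_of_subset hsub]
    exact Finset.disjoint_filter_filter Finset.disjoint_sdiff
  have h7 : (((primeSets F d \ goodSets F (4 * t) M K d).filter (HasResidualRank r)).card : ℝ) ≤
      (primeSets F d \ goodSets F (4 * t) M K d).card := by
    exact_mod_cast Finset.card_filter_le _ _
  have h8 : ((goodSets F (4 * t) M K d).card : ℝ) ≤ (Fintype.card F : ℝ) ^ d := by
    exact_mod_cast (Finset.card_le_card hsub).trans (card_primeSets_le d)
  have h9 : (4 : ℝ) * (Fintype.card F : ℝ) ^ d / (Fintype.card F : ℝ) ^ t ≤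
      (Fintype.card F : ℝ) ^ d * (4 / 4 ^ t) := by
    rw [mul_comm (4 : ℝ), mul_div_assoc]
    gcongr
  have h10 : ((K : ℝ) + 1) * (((d : ℝ) + 1) ^ K * (2 ^ (K * K) * 2 ^ (K * K)) *
        (4 * (Fintype.card F : ℝ) ^ d / (Fintype.card F : ℝ) ^ t) *
          Real.exp (1 + Real.log (4 * t : ℕ))) ≤ (Fintype.card F : ℝ) ^ d *
      (((K : ℝ) + 1) * (((d : ℝ) + 1) ^ K * (2 ^ (K * K) * 2 ^ (K * K)) * (4 / 4 ^ t) *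
        Real.exp (1 + Real.log (4 * t : ℕ)))) := by
    calc _ ≤ ((K : ℝ) + 1) * (((d : ℝ) + 1) ^ K * (2 ^ (K * K) * 2 ^ (K * K)) *
          ((Fintype.card F : ℝ) ^ d * (4 / 4 ^ t)) * Real.exp (1 + Real.log (4 * t : ℕ))) := by
          gcongr
      _ = _ := by ring
  rw [h3, h6]
  set x : ℝ := ((primeSets F d \ goodSets F (4 * t) M K d).card : ℝ)
  set y : ℝ := (((primeSets F d \ goodSets F (4 * t) M K d).filter (HasResidualRank r)).card : ℝ)
  have hy : 0 ≤ y := Nat.cast_nonneg _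
  set u : ℝ := (((goodSets F (4 * t) M K d).filter (HasResidualRank r)).card : ℝ)
  set v : ℝ := ((goodSets F (4 * t) M K d).card : ℝ)
  have h11 : |y - μ * x| ≤ (1 + |μ|) * x := by
    have hx : 0 ≤ x := hy.trans h7
    calc |y - μ * x| ≤ |y| + |μ * x| := abs_sub _ _
      _ = y + |μ| * x := by rw [abs_of_nonneg hy, abs_mul, abs_of_nonneg hx]
      _ ≤ _ := by linarith
  calc |u + y - μ * (v + x)| = |(u - μ * v) + (y - μ * x)| := by ring_nf
    _ ≤ |u - μ * v| + |y - μ * x| := abs_add_le _ _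
    _ ≤ _ := add_le_add (h1.trans (add_le_add (mul_le_mul_of_nonneg_left h8 hε) h10))
        (h11.trans (mul_le_mul_of_nonneg_left h2 (by positivity)))
    _ = _ := by ring

end FourRank

namespace FourRank

theorem natLog_bounds {d : ℕ} (hd : 0 < d) :
    ((d : ℝ) + 1 ≤ 2 ^ (Nat.log 2 d + 1)) ∧ (d : ℝ) ^ 2 ≤ 2 ^ (2 * (Nat.log 2 d + 1)) ∧
      Real.log d ≤ (Nat.log 2 d + 1 : ℕ) ∧ ((Nat.log 2 d + 1 : ℕ) : ℝ) ≤ 1 + 2 * Real.log d := by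
  have hd' : (0 : ℝ) < d := by exact_mod_cast hd
  have h1 : (d : ℝ) + 1 ≤ 2 ^ (Nat.log 2 d + 1) := by
    exact_mod_cast Nat.lt_pow_succ_log_self one_lt_two d
  refine ⟨h1, ?_, ?_, ?_⟩
  · rw [mul_comm, pow_mul]
    exact pow_le_pow_left₀ hd'.le (by linarith) 2
  · have := Real.log_le_log hd' (by linarith : (d : ℝ) ≤ 2 ^ (Nat.log 2 d + 1))
    rw [Real.log_pow] at this
    have h2 : Real.log 2 ≤ 1 := by linarith [Real.log_two_lt_d9]
    have h3 := mul_le_mul_of_nonneg_left h2 (Nat.cast_nonneg (α := ℝ) (Nat.log 2 d + 1))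
    linarith
  · have h2 : ((2 : ℝ) ^ Nat.log 2 d) ≤ d := by
      exact_mod_cast Nat.pow_log_le_self 2 hd.ne'
    have h3 := Real.log_le_log (by positivity) h2
    rw [Real.log_pow] at h3
    have h4 : 1 / 2 ≤ Real.log 2 := by linarith [Real.log_two_gt_d9]
    have h5 := mul_le_mul_of_nonneg_left h4 (Nat.cast_nonneg (α := ℝ) (Nat.log 2 d))
    push_cast
    linarith

theorem mainError_le {d L : ℕ} {x : ℝ} (hx : 1 ≤ x) (hxd : x ^ 4 = d) (hL : 0 < L)
    (hdL : (d : ℝ) + 1 ≤ 2 ^ L) :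
    (((2 * L : ℕ) : ℝ) + 1) * (((d : ℝ) + 1) ^ (2 * L) *
      (2 ^ (2 * L * (2 * L)) * 2 ^ (2 * L * (2 * L))) * (4 / 4 ^ (12 * L ^ 2)) *
        Real.exp (1 + Real.log (4 * (12 * L ^ 2) : ℕ))) ≤
      576 * Real.exp 1 * ((L : ℝ) ^ 8 / x) := by
  have hL1 : (1 : ℝ) ≤ L := by exact_mod_cast hL
  have hx4 : x ≤ x ^ 4 := le_self_pow₀ hx (by norm_num)
  have e1 : Real.exp (1 + Real.log (4 * (12 * L ^ 2) : ℕ)) = Real.exp 1 * (48 * (L : ℝ) ^ 2) := by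
    rw [Real.exp_add, Real.exp_log (by positivity)]
    push_cast
    ring
  have e2 : ((d : ℝ) + 1) ^ (2 * L) * (2 ^ (2 * L * (2 * L)) * 2 ^ (2 * L * (2 * L))) *
      (4 / 4 ^ (12 * L ^ 2)) ≤ 4 / x := by
    have h1 : ((d : ℝ) + 1) ^ (2 * L) ≤ 2 ^ (2 * L ^ 2) := by
      refine (pow_le_pow_left₀ (by positivity) hdL _).trans (le_of_eq ?_)
      rw [← pow_mul]
      ring_nf
    have h2 : x ≤ 2 ^ (14 * L ^ 2) := by
      have h3 : (2 : ℝ) ^ L ≤ 2 ^ (14 * L ^ 2) := pow_le_pow_right₀ one_le_two (by nlinarith)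
      linarith
    have h4 : (4 : ℝ) ^ (12 * L ^ 2) =
        2 ^ (2 * L ^ 2) * (2 ^ (2 * L * (2 * L)) * 2 ^ (2 * L * (2 * L))) * 2 ^ (14 * L ^ 2) := by
      rw [show (4 : ℝ) = 2 ^ 2 by norm_num, ← pow_mul, ← pow_add, ← pow_add, ← pow_add]
      ring_nf
    rw [mul_div_assoc', div_le_div_iff₀ (by positivity) (by linarith), h4]
    calc _ ≤ (2 : ℝ) ^ (2 * L ^ 2) * (2 ^ (2 * L * (2 * L)) * 2 ^ (2 * L * (2 * L))) * 4 *
          2 ^ (14 * L ^ 2) := by gcongr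
      _ = _ := by ring
  rw [e1]
  have e3 : ((2 * L : ℕ) : ℝ) + 1 ≤ 3 * L := by
    push_cast
    linarith
  have e4 : (L : ℝ) ^ 3 ≤ L ^ 8 := pow_le_pow_right₀ hL1 (by norm_num)
  calc _ ≤ (3 * (L : ℝ)) * (4 / x * (Real.exp 1 * (48 * (L : ℝ) ^ 2))) := by gcongr
    _ = 576 * Real.exp 1 * ((L : ℝ) ^ 3 / x) := by ring
    _ ≤ _ := by gcongr

theorem badBound_le (M : ℕ) {d L : ℕ} {x : ℝ} (hx : 1 ≤ x) (hxd : x ^ 4 = d) (hL : 0 < L)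
    (hlog : Real.log d ≤ L) (hdL : (d : ℝ) ^ 2 ≤ 2 ^ (2 * L)) :
    badBound (12 * L ^ 2) M (2 * L) d ≤
      (2 ^ (M + 1) * (2 * (48 ^ 2 * Real.exp 1 ^ 3)) + 2 * Real.exp 1 ^ 2 +
        2 * (48 ^ 2 * Real.exp 1 ^ 2 * (3 * (192 * Real.exp 1)))) * ((L : ℝ) ^ 8 / x) := by
  have hL1 : (1 : ℝ) ≤ L := by exact_mod_cast hL
  have hx0 : 0 < x := by linarith
  have hd1 : (1 : ℝ) ≤ d := hxd ▸ one_le_pow₀ hx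
  have hE : 1 ≤ Real.exp 1 := Real.one_le_exp zero_le_one
  have e1 : Real.exp (1 + Real.log (4 * (12 * L ^ 2) : ℕ)) = Real.exp 1 * (48 * (L : ℝ) ^ 2) := by
    rw [Real.exp_add, Real.exp_log (by positivity)]
    push_cast
    ring
  have e2 : Real.exp (1 / 2 * (1 + Real.log d)) ≤ Real.exp 1 * x ^ 2 := by
    rw [← hxd, Real.log_pow, show 1 / 2 * (1 + ((4 : ℕ) : ℝ) * Real.log x) =
      1 / 2 + 2 * Real.log x by push_cast; ring, Real.exp_add, two_mul (Real.log x), Real.exp_add,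
      Real.exp_log hx0, ← sq]
    exact mul_le_mul_of_nonneg_right (Real.exp_le_exp.2 (by norm_num)) (by positivity)
  have e3 : Real.exp (2 * (1 + Real.log d)) = Real.exp 1 ^ 2 * (d : ℝ) ^ 2 := by
    rw [two_mul (1 + Real.log d), Real.exp_add, Real.exp_add, Real.exp_log (by linarith)]
    ring
  have t1 : (2 ^ (M + 1) * (2 * Real.exp (2 * (1 + Real.log (4 * (12 * L ^ 2) : ℕ)) +
      1 / 2 * (1 + Real.log d)))) / d ≤
      2 ^ (M + 1) * (2 * (48 ^ 2 * Real.exp 1 ^ 3)) * ((L : ℝ) ^ 8 / x) := by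
    rw [Real.exp_add, two_mul (1 + Real.log (4 * (12 * L ^ 2) : ℕ)), Real.exp_add, e1]
    calc _ ≤ (2 ^ (M + 1) * (2 * (Real.exp 1 * (48 * (L : ℝ) ^ 2) *
          (Real.exp 1 * (48 * (L : ℝ) ^ 2)) * (Real.exp 1 * x ^ 2)))) / x ^ 4 := by
          rw [hxd]
          gcongr
      _ = 2 ^ (M + 1) * (2 * (48 ^ 2 * Real.exp 1 ^ 3)) * ((L : ℝ) ^ 4 / x ^ 2) := by
          field_simp
      _ ≤ _ := by
          have h1 : (L : ℝ) ^ 4 ≤ L ^ 8 := pow_le_pow_right₀ hL1 (by norm_num)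
          have h2 : x ≤ x ^ 2 := le_self_pow₀ hx (by norm_num)
          gcongr
  have t2 : 2 * Real.exp (2 * (1 + Real.log d)) / (2 ^ (2 * L) * d) ≤
      2 * Real.exp 1 ^ 2 * ((L : ℝ) ^ 8 / x) := by
    rw [e3]
    calc _ ≤ 2 * (Real.exp 1 ^ 2 * (d : ℝ) ^ 2) / ((d : ℝ) ^ 2 * d) := by gcongr
      _ = 2 * Real.exp 1 ^ 2 * (1 / (d : ℝ)) := by field_simp
      _ ≤ _ := by
          have h1 : (1 : ℝ) ≤ (L : ℝ) ^ 8 := one_le_pow₀ hL1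
          have h2 : x ≤ d := hxd ▸ le_self_pow₀ hx (by norm_num)
          gcongr
  have t3 : 2 * (Real.exp (1 + Real.log (4 * (12 * L ^ 2) : ℕ)) ^ 2 * ((2 + Real.log d) *
      Real.sqrt ((d + 1) * (4 * (12 * L ^ 2) * (2 * L) : ℕ) *
        Real.exp (1 / 2 * (1 + Real.log d))))) / d ≤
      2 * (48 ^ 2 * Real.exp 1 ^ 2 * (3 * (192 * Real.exp 1))) * ((L : ℝ) ^ 8 / x) := by
    have h1 : Real.sqrt ((d + 1) * (4 * (12 * L ^ 2) * (2 * L) : ℕ) *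
        Real.exp (1 / 2 * (1 + Real.log d))) ≤ 192 * Real.exp 1 * (L : ℝ) ^ 3 * x ^ 3 := by
      refine Real.sqrt_le_iff.2 ⟨by positivity, ?_⟩
      push_cast
      calc _ ≤ ((d : ℝ) + d) * (4 * (12 * (L : ℝ) ^ 2) * (2 * L)) * (Real.exp 1 * x ^ 2) := by
            gcongr
        _ = 192 * Real.exp 1 * (L : ℝ) ^ 3 * x ^ 6 * 1 := by
            rw [← hxd]
            ring
        _ ≤ 192 * Real.exp 1 * (L : ℝ) ^ 3 * x ^ 6 * (192 * Real.exp 1 * (L : ℝ) ^ 3) := by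
            gcongr
            have : (1 : ℝ) ≤ (L : ℝ) ^ 3 := one_le_pow₀ hL1
            have h4 : 1 ≤ 192 * Real.exp 1 := by linarith
            exact one_le_mul_of_one_le_of_one_le h4 this
        _ = _ := by ring
    have h2 : 2 + Real.log d ≤ 3 * L := by linarith
    rw [e1]
    calc _ ≤ 2 * ((Real.exp 1 * (48 * (L : ℝ) ^ 2)) ^ 2 * ((3 * L) *
          (192 * Real.exp 1 * (L : ℝ) ^ 3 * x ^ 3))) / x ^ 4 := by
          rw [hxd]
          gcongr
      _ = _ := by field_simp
  exact (add_le_add (add_le_add t1 t2) t3).trans (le_of_eq (by ring))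

theorem tendsto_natLog_pow_div (k : ℕ) {s : ℝ} (hs : 0 < s) :
    Filter.Tendsto (fun d : ℕ => ((Nat.log 2 d + 1 : ℕ) : ℝ) ^ k / (d : ℝ) ^ s) Filter.atTop
      (nhds 0) := by
  have h1 : Filter.Tendsto (fun y : ℝ => Real.log y ^ (k : ℝ) / y ^ s) Filter.atTop (nhds 0) :=
    (isLittleO_log_rpow_rpow_atTop (k : ℝ) hs).tendsto_div_nhds_zero
  have h2 := (h1.comp tendsto_natCast_atTop_atTop).const_mul ((3 : ℝ) ^ k)
  rw [mul_zero] at h2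
  refine squeeze_zero' (Filter.Eventually.of_forall fun d => by positivity) ?_ h2
  filter_upwards [Filter.eventually_ge_atTop 3] with d hd
  have h3 := (natLog_bounds (by omega : 0 < d)).2.2.2
  have h4 : 1 ≤ Real.log d := by
    rw [Real.le_log_iff_exp_le (by positivity)]
    have : (3 : ℝ) ≤ d := by exact_mod_cast hd
    linarith [Real.exp_one_lt_d9]
  simp only [Function.comp_apply, Real.rpow_natCast]
  rw [mul_div_assoc', ← mul_pow]
  gcongr
  linarith

end FourRank

namespace FourRank

variable {F : Type} [Field F] [Fintype F]

theorem tendsto_error (M : ℕ) (μ : ℝ) : Filter.Tendsto (fun d : ℕ =>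
    (576 * Real.exp 1 + (1 + |μ|) * (2 ^ (M + 1) * (2 * (48 ^ 2 * Real.exp 1 ^ 3)) +
      2 * Real.exp 1 ^ 2 + 2 * (48 ^ 2 * Real.exp 1 ^ 2 * (3 * (192 * Real.exp 1))))) *
      (((Nat.log 2 d + 1 : ℕ) : ℝ) ^ 8 / (d : ℝ) ^ (1 / 4 : ℝ))) Filter.atTop (nhds 0) := by
  have := (tendsto_natLog_pow_div 8 (by norm_num : (0 : ℝ) < 1 / 4)).const_mul
    (576 * Real.exp 1 + (1 + |μ|) * (2 ^ (M + 1) * (2 * (48 ^ 2 * Real.exp 1 ^ 3)) +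
      2 * Real.exp 1 ^ 2 + 2 * (48 ^ 2 * Real.exp 1 ^ 2 * (3 * (192 * Real.exp 1)))))
  rwa [mul_zero] at this

theorem eventually_natLog_cube_le :
    ∀ᶠ d : ℕ in Filter.atTop, 192 * (Nat.log 2 d + 1) ^ 3 ≤ d := by
  have := (tendsto_natLog_pow_div 3 one_pos).eventually_lt_const
    (by norm_num : (0 : ℝ) < 1 / 192)
  filter_upwards [this, Filter.eventually_ge_atTop 1] with d h hd
  have hd' : (0 : ℝ) < d := by exact_mod_cast hd
  rw [Real.rpow_one, div_lt_iff₀ hd'] at h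
  have h2 : 192 * ((Nat.log 2 d + 1 : ℕ) : ℝ) ^ 3 ≤ d := by linarith
  exact_mod_cast h2

open Classical in
theorem tendsto_card_filter_hasResidualRank_div (h4 : Fintype.card F % 4 = 1)
    (h5 : 5 ≤ Fintype.card F) {r : ℕ} {μ : ℝ}
    (hμ : Filter.Tendsto (fun N => (symCount (Fin N) r : ℝ) / symTotal (Fin N)) Filter.atTop
      (nhds μ)) :
    Filter.Tendsto (fun d => (((primeSets F d).filter (HasResidualRank r)).card : ℝ) /
      (primeSets F d).card) Filter.atTop (nhds μ) := by
  rw [Metric.tendsto_nhds]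
  intro e he
  obtain ⟨M, hM⟩ := Metric.tendsto_atTop.1 hμ (e / 4) (by linarith)
  have hM' : ∀ N, M ≤ N → |(symCount (Fin N) r : ℝ) / symTotal (Fin N) - μ| ≤ e / 4 :=
    fun N hN => (hM N hN).le
  filter_upwards [(tendsto_error M μ).eventually_lt_const (by linarith : 0 < e / 4),
    eventually_natLog_cube_le, Filter.eventually_ge_atTop 1] with d h1 h2 hd
  have hd' : (1 : ℝ) ≤ d := by exact_mod_cast hd
  obtain ⟨b1, b2, b3, -⟩ := natLog_bounds (by omega : 0 < d)
  have hx : 1 ≤ (d : ℝ) ^ (1 / 4 : ℝ) := Real.one_le_rpow hd' (by norm_num)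
  have hxd : ((d : ℝ) ^ (1 / 4 : ℝ)) ^ 4 = d := by
    rw [← Real.rpow_natCast, ← Real.rpow_mul (by linarith)]
    norm_num
  have hL : 0 < Nat.log 2 d + 1 := Nat.succ_pos _
  have a1 := mainError_le hx hxd hL b1
  have a2 := badBound_le M hx hxd hL b3 b2
  have h3 := abs_card_primeSets_sub_le h4 h5 hM' (t := 12 * (Nat.log 2 d + 1) ^ 2)
    (K := 2 * (Nat.log 2 d + 1)) (d := d) (by omega) (le_trans (le_of_eq (by ring)) h2)
  have h6 : (3 : ℝ) * (Fintype.card F : ℝ) ^ d ≤ 4 * (primeSets F d).card := by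
    exact_mod_cast three_mul_pow_le_card_primeSets h5 d
  have hq : (0 : ℝ) < (Fintype.card F : ℝ) ^ d := by
    have : (0 : ℝ) < Fintype.card F := by exact_mod_cast Fintype.card_pos
    positivity
  have hc : (0 : ℝ) < (primeSets F d).card := by linarith
  have a3 := mul_le_mul_of_nonneg_left a2 (by positivity : 0 ≤ 1 + |μ|)
  have h7 : |(((primeSets F d).filter (HasResidualRank r)).card : ℝ) -
      μ * (primeSets F d).card| ≤ (Fintype.card F : ℝ) ^ d * (e / 4 + e / 4) := by
    refine h3.trans (mul_le_mul_of_nonneg_left ?_ hq.le)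
    rw [add_mul, mul_assoc] at h1
    linarith
  rw [Real.dist_eq, div_sub' hc.ne', abs_div, abs_of_pos hc, div_lt_iff₀ hc, mul_comm _ μ]
  nlinarith

theorem hasResidualRank_iff_fourRankEq (h4 : Fintype.card F % 4 = 1) {d : ℕ} (hd : Odd d)
    {S : Finset F[X]} (hS : S ∈ primeSets F d) (r : ℕ) :
    HasResidualRank r S ↔ fourRankEq (∏ p ∈ S, p) r := by
  obtain ⟨h1, h2⟩ := mem_primeSets.1 hS
  refine (fourRankEq_prod_iff h4 h1 ?_ r).symm
  rwa [natDegree_prod_eq_wt h1, h2]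

open Classical in
theorem ratio_eq (h4 : Fintype.card F % 4 = 1) {d : ℕ} (hd : Odd d) (r : ℕ) :
    (Nat.card {f : F[X] // f.Monic ∧ Squarefree f ∧ f.natDegree = d ∧ fourRankEq f r} : ℝ) /
      (Nat.card {f : F[X] // f.Monic ∧ Squarefree f ∧ f.natDegree = d} : ℝ) =
    (((primeSets F d).filter (HasResidualRank r)).card : ℝ) / (primeSets F d).card := by
  have h2 := card_squarefree_eq (F := F) d fun _ => True
  simp only [and_true, Finset.filter_true] at h2
  rw [h2, card_squarefree_eq d fun f => fourRankEq f r]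
  congr 3
  exact Finset.filter_congr fun S hS => (hasResidualRank_iff_fourRankEq h4 hd hS r).symm

end FourRank

/-- **Distribution of the 4-rank for `q ≡ 1 (mod 4)`.**  Among monic squarefree polynomials
`f` of degree `d` over `F_q`, the proportion of those whose ideal class group of
`F_q[x][Y]/(Y² - f)` satisfies `#(2·Cl[4]) = 2^r` tends, as `d → ∞` through odd integers, to
`μ_S(r) = (2^{r(r-1)/2} / #GL_r(F_2)) · ∏_{k=0}^∞ (1 - 2^{-2k-1})`. -/
theorem fourRank_distribution_one_mod_four (q : ℕ) (F : Type) [Field F] [Fintype F]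
    (hq : Fintype.card F = q) (hq4 : q % 4 = 1) (r : ℕ) :
    Filter.Tendsto
      (fun d : ℕ =>
        (Nat.card {f : F[X] // f.Monic ∧ Squarefree f ∧ f.natDegree = d ∧ fourRankEq f r} : ℝ) /
          (Nat.card {f : F[X] // f.Monic ∧ Squarefree f ∧ f.natDegree = d} : ℝ))
      (Filter.atTop ⊓ Filter.principal {d : ℕ | Odd d})
      (nhds (((2 : ℝ) ^ (r * (r - 1) / 2) / (Nat.card (GL (Fin r) (ZMod 2)) : ℝ)) *
        ∏' k : ℕ, (1 - ((2 : ℝ) ^ (2 * k + 1))⁻¹))) := by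
  subst hq
  have h5 : 5 ≤ Fintype.card F := by
    have := Fintype.one_lt_card (α := F)
    omega
  refine ((FourRank.tendsto_card_filter_hasResidualRank_div hq4 h5
    (FourRank.tendsto_symCount r)).mono_left inf_le_left).congr' ?_
  rw [Filter.EventuallyEq, Filter.eventually_inf_principal]
  exact Filter.Eventually.of_forall fun d hd => (FourRank.ratio_eq hq4 hd r).symm
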